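/- Let s ∈ ℂ with Re(s) > −1/2. For every N ≥ 1, F_N(t) ≠ 0 for all t > 0, and likewise F_∞(t) ≠ 0 for all t > 0; consequently, for every N ∈ ℕ ∪ {∞} the function θ_N(τ) := τ · (d/dτ) log F_N(τ^{−1}) = −F_N′(τ^{−1})/(τ F_N(τ^{−1})) is well defined and twice continuously differentiable on (0,∞). Moreover, for every p ∈ {0,1,2} and every τ > 0, θ_N^{(p)}(τ) → θ_∞^{(p)}(τ) as N → ∞. -/

import Mathlib

noncomputable section

open Complex MeasureTheory Filter Set

/-- Rising Pochhammer symbol `(x)_n = x(x+1)⋯(x+n−1)`. -/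
def poch (x : ℂ) (n : ℕ) : ℂ := ∏ i ∈ Finset.range n, (x + i)

/-- Confluent hypergeometric series `₁F₁[r, q; z]`. -/
def oneF1 (r q z : ℂ) : ℂ := ∑' n : ℕ, poch r n / (poch q n * n.factorial) * z ^ n

/-- Terminating Gauss hypergeometric series `₂F₁[−m, b, c; z]`. -/
def twoF1neg (m : ℕ) (b c z : ℂ) : ℂ :=
  ∑ k ∈ Finset.range (m + 1),
    poch (-(m : ℂ)) k * poch b k / (poch c k * (k.factorial : ℂ)) * z ^ k

/-- The common prefactor `|2/x|^{Re s} e^{−i/x + π Im(s) Sgn(x)/2}`. -/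
def prefac (s : ℂ) (x : ℝ) : ℂ :=
  ((|2 / x| ^ s.re : ℝ) : ℂ) *
    Complex.exp (-Complex.I / (x : ℂ) + ((Real.pi * s.im * Real.sign x / 2 : ℝ) : ℂ))

/-- `P̃(x) = |2/x|^{Re s} e^{−i/x + π Im(s) Sgn(x)/2} ₁F₁[s, 2Re(s)+1; 2i/x]`. -/
def Ptilde (s : ℂ) (x : ℝ) : ℂ :=
  prefac s x * oneF1 s ((2 * s.re + 1 : ℝ) : ℂ) (2 * Complex.I / (x : ℂ))

/-- `Q(x) = (2/x)|2/x|^{Re s} e^{−i/x + π Im(s) Sgn(x)/2} ₁F₁[s+1, 2Re(s)+2; 2i/x]`. -/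
def Qfun (s : ℂ) (x : ℝ) : ℂ :=
  (2 / (x : ℂ)) * prefac s x * oneF1 (s + 1) ((2 * s.re + 2 : ℝ) : ℂ) (2 * Complex.I / (x : ℂ))

/-- The constant in front of the limiting kernel `K_∞`. -/
def cinf (s : ℂ) : ℂ :=
  (1 / (2 * (Real.pi : ℂ))) *
    (Complex.Gamma (s + 1) * Complex.Gamma ((starRingEnd ℂ) s + 1) /
      (Complex.Gamma ((2 * s.re + 1 : ℝ) : ℂ) * Complex.Gamma ((2 * s.re + 2 : ℝ) : ℂ)))

/-- The limiting kernel `K_∞`, as a complex number (it is in fact real). -/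
def KinfC (s : ℂ) (x y : ℝ) : ℂ :=
  if x = y then cinf s * (deriv (Ptilde s) x * Qfun s x - deriv (Qfun s) x * Ptilde s x)
  else cinf s * (Ptilde s x * Qfun s y - Qfun s x * Ptilde s y) / ((x : ℂ) - (y : ℂ))

/-- The limiting kernel `K_∞` (real-valued). -/
def Kinf (s : ℂ) (x y : ℝ) : ℝ := (KinfC s x y).re

/-- The generalized Cauchy weight `w_H` on `ℝ`. -/
def wH (s : ℂ) (N : ℕ) (x : ℝ) : ℝ :=
  (1 + x ^ 2) ^ (-s.re - (N : ℝ)) * Real.exp (2 * s.im * Complex.arg (1 + Complex.I * x))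

/-- The polynomial `p_{N−1}`. -/
def pPrev (s : ℂ) (N : ℕ) (x : ℝ) : ℂ :=
  ((x : ℂ) - Complex.I) ^ (N - 1) *
    twoF1neg (N - 1) (s + 1) ((2 * s.re + 2 : ℝ) : ℂ) (2 / (1 + Complex.I * (x : ℂ)))

/-- The polynomial `p̃_N`. -/
def pTil (s : ℂ) (N : ℕ) (x : ℝ) : ℂ :=
  ((x : ℂ) - Complex.I) ^ N *
    twoF1neg N s ((2 * s.re + 1 : ℝ) : ℂ) (2 / (1 + Complex.I * (x : ℂ)))

/-- The constant `C_{N,s}`. -/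
def CNs (s : ℂ) (N : ℕ) : ℂ :=
  (((2 : ℝ) ^ (2 * s.re) / Real.pi : ℝ) : ℂ) *
    (Complex.Gamma ((2 * s.re + N + 1 : ℝ) : ℂ) * Complex.Gamma (s + 1) *
        Complex.Gamma ((starRingEnd ℂ) s + 1) /
      (Complex.Gamma (N : ℂ) * Complex.Gamma ((2 * s.re + 1 : ℝ) : ℂ) *
        Complex.Gamma ((2 * s.re + 2 : ℝ) : ℂ)))

def phiN (s : ℂ) (N : ℕ) (x : ℝ) : ℂ := pTil s N x * (Real.sqrt (wH s N x) : ℂ)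

def psiN (s : ℂ) (N : ℕ) (x : ℝ) : ℂ := pPrev s N x * (Real.sqrt (wH s N x) : ℂ)

/-- The finite-`N` kernel `K_N` (complex form; extended to the diagonal by continuity,
i.e. by the Bernoulli–l'Hôpital expression). -/
def KNC (s : ℂ) (N : ℕ) (x y : ℝ) : ℂ :=
  if x = y then CNs s N * (deriv (phiN s N) x * psiN s N x - deriv (psiN s N) x * phiN s N x)
  else CNs s N * (phiN s N x * psiN s N y - psiN s N x * phiN s N y) / ((x : ℂ) - (y : ℂ))

/-- The finite-`N` kernel `K_N` (real-valued). -/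
def KN (s : ℂ) (N : ℕ) (x y : ℝ) : ℝ := (KNC s N x y).re

/-- The rescaled kernel `K_[N](x,y) = N · K_N(Nx, Ny)`. -/
def Kscaled (s : ℂ) (N : ℕ) (x y : ℝ) : ℝ := N * KN s N (N * x) (N * y)

/-- `P̃_N`. -/
def PtildeN (s : ℂ) (N : ℕ) (x : ℝ) : ℂ :=
  (((2 : ℝ) ^ s.re : ℝ) : ℂ) *
    (Real.sqrt (Real.Gamma (2 * s.re + N + 1) / (N * Real.Gamma N)) : ℂ) *
    pTil s N (N * x) * (Real.sqrt (wH s N (N * x)) : ℂ)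

/-- `Q_N`. -/
def QN (s : ℂ) (N : ℕ) (x : ℝ) : ℂ :=
  (((2 : ℝ) ^ (s.re + 1) : ℝ) : ℂ) *
    (Real.sqrt (N * Real.Gamma (2 * s.re + N + 1) / Real.Gamma N) : ℂ) *
    pPrev s N (N * x) * (Real.sqrt (wH s N (N * x)) : ℂ)

/-- `k`-point correlation function of a kernel. -/
def rhoK (K : ℝ → ℝ → ℝ) (k : ℕ) (x : Fin k → ℝ) : ℝ :=
  Matrix.det (Matrix.of fun i j => K (x i) (x j))

/-- The Fredholm determinant of a kernel restricted to `(t,∞)²`. -/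
def fredholmDet (K : ℝ → ℝ → ℝ) (t : ℝ) : ℝ :=
  1 + ∑' k : ℕ, ((-1 : ℝ) ^ (k + 1) / (k + 1).factorial) *
    ∫ x : Fin (k + 1) → ℝ in Set.univ.pi fun _ => Set.Ioi t, rhoK K (k + 1) x

/-- Mixed partial derivative `∂^{p+q}K/∂x^p∂y^q`. -/
def pderiv₂ (K : ℝ → ℝ → ℝ) (p q : ℕ) (x y : ℝ) : ℝ :=
  iteratedDeriv p (fun x' => iteratedDeriv q (fun y' => K x' y') y) x

/-- `F_{n,h,a}(x) = ₂F₁[−n, h, a; 2/(1+ix)]` (a terminating series). -/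
def Fnha (n : ℕ) (h : ℂ) (a : ℝ) (x : ℝ) : ℂ :=
  ∑' k : ℕ, poch (-(n : ℂ)) k * poch h k / (poch (a : ℂ) k * (k.factorial : ℂ)) *
    (2 / (1 + Complex.I * (x : ℂ))) ^ k

/-- `θ(τ) = τ (d/dτ) log F(τ⁻¹)`. -/
def thetaOf (F : ℝ → ℝ) (τ : ℝ) : ℝ := τ * deriv (fun u => Real.log (F u⁻¹)) τ

/-- Squared Vandermonde determinant `∏_{j<k} (x_j − x_k)²`. -/
def vandSq (N : ℕ) (x : Fin N → ℝ) : ℝ :=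
  ∏ p ∈ Finset.univ.filter fun p : Fin N × Fin N => p.1 < p.2, (x p.1 - x p.2) ^ 2

/-- `φ(x,y) = (f(x)g(y) − g(x)f(y))/(x−y)`, extended to the diagonal. -/
def phiFG (f g : ℝ → ℝ) (x y : ℝ) : ℝ :=
  if x = y then deriv f x * g x - deriv g x * f x else (f x * g y - g x * f y) / (x - y)

/-! ### Hadamard-type bounds for determinants -/

section Hadamard
open scoped Matrix ComplexOrder

/-- **Hadamard's inequality** for complex matrices with bounded entries. -/
theorem norm_det_le_of_norm_entry_le {k : ℕ} {A : Matrix (Fin k) (Fin k) ℂ} {C : ℝ}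
    (h : ∀ i j, ‖A i j‖ ≤ C) : ‖A.det‖ ^ 2 ≤ ((k : ℝ) * C ^ 2) ^ k := by
  rcases Nat.eq_zero_or_pos k with rfl | hk
  · simp
  have hPSD : (A * Aᴴ).PosSemidef := Matrix.posSemidef_self_mul_conjTranspose A
  have hdet : ((‖A.det‖ ^ 2 : ℝ) : ℂ) = (A * Aᴴ).det := by
    rw [Matrix.det_mul, Matrix.det_conjTranspose]
    simp [Complex.mul_conj, Complex.normSq_eq_norm_sq]
  have htr : (A * Aᴴ).trace.re ≤ (k : ℝ) ^ 2 * C ^ 2 := by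
    simp only [Matrix.trace, Matrix.diag, Matrix.mul_apply, Matrix.conjTranspose_apply]
    have : (∑ i, ∑ j, A i j * star (A i j)).re = ∑ i, ∑ j, ‖A i j‖ ^ 2 := by
      simp only [Complex.re_sum]
      refine Finset.sum_congr rfl fun i _ => Finset.sum_congr rfl fun j _ => ?_
      have : A i j * star (A i j) = ((‖A i j‖ ^ 2 : ℝ) : ℂ) := by
        simp [Complex.mul_conj, Complex.normSq_eq_norm_sq]
      rw [this, Complex.ofReal_re]
    rw [this]
    calc ∑ i, ∑ j, ‖A i j‖ ^ 2 ≤ ∑ _i : Fin k, ∑ _j : Fin k, C ^ 2 := by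
          gcongr with i _ j _
          exact h i j
      _ = _ := by simp; ring
  set ev := hPSD.isHermitian.eigenvalues with hev
  have hnn : ∀ i, 0 ≤ ev i := hPSD.eigenvalues_nonneg
  have hd : ‖A.det‖ ^ 2 = ∏ i, ev i := by
    have := hPSD.isHermitian.det_eq_prod_eigenvalues
    rw [← hdet] at this
    refine Complex.ofReal_injective (this.trans ?_)
    rw [Complex.ofReal_prod]
    rfl
  have ht : (A * Aᴴ).trace.re = ∑ i, ev i := by
    rw [hPSD.isHermitian.trace_eq_sum_eigenvalues]
    simp [hev]
  have hk' : (0 : ℝ) < k := by exact_mod_cast hk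
  have key := Real.geom_mean_le_arith_mean Finset.univ (fun _ : Fin k => (1 : ℝ)) ev
    (by simp) (by simpa using hk') (fun i _ => hnn i)
  simp only [Real.rpow_one, Finset.sum_const, Finset.card_univ, Fintype.card_fin, nsmul_eq_mul,
    mul_one, one_mul] at key
  rw [hd]
  have hp : 0 ≤ ∏ i, ev i := Finset.prod_nonneg fun i _ => hnn i
  calc ∏ i, ev i = ((∏ i, ev i) ^ ((k : ℝ)⁻¹)) ^ k := by
        rw [← Real.rpow_natCast, ← Real.rpow_mul hp, inv_mul_cancel₀ hk'.ne', Real.rpow_one]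
    _ ≤ ((∑ i, ev i) / k) ^ k := by gcongr
    _ ≤ ((k : ℝ) * C ^ 2) ^ k := by
        rw [← ht]
        have h0 : 0 ≤ (A * Aᴴ).trace.re := by rw [ht]; exact Finset.sum_nonneg fun i _ => hnn i
        gcongr
        rw [div_le_iff₀ hk']
        nlinarith

end Hadamard

theorem sqrt_pow_self_le (k : ℕ) :
    Real.sqrt k ^ k ≤ Real.sqrt (Real.exp 1) ^ k * Real.sqrt k.factorial := by
  have h := Real.pow_div_factorial_le_exp (x := (k : ℝ)) (by positivity) k
  rw [div_le_iff₀ (by positivity)] at h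
  have h2 : Real.sqrt ((k : ℝ) ^ k) ≤ Real.sqrt (Real.exp k * k.factorial) :=
    Real.sqrt_le_sqrt h
  rw [Real.sqrt_mul (Real.exp_pos _).le] at h2
  have e1 : ∀ x : ℝ, 0 ≤ x → Real.sqrt (x ^ k) = Real.sqrt x ^ k := fun x hx => by
    rw [Real.sqrt_eq_iff_mul_self_eq (by positivity) (by positivity), ← mul_pow,
      Real.mul_self_sqrt hx]
  rw [e1 _ (by positivity)] at h2
  rwa [show Real.exp k = Real.exp 1 ^ k by rw [← Real.exp_nat_mul]; simp, e1 _ (by positivity)]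
    at h2

theorem norm_det_le_of_norm_entry_le_mul {k : ℕ} {A : Matrix (Fin k) (Fin k) ℂ} {C : ℝ}
    (hC : 0 ≤ C) {r : Fin k → ℝ} (h : ∀ i j, ‖A i j‖ ≤ C * (r i * r j)) :
    ‖A.det‖ ≤ (Real.sqrt (Real.exp 1) * C) ^ k * Real.sqrt k.factorial * ∏ i, r i ^ 2 := by
  set B : Matrix (Fin k) (Fin k) ℂ := Matrix.of fun i j => A i j / ((r i : ℂ) * r j) with hB
  have hAB : A = Matrix.of fun i j => (r i : ℂ) * (Matrix.of fun i j => (r j : ℂ) * B i j) i j := by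
    ext i j
    simp only [hB, Matrix.of_apply]
    by_cases h0 : (r i : ℂ) * r j = 0
    · have : r i * r j = 0 := by exact_mod_cast h0
      have h1 := h i j
      rw [this, mul_zero, norm_le_zero_iff] at h1
      simp [h1]
    · rw [← mul_assoc, mul_div_cancel₀ _ h0]
  have hBb : ∀ i j, ‖B i j‖ ≤ C := fun i j => by
    simp only [hB, Matrix.of_apply, norm_div]
    have h1 := h i j
    by_cases h0 : r i * r j = 0
    · have : ((r i : ℂ) * r j) = 0 := by exact_mod_cast h0
      rw [this]; simpa using hC
    · have hne : 0 < ‖((r i : ℂ) * r j)‖ := by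
        rw [norm_pos_iff]; exact_mod_cast h0
      rw [div_le_iff₀ hne]
      refine h1.trans ?_
      gcongr
      rw [← Complex.ofReal_mul, Complex.norm_real]
      exact le_abs_self _
  have hd : A.det = (∏ i, (r i : ℂ)) * ((∏ i, (r i : ℂ)) * B.det) := by
    conv_lhs => rw [hAB]
    rw [Matrix.det_mul_column, Matrix.det_mul_row]
  have hB2 : ‖B.det‖ ≤ (Real.sqrt k * C) ^ k := by
    have := norm_det_le_of_norm_entry_le hBb
    refine abs_le_of_sq_le_sq' ?_ (by positivity) |>.2
    refine this.trans (le_of_eq ?_)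
    rw [← pow_mul, mul_comm k 2, pow_mul, mul_pow (Real.sqrt k), Real.sq_sqrt (by positivity)]
  rw [hd, norm_mul, norm_mul]
  have hr : ‖∏ i, (r i : ℂ)‖ * ‖∏ i, (r i : ℂ)‖ = ∏ i, r i ^ 2 := by
    rw [← norm_mul, ← Finset.prod_mul_distrib, norm_prod]
    refine Finset.prod_congr rfl fun i _ => ?_
    rw [← Complex.ofReal_mul, Complex.norm_real, Real.norm_eq_abs, ← sq, abs_sq]
  have h3 : (Real.sqrt k * C) ^ k ≤
      (Real.sqrt (Real.exp 1) * C) ^ k * Real.sqrt k.factorial := by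
    rw [mul_pow, mul_pow]
    have := mul_le_mul_of_nonneg_right (sqrt_pow_self_le k) (pow_nonneg hC k)
    linarith
  calc _ = ‖B.det‖ * (‖∏ i, (r i : ℂ)‖ * ‖∏ i, (r i : ℂ)‖) := by ring
    _ ≤ _ := by
      rw [hr]
      gcongr
      exact hB2.trans h3

theorem summable_pow_div_sqrt_factorial (x : ℝ) :
    Summable fun k : ℕ => x ^ k / Real.sqrt k.factorial := by
  rcases eq_or_ne x 0 with rfl | hx
  · refine summable_of_ne_finset_zero (s := {0}) fun k hk => ?_
    simp at hk
    simp [hk]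
  refine summable_of_ratio_test_tendsto_lt_one (l := 0) one_pos
    (Eventually.of_forall fun k => by positivity) ?_
  have : ∀ k : ℕ, ‖x ^ (k + 1) / Real.sqrt (k + 1).factorial‖ / ‖x ^ k / Real.sqrt k.factorial‖
      = |x| * (Real.sqrt (k + 1 : ℕ))⁻¹ := fun k => by
    rw [Nat.factorial_succ, Nat.cast_mul, Real.sqrt_mul (by positivity)]
    simp only [norm_div, norm_pow, Real.norm_eq_abs, norm_mul]
    rw [abs_of_nonneg (Real.sqrt_nonneg _), abs_of_nonneg (Real.sqrt_nonneg _)]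
    have h1 : Real.sqrt k.factorial ≠ 0 := by positivity
    have h2 : Real.sqrt (k + 1 : ℕ) ≠ 0 := by positivity
    have h3 : |x| ≠ 0 := by positivity
    field_simp
    rw [pow_succ]
  simp_rw [this]
  rw [show (0 : ℝ) = |x| * 0 by simp]
  refine Tendsto.const_mul _ (tendsto_inv_atTop_zero.comp ?_)
  exact Real.tendsto_sqrt_atTop.comp
    (tendsto_natCast_atTop_atTop.comp (tendsto_add_atTop_nat 1))

/-! ### Holomorphic families: integrals and limits -/

theorem norm_deriv_le_of_ball {f : ℂ → ℂ} {z₀ : ℂ} {r B : ℝ} (hr : 0 < r)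
    (hf : DifferentiableOn ℂ f (Metric.ball z₀ r)) (hB : ∀ z ∈ Metric.ball z₀ r, ‖f z‖ ≤ B)
    {z : ℂ} (hz : z ∈ Metric.ball z₀ (r / 2)) : ‖deriv f z‖ ≤ B / (r / 4) := by
  have hsub : Metric.closedBall z (r / 4) ⊆ Metric.ball z₀ r := fun w hw => by
    rw [Metric.mem_closedBall] at hw
    rw [Metric.mem_ball] at hz ⊢
    linarith [dist_triangle w z z₀]
  refine Complex.norm_deriv_le_of_forall_mem_sphere_norm_le (by positivity) ?_
    fun w hw => hB w (hsub (Metric.sphere_subset_closedBall hw))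
  exact DifferentiableOn.diffContOnCl_ball (hf.mono hsub) subset_rfl |>.mono subset_rfl

/-- An integral of holomorphic functions with an integrable local bound is holomorphic. -/
theorem differentiableAt_integral_of_norm_le {Y : Type*} [MeasurableSpace Y] {μ : Measure Y}
    {f : ℂ → Y → ℂ} {z₀ : ℂ} {r : ℝ} (hr : 0 < r) {b : Y → ℝ} (hb : Integrable b μ)
    (hmeas : ∀ z ∈ Metric.ball z₀ r, AEStronglyMeasurable (f z) μ)
    (hdiff : ∀ y, DifferentiableOn ℂ (fun z => f z y) (Metric.ball z₀ r))
    (hle : ∀ z ∈ Metric.ball z₀ r, ∀ y, ‖f z y‖ ≤ b y) :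
    DifferentiableAt ℂ (fun z => ∫ y, f z y ∂μ) z₀ := by
  have hz₀ : z₀ ∈ Metric.ball z₀ r := Metric.mem_ball_self hr
  have hda : ∀ y, ∀ z ∈ Metric.ball z₀ r,
      HasDerivAt (fun z => f z y) (deriv (fun z => f z y) z) z :=
    fun y z hz => ((hdiff y).differentiableAt (Metric.isOpen_ball.mem_nhds hz)).hasDerivAt
  have hseq : Tendsto (fun n : ℕ => z₀ + (((r / 2 / (n + 1) : ℝ)) : ℂ)) atTop
      (nhdsWithin z₀ {z₀}ᶜ) := by
    refine tendsto_nhdsWithin_iff.2 ⟨?_, Eventually.of_forall fun n => ?_⟩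
    · have : Tendsto (fun n : ℕ => (r / 2 / ((n : ℝ) + 1))) atTop (nhds 0) :=
        tendsto_const_nhds.div_atTop (tendsto_natCast_atTop_atTop.atTop_add tendsto_const_nhds)
      simpa using tendsto_const_nhds.add (Complex.continuous_ofReal.continuousAt.tendsto.comp this)
    · have : (r / 2 / ((n : ℝ) + 1)) ≠ 0 := by positivity
      simp only [mem_compl_iff, mem_singleton_iff, add_eq_left]
      exact_mod_cast this
  have hmem : ∀ n : ℕ, z₀ + (((r / 2 / (n + 1) : ℝ)) : ℂ) ∈ Metric.ball z₀ r := fun n => by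
    rw [Metric.mem_ball, dist_eq_norm, add_sub_cancel_left, Complex.norm_real, Real.norm_eq_abs,
      abs_of_nonneg (by positivity)]
    calc r / 2 / ((n : ℝ) + 1) ≤ r / 2 :=
          div_le_self (by positivity) (by linarith [n.cast_nonneg (α := ℝ)])
      _ < r := by linarith
  have hF' : AEStronglyMeasurable (fun y => deriv (fun z => f z y) z₀) μ := by
    refine aestronglyMeasurable_of_tendsto_ae atTop
      (f := fun (n : ℕ) y => slope (fun z => f z y) z₀ (z₀ + (((r / 2 / (n + 1) : ℝ)) : ℂ)))
      (fun n => ?_) (Eventually.of_forall fun y => ?_)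
    · simp only [slope, vsub_eq_sub]
      have := ((hmeas _ (hmem n)).sub (hmeas _ hz₀)).const_smul
        (z₀ + (((r / 2 / (n + 1) : ℝ)) : ℂ) - z₀)⁻¹
      exact this
    · exact (hasDerivAt_iff_tendsto_slope.1 (hda y z₀ hz₀)).comp hseq
  refine (hasDerivAt_integral_of_dominated_loc_of_deriv_le (F := f)
    (F' := fun z y => deriv (fun z => f z y) z) (bound := fun y => b y / (r / 4))
    (Metric.ball_mem_nhds z₀ (half_pos hr)) ?_ ?_ hF' ?_ (hb.div_const _) ?_).2.differentiableAt
  · filter_upwards [Metric.ball_mem_nhds z₀ hr] with z hz using hmeas z hz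
  · exact hb.mono' (hmeas _ hz₀) (Eventually.of_forall fun y => hle _ hz₀ y)
  · exact Eventually.of_forall fun y z hz =>
      norm_deriv_le_of_ball hr (hdiff y) (fun w hw => hle w hw y) hz
  · exact Eventually.of_forall fun y z hz =>
      hda y z (Metric.ball_subset_ball (by linarith) hz)

/-- A sequence of functions holomorphic on `Ω`, converging pointwise to a holomorphic limit and
locally uniformly bounded. -/
structure HoloConv (f : ℕ → ℂ → ℂ) (g : ℂ → ℂ) (Ω : Set ℂ) : Prop where
  diff : ∀ z ∈ Ω, ∃ r > 0, Metric.ball z r ⊆ Ω ∧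
    ∃ B, ∀ᶠ n in atTop, DifferentiableOn ℂ (f n) (Metric.ball z r) ∧
      ∀ w ∈ Metric.ball z r, ‖f n w‖ ≤ B
  lim : ∀ z ∈ Ω, Tendsto (fun n => f n z) atTop (nhds (g z))
  diff_lim : DifferentiableOn ℂ g Ω

theorem HoloConv.tendsto_deriv {f : ℕ → ℂ → ℂ} {g : ℂ → ℂ} {Ω : Set ℂ} (h : HoloConv f g Ω)
    {z : ℂ} (hz : z ∈ Ω) : Tendsto (fun n => deriv (f n) z) atTop (nhds (deriv g z)) := by
  obtain ⟨r, hr, hrΩ, B, hB⟩ := h.diff z hz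
  have hsub : Metric.closedBall z (r / 2) ⊆ Metric.ball z r :=
    Metric.closedBall_subset_ball (by linarith)
  have hR : 0 < r / 2 := half_pos hr
  have key : ∀ F : ℂ → ℂ, DifferentiableOn ℂ F (Metric.ball z r) →
      deriv F z = (2 * Real.pi * I : ℂ)⁻¹ • ∮ w in C(z, r / 2), ((w - z) ^ 2)⁻¹ • F w := by
    intro F hF
    rw [Complex.two_pi_I_inv_smul_circleIntegral_sub_sq_inv_smul_of_differentiable
      Metric.isOpen_ball hsub hF (Metric.mem_ball_self hR)]
  have hev : (fun n => (2 * Real.pi * I : ℂ)⁻¹ •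
      ∮ w in C(z, r / 2), ((w - z) ^ 2)⁻¹ • f n w) =ᶠ[atTop] fun n => deriv (f n) z := by
    filter_upwards [hB] with n hn using (key _ hn.1).symm
  rw [key g (h.diff_lim.mono hrΩ)]
  refine Tendsto.congr' hev (Tendsto.const_smul ?_ _)
  simp only [circleIntegral]
  have hcm : ∀ θ, circleMap z (r / 2) θ ∈ Metric.ball z r := fun θ =>
    hsub (circleMap_mem_closedBall z hR.le θ)
  refine intervalIntegral.tendsto_integral_filter_of_dominated_convergence
    (fun _ => (r / 2) * (((r / 2) ^ 2)⁻¹ * B)) ?_ ?_ (by simp) ?_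
  · filter_upwards [hB] with n hn
    refine Continuous.aestronglyMeasurable ?_
    have hc : Continuous fun θ => f n (circleMap z (r / 2) θ) :=
      hn.1.continuousOn.comp_continuous (continuous_circleMap _ _) hcm
    have hne : ∀ θ, circleMap z (r / 2) θ - z ≠ 0 := fun θ => by
      simp [circleMap, hr.ne']
    have h1 : Continuous fun θ => deriv (circleMap z (r / 2)) θ := by
      simp only [deriv_circleMap]
      fun_prop
    have h2 : Continuous fun θ => ((circleMap z (r / 2) θ - z) ^ 2)⁻¹ :=
      (((continuous_circleMap _ _).sub continuous_const).pow 2).inv₀ fun θ => pow_ne_zero 2 (hne θ)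
    exact h1.smul (h2.smul hc)
  · filter_upwards [hB] with n hn
    refine Eventually.of_forall fun θ _ => ?_
    rw [norm_smul, norm_smul, norm_inv, norm_pow]
    have e1 : ‖deriv (circleMap z (r / 2)) θ‖ = r / 2 := by
      simp [deriv_circleMap, circleMap, abs_of_pos hr]
    have e2 : ‖circleMap z (r / 2) θ - z‖ = r / 2 := by simp [circleMap, abs_of_pos hr]
    rw [e1, e2]
    gcongr
    exact hn.2 _ (hcm θ)
  · refine Eventually.of_forall fun θ _ => ?_
    exact ((h.lim _ (hrΩ (hcm θ))).const_smul _).const_smul _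

theorem HoloConv.deriv {f : ℕ → ℂ → ℂ} {g : ℂ → ℂ} {Ω : Set ℂ} (hΩ : IsOpen Ω)
    (h : HoloConv f g Ω) : HoloConv (fun n => deriv (f n)) (deriv g) Ω where
  diff z hz := by
    obtain ⟨r, hr, hrΩ, B, hB⟩ := h.diff z hz
    have hs : Metric.ball z (r / 2) ⊆ Metric.ball z r := Metric.ball_subset_ball (by linarith)
    refine ⟨r / 2, half_pos hr, hs.trans hrΩ, B / (r / 4), ?_⟩
    filter_upwards [hB] with n hn
    exact ⟨(hn.1.deriv Metric.isOpen_ball).mono hs,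
      fun w hw => norm_deriv_le_of_ball hr hn.1 hn.2 hw⟩
  lim z hz := h.tendsto_deriv hz
  diff_lim := h.diff_lim.deriv hΩ

/-! ### Fredholm determinants -/

/-- The Fredholm determinant `det(1 - L)` of a kernel `L` on a measure space, as a series. -/
def fredSeries {X : Type*} [MeasurableSpace X] (μ : Measure X) (L : X → X → ℂ) : ℂ :=
  1 + ∑' k : ℕ, ((-1 : ℂ) ^ (k + 1) / (k + 1).factorial) *
    ∫ x : Fin (k + 1) → X, (Matrix.of fun i j => L (x i) (x j)).det ∂Measure.pi fun _ => μ

section Fredholm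
variable {X : Type*} [MeasurableSpace X] {μ : Measure X}

theorem measurable_det_kernel {L : X → X → ℂ} (hL : Measurable fun p : X × X => L p.1 p.2)
    (k : ℕ) : Measurable fun x : Fin k → X => (Matrix.of fun i j => L (x i) (x j)).det := by
  simp only [Matrix.det_apply, Matrix.of_apply]
  refine Finset.measurable_sum _ fun σ _ => Measurable.const_smul ?_ _
  refine Finset.measurable_prod _ fun i _ => ?_
  have h : Measurable fun x : Fin k → X => (x (σ i), x i) :=
    (measurable_pi_apply _).prodMk (measurable_pi_apply _)
  exact hL.comp h

variable {ρ : X → ℝ}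

/-- The bound for the `k`-th term of the Fredholm series. -/
def fredBound (μ : Measure X) (ρ : X → ℝ) (C : ℝ) (k : ℕ) : ℝ :=
  (Real.sqrt (Real.exp 1) * C * ∫ x, ρ x ^ 2 ∂μ) ^ (k + 1) / Real.sqrt (k + 1).factorial

theorem summable_fredBound (C : ℝ) : Summable (fredBound μ ρ C) :=
  (summable_nat_add_iff 1).2 (summable_pow_div_sqrt_factorial _)

variable [SigmaFinite μ]

theorem integrable_prod_sq (hρ : Integrable (fun x => ρ x ^ 2) μ) (k : ℕ) :
    Integrable (fun x : Fin k → X => ∏ i, ρ (x i) ^ 2) (Measure.pi fun _ => μ) :=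
  Integrable.fintype_prod (f := fun _ x => ρ x ^ 2) fun _ => hρ

theorem norm_fred_term_le (hρ : Integrable (fun x => ρ x ^ 2) μ) {L : X → X → ℂ} {C : ℝ}
    (hC : 0 ≤ C) (hL : ∀ u v, ‖L u v‖ ≤ C * (ρ u * ρ v)) (k : ℕ) :
    ‖((-1 : ℂ) ^ (k + 1) / (k + 1).factorial) *
      ∫ x : Fin (k + 1) → X, (Matrix.of fun i j => L (x i) (x j)).det ∂Measure.pi fun _ => μ‖ ≤
      fredBound μ ρ C k := by
  have h1 : ‖∫ x : Fin (k + 1) → X, (Matrix.of fun i j => L (x i) (x j)).det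
      ∂Measure.pi fun _ => μ‖ ≤ ∫ x : Fin (k + 1) → X, (Real.sqrt (Real.exp 1) * C) ^ (k + 1) *
        Real.sqrt (k + 1).factorial * ∏ i, ρ (x i) ^ 2 ∂Measure.pi fun _ => μ :=
    norm_integral_le_of_norm_le ((integrable_prod_sq hρ _).const_mul _)
      (Eventually.of_forall fun x => norm_det_le_of_norm_entry_le_mul hC fun i j => hL _ _)
  rw [integral_const_mul, integral_fintype_prod_eq_pow (fun x => ρ x ^ 2)] at h1
  rw [norm_mul, norm_div, norm_pow, norm_neg, norm_one, one_pow, Complex.norm_natCast, fredBound,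
    one_div, inv_mul_le_iff₀ (by positivity), mul_pow]
  refine h1.trans (le_of_eq ?_)
  have h2 : Real.sqrt (k + 1).factorial * Real.sqrt (k + 1).factorial = (k + 1).factorial :=
    Real.mul_self_sqrt (by positivity)
  have h3 : Real.sqrt (k + 1).factorial ≠ 0 := by positivity
  simp only [Fintype.card_fin]
  rw [mul_comm _ (Real.sqrt _), mul_assoc, ← mul_pow, mul_div_assoc', eq_div_iff h3, mul_right_comm,
    h2]

theorem tendsto_fredSeries (hρ : Integrable (fun x => ρ x ^ 2) μ) {L : ℕ → X → X → ℂ}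
    {L' : X → X → ℂ} {C : ℝ} (hC : 0 ≤ C)
    (hmeas : ∀ᶠ n in atTop, Measurable fun p : X × X => L n p.1 p.2)
    (hle : ∀ᶠ n in atTop, ∀ u v, ‖L n u v‖ ≤ C * (ρ u * ρ v))
    (hlim : ∀ u v, Tendsto (fun n => L n u v) atTop (nhds (L' u v))) :
    Tendsto (fun n => fredSeries μ (L n)) atTop (nhds (fredSeries μ L')) := by
  refine Tendsto.const_add _ (tendsto_tsum_of_dominated_convergence
    (bound := fredBound μ ρ C) (summable_fredBound C) (fun k => ?_) ?_)
  · refine Tendsto.const_mul _ ?_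
    refine tendsto_integral_filter_of_dominated_convergence
      (fun x => (Real.sqrt (Real.exp 1) * C) ^ (k + 1) *
        Real.sqrt (k + 1).factorial * ∏ i, ρ (x i) ^ 2) ?_ ?_
      ((integrable_prod_sq hρ _).const_mul _) (Eventually.of_forall fun x => ?_)
    · filter_upwards [hmeas] with n hn using (measurable_det_kernel hn _).aestronglyMeasurable
    · filter_upwards [hle] with n hn
      exact Eventually.of_forall fun x => norm_det_le_of_norm_entry_le_mul hC fun i j => hn _ _
    · simp only [Matrix.det_apply, Matrix.of_apply]
      exact tendsto_finsetSum _ fun σ _ =>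
        (tendsto_finsetProd _ fun i _ => hlim _ _).const_smul _
  · filter_upwards [hle] with n hn using norm_fred_term_le hρ hC hn

theorem norm_fredSeries_le (hρ : Integrable (fun x => ρ x ^ 2) μ) {L : X → X → ℂ} {C : ℝ}
    (hC : 0 ≤ C) (hL : ∀ u v, ‖L u v‖ ≤ C * (ρ u * ρ v)) :
    ‖fredSeries μ L‖ ≤ 1 + ∑' k, fredBound μ ρ C k := by
  refine (norm_add_le _ _).trans ?_
  rw [norm_one]
  gcongr
  exact tsum_of_norm_bounded (summable_fredBound C).hasSum (norm_fred_term_le hρ hC hL)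

theorem differentiableOn_fredSeries_ball (hρ : Integrable (fun x => ρ x ^ 2) μ)
    {L : ℂ → X → X → ℂ} {z₀ : ℂ} {r C : ℝ} (hC : 0 ≤ C)
    (hmeas : ∀ z ∈ Metric.ball z₀ r, Measurable fun p : X × X => L z p.1 p.2)
    (hdiff : ∀ u v, DifferentiableOn ℂ (fun z => L z u v) (Metric.ball z₀ r))
    (hle : ∀ z ∈ Metric.ball z₀ r, ∀ u v, ‖L z u v‖ ≤ C * (ρ u * ρ v)) :
    DifferentiableOn ℂ (fun z => fredSeries μ (L z)) (Metric.ball z₀ r) := by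
  refine DifferentiableOn.const_add _ (Complex.differentiableOn_tsum_of_summable_norm
    (summable_fredBound (μ := μ) (ρ := ρ) C) (fun k => ?_) Metric.isOpen_ball
    fun k z hz => norm_fred_term_le hρ hC (hle z hz) k)
  refine DifferentiableOn.const_mul (fun z hz => DifferentiableAt.differentiableWithinAt ?_) _
  obtain ⟨ε, hε, hsub⟩ := Metric.isOpen_iff.1 Metric.isOpen_ball z hz
  refine differentiableAt_integral_of_norm_le hε
    (b := fun x => (Real.sqrt (Real.exp 1) * C) ^ (k + 1) *
        Real.sqrt (k + 1).factorial * ∏ i, ρ (x i) ^ 2)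
    ((integrable_prod_sq hρ _).const_mul _)
    (fun w hw => (measurable_det_kernel (hmeas w (hsub hw)) _).aestronglyMeasurable)
    (fun x => ?_)
    (fun w hw x => norm_det_le_of_norm_entry_le_mul hC fun i j => hle w (hsub hw) _ _)
  simp only [Matrix.det_apply, Matrix.of_apply]
  refine DifferentiableOn.fun_sum fun σ _ => DifferentiableOn.const_smul ?_ _
  exact DifferentiableOn.fun_finsetProd fun i _ => (hdiff _ _).mono hsub

end Fredholm

/-! ### Finite rank kernels -/

section FiniteRank

theorem det_submatrix_eq_zero_of_not_injective {n k : ℕ} (G : Matrix (Fin n) (Fin n) ℝ)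
    {l : Fin k → Fin n} (hl : ¬ Function.Injective l) : (G.submatrix l l).det = 0 := by
  simp only [Function.Injective, not_forall] at hl
  obtain ⟨a, b, hab, hne⟩ := hl
  exact Matrix.det_zero_of_row_eq hne (by ext c; simp [hab])

open Classical in
/-- Summing the minors over all index functions counts each principal minor `k!` times. -/
theorem sum_det_submatrix_eq {n : ℕ} (G : Matrix (Fin n) (Fin n) ℝ) (k : ℕ) :
    ∑ l : Fin k → Fin n, (G.submatrix l l).det =
      k.factorial * ∑ S ∈ (Finset.univ : Finset (Fin n)).powersetCard k,
        (G.submatrix (Subtype.val : S → Fin n) (Subtype.val : S → Fin n)).det := by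
  have h1 : ∑ l : Fin k → Fin n, (G.submatrix l l).det =
      ∑ l ∈ (Finset.univ : Finset (Fin k → Fin n)).filter Function.Injective,
        (G.submatrix l l).det := by
    rw [Finset.sum_filter]
    refine Finset.sum_congr rfl fun l _ => ?_
    split_ifs with h
    · rfl
    · exact det_submatrix_eq_zero_of_not_injective G h
  rw [h1, ← Finset.sum_fiberwise_of_maps_to (g := fun l => Finset.univ.image l)
    (t := (Finset.univ : Finset (Fin n)).powersetCard k), Finset.mul_sum]
  swap
  · intro l hl
    rw [Finset.mem_powersetCard_univ, Finset.card_image_of_injective _ (Finset.mem_filter.1 hl).2,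
      Finset.card_univ, Fintype.card_fin]
  refine Finset.sum_congr rfl fun S hS => ?_
  rw [Finset.mem_powersetCard_univ] at hS
  have hcard : Fintype.card (Fin k) = Fintype.card S := by simp [hS]
  have e0 : Fin k ≃ S := Fintype.equivOfCardEq hcard
  have h2 : ∑ e : Fin k ≃ S, (G.submatrix (fun a => (e a : Fin n)) fun a => (e a : Fin n)).det =
      ∑ l ∈ ((Finset.univ : Finset (Fin k → Fin n)).filter Function.Injective).filter
        (fun l => Finset.univ.image l = S), (G.submatrix l l).det := by
    refine Finset.sum_bij' (fun e _ => fun a => (e a : Fin n))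
      (fun l hl => Equiv.ofBijective (fun a => (⟨l a, by
        rw [← (Finset.mem_filter.1 hl).2]; simp⟩ : S)) ⟨fun a b hab =>
          (Finset.mem_filter.1 (Finset.mem_filter.1 hl).1).2 (by simpa using hab), fun b => by
          obtain ⟨a, _, ha⟩ := Finset.mem_image.1
            ((Finset.ext_iff.1 (Finset.mem_filter.1 hl).2 b).2 b.2)
          exact ⟨a, Subtype.ext ha⟩⟩) ?_ ?_ ?_ ?_ ?_
    · intro e _
      refine Finset.mem_filter.2 ⟨Finset.mem_filter.2 ⟨Finset.mem_univ _,
        Subtype.val_injective.comp e.injective⟩, ?_⟩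
      ext i
      simp only [Finset.mem_image, Finset.mem_univ, true_and]
      exact ⟨fun ⟨a, ha⟩ => ha ▸ (e a).2, fun hi => ⟨e.symm ⟨i, hi⟩, by simp⟩⟩
    · intro l hl; exact Finset.mem_univ _
    · intro e _; ext a; rfl
    · intro l hl; rfl
    · intro e _; rfl
  rw [← h2]
  have h3 : ∀ e : Fin k ≃ S, (G.submatrix (fun a => (e a : Fin n)) fun a => (e a : Fin n)).det =
      (G.submatrix (Subtype.val : S → Fin n) (Subtype.val : S → Fin n)).det := fun e => by
    rw [← Matrix.det_submatrix_equiv_self e]; rfl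
  rw [Finset.sum_congr rfl fun e _ => h3 e, Finset.sum_const, Finset.card_univ,
    Fintype.card_equiv e0, Fintype.card_fin, nsmul_eq_mul]

variable {X : Type*} [MeasurableSpace X] {μ : Measure X} [SigmaFinite μ]

open Classical in
/-- Andréief's identity for the correlation functions of a finite rank kernel. -/
theorem integral_det_finite_rank {n : ℕ} {f φ : Fin n → X → ℝ}
    (hInt : ∀ l m, Integrable (fun x => φ l x * f m x) μ) (k : ℕ) :
    ∫ x : Fin k → X, (Matrix.of fun a b => ∑ l, f l (x a) * φ l (x b)).det
        ∂Measure.pi (fun _ => μ) =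
      k.factorial * ∑ S ∈ (Finset.univ : Finset (Fin n)).powersetCard k,
        ((Matrix.of fun l m => ∫ x, φ l x * f m x ∂μ).submatrix
          (Subtype.val : S → Fin n) (Subtype.val : S → Fin n)).det := by
  rw [← sum_det_submatrix_eq]
  have h1 : ∀ x : Fin k → X, (Matrix.of fun a b => ∑ l, f l (x a) * φ l (x b)).det =
      ∑ l : Fin k → Fin n, ∑ σ : Equiv.Perm (Fin k), ((Equiv.Perm.sign σ : ℤ) : ℝ) *
        ∏ b, (φ (l b) (x b) * f (l (σ⁻¹ b)) (x b)) := fun x => by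
    rw [Matrix.det_apply', Finset.sum_comm]
    refine Finset.sum_congr rfl fun σ _ => ?_
    simp only [Matrix.of_apply]
    rw [Finset.prod_univ_sum, Finset.mul_sum, Fintype.piFinset_univ]
    refine Finset.sum_congr rfl fun l _ => ?_
    rw [Finset.prod_mul_distrib, Finset.prod_mul_distrib, mul_comm (∏ b, f _ _)]
    congr 2
    refine Fintype.prod_equiv σ _ _ fun b => ?_
    simp
  have hI : ∀ (l : Fin k → Fin n) (σ : Equiv.Perm (Fin k)), Integrable (fun x : Fin k → X =>
      ∏ b, (φ (l b) (x b) * f (l (σ⁻¹ b)) (x b))) (Measure.pi fun _ => μ) := fun l σ =>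
    Integrable.fintype_prod (f := fun b y => φ (l b) y * f (l (σ⁻¹ b)) y) fun b => hInt _ _
  simp only [h1]
  rw [integral_finsetSum _ fun l _ => integrable_finsetSum _ fun σ _ => (hI l σ).const_mul _]
  refine Finset.sum_congr rfl fun l _ => ?_
  rw [integral_finsetSum _ fun σ _ => (hI l σ).const_mul _, Matrix.det_apply']
  refine Finset.sum_congr rfl fun σ _ => ?_
  rw [integral_const_mul,
    integral_fintype_prod_eq_prod (fun b y => φ (l b) y * f (l (σ⁻¹ b)) y)]
  congr 1
  refine (Fintype.prod_equiv σ _ _ fun b => ?_).symm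
  simp

/-- The Fredholm series of a finite rank kernel is a finite determinant. -/
theorem one_add_tsum_finite_rank {n : ℕ} {f φ : Fin n → X → ℝ}
    (hInt : ∀ l m, Integrable (fun x => φ l x * f m x) μ) :
    1 + ∑' k : ℕ, ((-1 : ℝ) ^ (k + 1) / (k + 1).factorial) *
      ∫ x : Fin (k + 1) → X, (Matrix.of fun a b => ∑ l, f l (x a) * φ l (x b)).det
        ∂Measure.pi (fun _ => μ) =
    (1 - Matrix.of fun l m => ∫ x, φ l x * f m x ∂μ).det := by
  classical
  set G : Matrix (Fin n) (Fin n) ℝ := Matrix.of fun l m => ∫ x, φ l x * f m x ∂μ with hG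
  set c : ℕ → ℝ := fun k => ∑ S ∈ (Finset.univ : Finset (Fin n)).powersetCard k,
    (G.submatrix (Subtype.val : S → Fin n) (Subtype.val : S → Fin n)).det with hc
  have h0 : c 0 = 1 := by simp [hc]
  have hbig : ∀ k, n < k → c k = 0 := fun k hk => by
    simp only [hc]
    rw [Finset.powersetCard_eq_empty.2 (by simpa using hk), Finset.sum_empty]
  have h1 : ∀ k : ℕ, ((-1 : ℝ) ^ (k + 1) / (k + 1).factorial) *
      ∫ x : Fin (k + 1) → X, (Matrix.of fun a b => ∑ l, f l (x a) * φ l (x b)).det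
        ∂Measure.pi (fun _ => μ) = (-1) ^ (k + 1) * c (k + 1) := fun k => by
    rw [integral_det_finite_rank hInt, ← hG, div_mul_eq_mul_div, mul_left_comm,
      mul_div_cancel_left₀ _ (by positivity)]
  set D : Polynomial ℝ := (1 + (Polynomial.X : Polynomial ℝ) • G.map Polynomial.C).det with hD
  have hcoeff : ∀ k, D.coeff k = c k := fun k => Matrix.coeff_det_one_add_X_smul_eq_sum_minors G k
  have hdeg : D.natDegree < n + 1 := by
    rw [Nat.lt_succ_iff, Polynomial.natDegree_le_iff_coeff_eq_zero]
    intro k hk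
    rw [hcoeff, hbig k hk]
  have hDval : D.eval (-1) = (1 - G).det := by
    rw [hD, ← Polynomial.coe_evalRingHom, RingHom.map_det]
    congr 1
    ext i j
    by_cases hij : i = j
    · subst hij; simp; ring
    · simp [hij]
  rw [← hDval, Polynomial.eval_eq_sum_range' hdeg, Finset.sum_range_succ', tsum_congr h1,
    tsum_eq_sum (s := Finset.range n)]
  · simp only [hcoeff, pow_zero, mul_one, h0]
    rw [add_comm]
    congr 1
    exact Finset.sum_congr rfl fun k _ => mul_comm _ _
  · intro k hk
    rw [hbig _ (by simpa using hk), mul_zero]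

/-- The Gram matrix of a family of functions. -/
def gramMatrix {n : ℕ} (μ : Measure X) (φ : Fin n → X → ℝ) : Matrix (Fin n) (Fin n) ℝ :=
  Matrix.of fun i j => ∫ x, φ i x * φ j x ∂μ

theorem det_gramMatrix_eq {n : ℕ} {φ : Fin n → X → ℝ}
    (hInt : ∀ l m, Integrable (fun x => φ l x * φ m x) μ) :
    (gramMatrix μ φ).det = (n.factorial : ℝ)⁻¹ * ∫ x : Fin n → X,
      (Matrix.of fun i j => φ i (x j)).det ^ 2 ∂Measure.pi (fun _ => μ) := by
  classical
  have h := integral_det_finite_rank hInt n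
  have h2 : ((Finset.univ : Finset (Fin n)).powersetCard n) = {Finset.univ} := by
    simpa using Finset.powersetCard_self (Finset.univ : Finset (Fin n))
  rw [h2, Finset.sum_singleton] at h
  have h3 : ((Matrix.of fun l m => ∫ x, φ l x * φ m x ∂μ).submatrix
      (Subtype.val : {i // i ∈ (Finset.univ : Finset (Fin n))} → Fin n) Subtype.val).det =
      (gramMatrix μ φ).det :=
    Matrix.det_submatrix_equiv_self (Equiv.subtypeUnivEquiv (fun i => Finset.mem_univ i)) _
  rw [h3] at h
  rw [← mul_right_inj' (show (n.factorial : ℝ) ≠ 0 by positivity), ← h, mul_inv_cancel_left₀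
    (by positivity)]
  refine integral_congr_ae (Eventually.of_forall fun x => ?_)
  simp only
  have h4 : (Matrix.of fun a b => ∑ l, φ l (x a) * φ l (x b)) =
      (Matrix.of fun i j => φ i (x j)).transpose * Matrix.of fun i j => φ i (x j) := by
    ext a b
    simp [Matrix.mul_apply]
  rw [h4, Matrix.det_mul, Matrix.det_transpose, sq]

theorem integrable_det_sq {n : ℕ} {φ : Fin n → X → ℝ}
    (hInt : ∀ l m, Integrable (fun x => φ l x * φ m x) μ) :
    Integrable (fun x : Fin n → X => (Matrix.of fun i j => φ i (x j)).det ^ 2)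
      (Measure.pi fun _ => μ) := by
  have h : ∀ x : Fin n → X, (Matrix.of fun i j => φ i (x j)).det ^ 2 =
      ∑ σ : Equiv.Perm (Fin n), ∑ ρ : Equiv.Perm (Fin n),
        (((Equiv.Perm.sign σ : ℤ) : ℝ) * ((Equiv.Perm.sign ρ : ℤ) : ℝ)) *
          ∏ b, (φ (σ b) (x b) * φ (ρ b) (x b)) := fun x => by
    rw [sq, Matrix.det_apply', Finset.sum_mul_sum]
    refine Finset.sum_congr rfl fun σ _ => Finset.sum_congr rfl fun ρ _ => ?_
    rw [Finset.prod_mul_distrib]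
    simp only [Matrix.of_apply]
    ring
  simp only [h]
  exact integrable_finsetSum _ fun σ _ => integrable_finsetSum _ fun ρ _ =>
    (Integrable.fintype_prod (f := fun b y => φ (σ b) y * φ (ρ b) y)
      fun b => hInt _ _).const_mul _

end FiniteRank

/-- Fredholm determinants of projection-type kernels as quotients of Gram determinants. -/
theorem fredholmDet_eq_det_div {n : ℕ} {φ : Fin n → ℝ → ℝ} {K : ℝ → ℝ → ℝ}
    (hInt : ∀ l m, Integrable (fun x => φ l x * φ m x))
    (hdet : (gramMatrix volume φ).det ≠ 0)
    (hK : ∀ x y, K x y = ∑ i, ∑ j, (gramMatrix volume φ)⁻¹ i j * (φ i x * φ j y)) (t : ℝ) :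
    fredholmDet K t =
      (gramMatrix (volume.restrict (Iic t)) φ).det / (gramMatrix volume φ).det := by
  set M := gramMatrix volume φ with hM
  set f : Fin n → ℝ → ℝ := fun j x => ∑ i, M⁻¹ i j * φ i x with hf
  have hK' : ∀ x y, K x y = ∑ j, f j x * φ j y := fun x y => by
    rw [hK, Finset.sum_comm]
    simp only [hf, Finset.sum_mul, mul_assoc]
  have hInt' : ∀ l m, Integrable (fun x => φ l x * f m x) (volume.restrict (Ioi t)) := fun l m => by
    simp only [hf, Finset.mul_sum]
    refine integrable_finsetSum _ fun i _ => ?_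
    simpa only [mul_left_comm] using ((hInt l i).restrict.const_mul (M⁻¹ i m))
  have h1 : fredholmDet K t = (1 - Matrix.of fun l m => ∫ x in Ioi t, φ l x * f m x).det := by
    rw [← one_add_tsum_finite_rank hInt', fredholmDet]
    simp only [rhoK, hK', ← Measure.restrict_pi_pi, volume_pi]
  have hMs : ∀ i j, ∫ x in Ioi t, φ i x * φ j x =
      M i j - ∫ x in Iic t, φ i x * φ j x := fun i j => by
    rw [hM, gramMatrix, Matrix.of_apply, ← integral_add_compl measurableSet_Iic (hInt i j)
      (s := Iic t), compl_Iic]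
    ring
  have h2 : (Matrix.of fun l m => ∫ x in Ioi t, φ l x * f m x) =
      (M - gramMatrix (volume.restrict (Iic t)) φ) * M⁻¹ := by
    ext l m
    rw [Matrix.of_apply, Matrix.mul_apply]
    simp only [hf, Finset.mul_sum]
    rw [integral_finsetSum _ fun i _ => by
      simpa only [mul_left_comm] using ((hInt l i).restrict.const_mul (M⁻¹ i m))]
    refine Finset.sum_congr rfl fun i _ => ?_
    rw [Matrix.sub_apply, gramMatrix, Matrix.of_apply, ← hMs, mul_comm, ← integral_const_mul]
    simp only [mul_left_comm]
  have hu : IsUnit M.det := isUnit_iff_ne_zero.2 hdet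
  rw [h1, h2, Matrix.sub_mul, Matrix.mul_nonsing_inv _ hu, sub_sub_cancel, Matrix.det_mul,
    Matrix.det_nonsing_inv, Ring.inverse_eq_inv', div_eq_mul_inv]

theorem fredholmDet_nonneg_monotone {n : ℕ} {φ : Fin n → ℝ → ℝ} {K : ℝ → ℝ → ℝ}
    (hInt : ∀ l m, Integrable (fun x => φ l x * φ m x))
    (hdet : (gramMatrix volume φ).det ≠ 0)
    (hK : ∀ x y, K x y = ∑ i, ∑ j, (gramMatrix volume φ)⁻¹ i j * (φ i x * φ j y)) :
    (∀ t, 0 ≤ fredholmDet K t) ∧ Monotone (fredholmDet K) := by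
  have hpos : 0 ≤ (gramMatrix volume φ).det := by
    rw [det_gramMatrix_eq hInt]
    exact mul_nonneg (by positivity) (integral_nonneg fun x => sq_nonneg _)
  refine ⟨fun t => ?_, fun t t' htt => ?_⟩
  · rw [fredholmDet_eq_det_div hInt hdet hK, det_gramMatrix_eq fun l m => (hInt l m).restrict]
    exact div_nonneg (mul_nonneg (by positivity) (integral_nonneg fun x => sq_nonneg _)) hpos
  · rw [fredholmDet_eq_det_div hInt hdet hK, fredholmDet_eq_det_div hInt hdet hK,
      det_gramMatrix_eq fun l m => (hInt l m).restrict,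
      det_gramMatrix_eq fun l m => (hInt l m).restrict]
    refine div_le_div_of_nonneg_right (mul_le_mul_of_nonneg_left ?_ (by positivity)) hpos
    rw [← Measure.restrict_pi_pi, ← Measure.restrict_pi_pi]
    refine setIntegral_mono_set ?_ (Eventually.of_forall fun x => sq_nonneg _)
      (Set.pi_mono fun _ _ => Iic_subset_Iic.2 htt).eventuallyLE
    rw [IntegrableOn, Measure.restrict_pi_pi]
    exact integrable_det_sq fun l m => (hInt l m).restrict

/-! ### The Cauchy beta integral -/

theorem integrableOn_cpow_mul_cexp_neg_mul {a r : ℂ} (ha : 0 < a.re) (hr : 0 < r.re) :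
    IntegrableOn (fun t : ℝ => (t : ℂ) ^ (a - 1) * cexp (-(r * t))) (Ioi 0) := by
  have h := integrableOn_rpow_mul_exp_neg_mul_rpow (s := a.re - 1) (p := 1) (by linarith) one_pos
    hr
  refine Integrable.mono' h ?_ ?_
  · refine ContinuousOn.aestronglyMeasurable (fun t ht => ContinuousAt.continuousWithinAt ?_)
      measurableSet_Ioi
    have : (t : ℂ) ∈ slitPlane := by simpa using (mem_Ioi.1 ht)
    have h1 : ContinuousAt (fun t : ℝ => (t : ℂ) ^ (a - 1)) t :=
      Complex.continuous_ofReal.continuousAt.cpow continuousAt_const this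
    exact h1.mul (by fun_prop)
  · refine (ae_restrict_iff' measurableSet_Ioi).2 (Eventually.of_forall fun t ht => ?_)
    rw [norm_mul, Complex.norm_cpow_eq_rpow_re_of_pos ht, Complex.norm_exp]
    simp

theorem integral_cpow_mul_cexp_neg_mul_Ioi {a r : ℂ} (ha : 0 < a.re) (hr : 0 < r.re) :
    ∫ t in Ioi (0 : ℝ), (t : ℂ) ^ (a - 1) * cexp (-(r * t)) = r ^ (-a) * Complex.Gamma a := by
  set U : Set ℂ := {z | 0 < z.re} with hU
  have hUo : IsOpen U := isOpen_lt continuous_const Complex.continuous_re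
  have h1 : DifferentiableOn ℂ
      (fun r : ℂ => ∫ t in Ioi (0 : ℝ), (t : ℂ) ^ (a - 1) * cexp (-(r * t))) U := by
    intro z hz
    refine DifferentiableAt.differentiableWithinAt ?_
    have hz' : 0 < z.re := hz
    have hball : ∀ w ∈ Metric.ball z (z.re / 2), z.re / 2 ≤ w.re := fun w hw => by
      have := Complex.abs_re_le_norm (w - z)
      rw [Metric.mem_ball, dist_eq_norm] at hw
      rw [Complex.sub_re] at this
      linarith [neg_abs_le (w.re - z.re)]
    have hb : Integrable (fun t : ℝ => ‖(t : ℂ) ^ (a - 1) * cexp (-(((z.re / 2 : ℝ) : ℂ) * t))‖)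
        (volume.restrict (Ioi 0)) :=
      (integrableOn_cpow_mul_cexp_neg_mul ha (by simpa using hz')).norm
    have h2 := differentiableAt_integral_of_norm_le (μ := volume.restrict (Ioi (0 : ℝ)))
      (f := fun r t => (Ioi (0 : ℝ)).indicator (fun t => (t : ℂ) ^ (a - 1) * cexp (-(r * t))) t)
      (z₀ := z) (half_pos hz') hb ?_ ?_ ?_
    · refine h2.congr_of_eventuallyEq (Eventually.of_forall fun w => ?_)
      exact setIntegral_congr_fun measurableSet_Ioi fun t ht => by simp [indicator_of_mem ht]
    · intro w hw
      exact (integrableOn_cpow_mul_cexp_neg_mul ha (by linarith [hball w hw])).1.indicator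
        measurableSet_Ioi
    · intro t
      by_cases ht : t ∈ Ioi (0 : ℝ)
      · simp only [indicator_of_mem ht]
        fun_prop
      · simp only [indicator_of_notMem ht]
        fun_prop
    · intro w hw t
      by_cases ht : t ∈ Ioi (0 : ℝ)
      · simp only [indicator_of_mem ht, norm_mul, Complex.norm_exp]
        gcongr ?_ * ?_
        have := mul_le_mul_of_nonneg_right (hball w hw) (le_of_lt (mem_Ioi.1 ht))
        simpa using this
      · simp only [indicator_of_notMem ht, norm_zero]
        positivity
  have h2 : DifferentiableOn ℂ (fun r : ℂ => r ^ (-a) * Complex.Gamma a) U := by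
    intro z hz
    exact ((differentiableAt_id.cpow_const (Or.inl hz)).mul_const _).differentiableWithinAt
  have hpre : IsPreconnected U := (convex_halfSpace_re_gt 0).isPreconnected
  refine (h1.analyticOnNhd hUo).eqOn_of_preconnected_of_frequently_eq (h2.analyticOnNhd hUo) hpre
    (z₀ := 1) (by simp [hU]) ?_ hr
  have hseq : Tendsto (fun n : ℕ => (1 : ℂ) + (((1 / ((n : ℝ) + 1) : ℝ)) : ℂ)) atTop
      (nhdsWithin 1 {1}ᶜ) := by
    refine tendsto_nhdsWithin_iff.2 ⟨?_, Eventually.of_forall fun n => ?_⟩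
    · simpa using tendsto_const_nhds.add
        (Complex.continuous_ofReal.continuousAt.tendsto.comp
          tendsto_one_div_add_atTop_nhds_zero_nat)
    · have : (1 / ((n : ℝ) + 1)) ≠ 0 := by positivity
      simp only [mem_compl_iff, mem_singleton_iff, add_eq_left]
      exact_mod_cast this
  refine hseq.frequently (Frequently.of_forall fun n => ?_)
  have hp : 0 < 1 + 1 / ((n : ℝ) + 1) := by positivity
  have h3 := integral_cpow_mul_exp_neg_mul_Ioi ha hp
  rw [one_div (((1 + 1 / ((n : ℝ) + 1) : ℝ)) : ℂ), Complex.inv_cpow, ← Complex.cpow_neg] at h3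
  · rw [Complex.ofReal_add, Complex.ofReal_one] at h3
    exact h3
  · rw [Complex.arg_ofReal_of_nonneg hp.le]; exact Real.pi_ne_zero.symm

theorem one_add_I_mul_mem_slitPlane (x : ℝ) : (1 + I * x : ℂ) ∈ slitPlane := Or.inl (by simp)

theorem one_sub_I_mul_mem_slitPlane (x : ℝ) : (1 - I * x : ℂ) ∈ slitPlane := Or.inl (by simp)

theorem norm_one_add_I_mul (x : ℝ) : ‖(1 + I * x : ℂ)‖ = Real.sqrt (1 + x ^ 2) := by
  rw [Complex.norm_def, Complex.normSq_apply]
  congr 1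
  simp
  ring

theorem norm_one_sub_I_mul (x : ℝ) : ‖(1 - I * x : ℂ)‖ = Real.sqrt (1 + x ^ 2) := by
  have := norm_one_add_I_mul (-x)
  simpa [sub_eq_add_neg] using this

theorem norm_cpow_le_of_ne_zero {z : ℂ} (hz : z ≠ 0) (a : ℂ) :
    ‖z ^ a‖ ≤ Real.exp (Real.pi * |a.im|) * ‖z‖ ^ a.re := by
  rw [Complex.norm_cpow_of_ne_zero hz, div_eq_mul_inv, ← Real.exp_neg, mul_comm]
  gcongr
  calc -(z.arg * a.im) ≤ |z.arg * a.im| := neg_le_abs _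
    _ = |z.arg| * |a.im| := abs_mul _ _
    _ ≤ Real.pi * |a.im| := by gcongr; exact Complex.abs_arg_le_pi z

/-- The integrand of the Cauchy beta integral. -/
def betaFun (a b : ℂ) (x : ℝ) : ℂ := (1 + I * x) ^ (-a) * (1 - I * x) ^ (-b)

theorem continuous_betaFun (a b : ℂ) : Continuous (betaFun a b) := by
  unfold betaFun
  refine Continuous.mul ?_ ?_
  · exact Continuous.cpow (by fun_prop) continuous_const one_add_I_mul_mem_slitPlane
  · exact Continuous.cpow (by fun_prop) continuous_const one_sub_I_mul_mem_slitPlane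

theorem norm_betaFun_le (a b : ℂ) (x : ℝ) : ‖betaFun a b x‖ ≤
    Real.exp (Real.pi * |a.im|) * Real.exp (Real.pi * |b.im|) *
      (1 + x ^ 2) ^ (-(a + b).re / 2) := by
  have h1 := norm_cpow_le_of_ne_zero (slitPlane_ne_zero (one_add_I_mul_mem_slitPlane x)) (-a)
  have h2 := norm_cpow_le_of_ne_zero (slitPlane_ne_zero (one_sub_I_mul_mem_slitPlane x)) (-b)
  rw [norm_one_add_I_mul] at h1
  rw [norm_one_sub_I_mul] at h2
  have hp : (0 : ℝ) < 1 + x ^ 2 := by positivity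
  rw [Real.sqrt_eq_rpow, ← Real.rpow_mul hp.le] at h1 h2
  rw [betaFun, norm_mul]
  refine (mul_le_mul h1 h2 (norm_nonneg _) (by positivity)).trans (le_of_eq ?_)
  simp only [Complex.neg_im, abs_neg, Complex.neg_re, Complex.add_re]
  rw [show -(a.re + b.re) / 2 = 1 / 2 * -a.re + 1 / 2 * -b.re by ring, Real.rpow_add hp]
  ring

theorem integrable_betaFun {a b : ℂ} (h : 1 < (a + b).re) : Integrable (betaFun a b) := by
  have h1 := (integrable_rpow_neg_one_add_norm_sq (E := ℝ) (μ := volume) (r := (a + b).re)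
    (by simpa using h)).const_mul (Real.exp (Real.pi * |a.im|) * Real.exp (Real.pi * |b.im|))
  refine h1.mono' (continuous_betaFun a b).aestronglyMeasurable (Eventually.of_forall fun x => ?_)
  simpa using norm_betaFun_le a b x

/-- The Cauchy beta integral. -/
def betaJ (a b : ℂ) : ℂ := ∫ x, betaFun a b x

theorem betaFun_succ_left (a b : ℂ) (x : ℝ) :
    betaFun a b x = (1 + I * x) * betaFun (a + 1) b x := by
  rw [betaFun, betaFun, ← mul_assoc, neg_add, ← sub_eq_add_neg,
    Complex.cpow_sub _ _ (slitPlane_ne_zero (one_add_I_mul_mem_slitPlane x)), cpow_one,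
    mul_div_cancel₀ _ (slitPlane_ne_zero (one_add_I_mul_mem_slitPlane x))]

theorem betaFun_succ_right (a b : ℂ) (x : ℝ) :
    betaFun a b x = (1 - I * x) * betaFun a (b + 1) x := by
  rw [betaFun, betaFun, mul_left_comm, neg_add, ← sub_eq_add_neg,
    Complex.cpow_sub _ _ (slitPlane_ne_zero (one_sub_I_mul_mem_slitPlane x)), cpow_one,
    mul_div_cancel₀ _ (slitPlane_ne_zero (one_sub_I_mul_mem_slitPlane x))]

theorem hasDerivAt_betaFun (a b : ℂ) (x : ℝ) :
    HasDerivAt (betaFun a b) (I * (b * betaFun a (b + 1) x - a * betaFun (a + 1) b x)) x := by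
  have h0 : HasDerivAt (fun x : ℝ => (x : ℂ)) 1 x := Complex.ofRealCLM.hasDerivAt
  have h1 : HasDerivAt (fun x : ℝ => (1 + I * x : ℂ)) I x := by
    simpa using (h0.const_mul I).const_add 1
  have h2 : HasDerivAt (fun x : ℝ => (1 - I * x : ℂ)) (-I) x := by
    simpa using (h0.const_mul I).const_sub 1
  have h3 := ((hasDerivAt_id (1 + I * (x : ℂ))).cpow_const (c := -a)
    (one_add_I_mul_mem_slitPlane x)).comp x h1
  have h4 := ((hasDerivAt_id (1 - I * (x : ℂ))).cpow_const (c := -b)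
    (one_sub_I_mul_mem_slitPlane x)).comp x h2
  refine (h3.mul h4).congr_deriv ?_
  simp only [betaFun, id, Function.comp, mul_one, neg_add, ← sub_eq_add_neg]
  ring

theorem tendsto_betaFun_zero {a b : ℂ} (h : 0 < (a + b).re) :
    Tendsto (betaFun a b) (cocompact ℝ) (nhds 0) := by
  have h1 : Tendsto (fun x : ℝ => 1 + x ^ 2) (cocompact ℝ) atTop := by
    refine tendsto_atTop_add_const_left _ _ ?_
    have := (tendsto_pow_atTop (α := ℝ) two_ne_zero).comp (tendsto_norm_cocompact_atTop (E := ℝ))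
    refine this.congr fun x => ?_
    simp
  have h2 := (tendsto_rpow_neg_atTop (half_pos h)).comp h1
  refine squeeze_zero_norm (norm_betaFun_le a b) ?_
  have h3 := h2.const_mul (Real.exp (Real.pi * |a.im|) * Real.exp (Real.pi * |b.im|))
  rw [mul_zero] at h3
  simpa only [neg_div, Function.comp_def] using h3

theorem betaJ_succ_left {a b : ℂ} (h : 1 < (a + b).re) :
    2 * a * betaJ (a + 1) b = (a + b - 1) * betaJ a b := by
  have hI1 := integrable_betaFun h
  have hI2 : Integrable (betaFun (a + 1) b) := integrable_betaFun (by
    simp only [Complex.add_re, Complex.one_re] at h ⊢; linarith)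
  have hd : ∀ x, HasDerivAt (betaFun a (b - 1))
      (I * ((a + b - 1) * betaFun a b x - 2 * a * betaFun (a + 1) b x)) x := fun x => by
    refine (hasDerivAt_betaFun a (b - 1) x).congr_deriv ?_
    rw [sub_add_cancel, betaFun_succ_right (a + 1) (b - 1), sub_add_cancel]
    linear_combination (-I * a) * betaFun_succ_left a b x
  have ht : Tendsto (betaFun a (b - 1)) (cocompact ℝ) (nhds 0) := tendsto_betaFun_zero (by
    simp only [Complex.add_re, Complex.sub_re, Complex.one_re] at h ⊢; linarith)
  have := integral_of_hasDerivAt_of_tendsto hd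
    (((hI1.const_mul _).sub (hI2.const_mul _)).const_mul _)
    (ht.mono_left atBot_le_cocompact) (ht.mono_left atTop_le_cocompact)
  rw [integral_const_mul, integral_sub (hI1.const_mul _) (hI2.const_mul _), integral_const_mul,
    integral_const_mul, sub_zero, mul_eq_zero, or_iff_right I_ne_zero, sub_eq_zero] at this
  exact this.symm

section Fourier
open scoped FourierTransform

/-- The unnormalised complex Gamma density. -/
def gammaDensity (a : ℂ) : ℝ → ℂ :=
  (Ioi (0 : ℝ)).indicator fun t => (t : ℂ) ^ (a - 1) * cexp (-t)

theorem integrable_gammaDensity {a : ℂ} (ha : 0 < a.re) : Integrable (gammaDensity a) := by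
  rw [gammaDensity, integrable_indicator_iff measurableSet_Ioi]
  simpa using integrableOn_cpow_mul_cexp_neg_mul ha (r := 1) (by simp)

theorem continuous_gammaDensity {a : ℂ} (ha : 1 < a.re) : Continuous (gammaDensity a) := by
  have h : gammaDensity a = fun t : ℝ => ((max t 0 : ℝ) : ℂ) ^ (a - 1) * cexp (-t) := by
    ext t
    by_cases ht : t ∈ Ioi (0 : ℝ)
    · rw [gammaDensity, indicator_of_mem ht, max_eq_left (le_of_lt ht)]
    · have h0 : a - 1 ≠ 0 := fun h0 => by
        have := congrArg Complex.re h0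
        simp only [Complex.sub_re, Complex.one_re, Complex.zero_re] at this
        linarith
      rw [gammaDensity, indicator_of_notMem ht, max_eq_right (not_lt.1 ht), Complex.ofReal_zero,
        Complex.zero_cpow h0, zero_mul]
  rw [h]
  refine Continuous.mul ?_ (by fun_prop)
  refine continuous_iff_continuousAt.2 fun t => ?_
  have := Complex.continuousAt_ofReal_cpow_const (max t 0) (a - 1)
    (Or.inl (by simpa using ha))
  exact ContinuousAt.comp (f := fun t : ℝ => max t 0) this (by fun_prop)

theorem fourier_gammaDensity {a : ℂ} (ha : 0 < a.re) (w : ℝ) :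
    𝓕 (gammaDensity a) w = (1 + I * ((2 * Real.pi * w : ℝ) : ℂ)) ^ (-a) * Complex.Gamma a := by
  rw [Real.fourier_real_eq_integral_exp_smul,
    ← integral_cpow_mul_cexp_neg_mul_Ioi ha (r := 1 + I * ((2 * Real.pi * w : ℝ) : ℂ)) (by simp),
    ← integral_indicator measurableSet_Ioi]
  refine integral_congr_ae (Eventually.of_forall fun t => ?_)
  by_cases ht : t ∈ Ioi (0 : ℝ)
  · simp only [gammaDensity, indicator_of_mem ht, smul_eq_mul]
    rw [mul_left_comm, ← Complex.exp_add]
    congr 2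
    push_cast
    ring
  · simp [gammaDensity, indicator_of_notMem ht]

theorem integral_fourier_mul_fourierInv {f g : ℝ → ℂ} (hf : Integrable f) (hc : Continuous f)
    (hF : Integrable (𝓕 f)) (hg : Integrable g) :
    ∫ w, 𝓕 f w * 𝓕 g (-w) = ∫ x, f x * g x := by
  have h := VectorFourier.integral_fourierIntegral_smul_eq_flip (L := innerₗ ℝ)
    Real.continuous_fourierChar continuous_inner hg.comp_neg hF
  have h1 : ∀ w, 𝓕 g (-w) = 𝓕 (fun x => g (-x)) w := fun w => by
    rw [← Real.fourierInv_eq_fourier_comp_neg, Real.fourierInv_eq_fourier_neg]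
  have h2 : ∀ x, 𝓕 (𝓕 f) (-x) = f x := fun x => by
    rw [← Real.fourierInv_eq_fourier_neg, hc.fourierInv_fourier_eq hf hF]
  calc ∫ w, 𝓕 f w * 𝓕 g (-w) = ∫ w, 𝓕 (fun x => g (-x)) w • 𝓕 f w := by
        simp only [h1, smul_eq_mul, mul_comm]
    _ = ∫ x, g (-x) * 𝓕 (𝓕 f) x := by simpa using! h
    _ = ∫ x, g x * 𝓕 (𝓕 f) (-x) := by
        rw [← integral_neg_eq_self]; simp
    _ = ∫ x, f x * g x := by simp only [h2, mul_comm]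

theorem betaJ_eq_of_one_lt {a b : ℂ} (ha : 1 < a.re) (hb : 0 < b.re) :
    Complex.Gamma a * Complex.Gamma b * betaJ a b =
      2 * Real.pi * (2 ^ (1 - a - b) * Complex.Gamma (a + b - 1)) := by
  have ha0 : 0 < a.re := by linarith
  have hab : 0 < (a + b - 1).re := by
    simp only [Complex.sub_re, Complex.add_re, Complex.one_re]; linarith
  have hF : 𝓕 (gammaDensity a) = fun w =>
      betaFun a 0 (2 * Real.pi * w) * Complex.Gamma a := by
    ext w
    rw [fourier_gammaDensity ha0]
    simp [betaFun]
  have hFi : Integrable (𝓕 (gammaDensity a)) := by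
    rw [hF]
    exact ((integrable_betaFun (by simpa using ha)).comp_mul_left' (by positivity)).mul_const _
  have h := integral_fourier_mul_fourierInv (integrable_gammaDensity ha0)
    (continuous_gammaDensity ha) hFi (integrable_gammaDensity hb)
  have h1 : ∀ w, 𝓕 (gammaDensity a) w * 𝓕 (gammaDensity b) (-w) =
      Complex.Gamma a * Complex.Gamma b * betaFun a b (2 * Real.pi * w) := fun w => by
    rw [fourier_gammaDensity ha0, fourier_gammaDensity hb, betaFun, mul_neg, Complex.ofReal_neg,
      mul_neg, ← sub_eq_add_neg]
    ring
  have h2 : ∫ x, gammaDensity a x * gammaDensity b x =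
      2 ^ (1 - a - b) * Complex.Gamma (a + b - 1) := by
    have h3 := integral_cpow_mul_cexp_neg_mul_Ioi hab (r := 2) (by simp)
    rw [show -(a + b - 1) = 1 - a - b by ring] at h3
    rw [← h3, ← integral_indicator measurableSet_Ioi]
    refine integral_congr_ae (Eventually.of_forall fun t => ?_)
    by_cases ht : t ∈ Ioi (0 : ℝ)
    · have ht0 : (t : ℂ) ≠ 0 := by exact_mod_cast (ne_of_gt ht)
      simp only [gammaDensity, indicator_of_mem ht]
      rw [show a + b - 1 - 1 = (a - 1) + (b - 1) by ring, Complex.cpow_add _ _ ht0,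
        show -(2 * (t : ℂ)) = -t + -t by ring, Complex.exp_add]
      ring
    · simp [gammaDensity, indicator_of_notMem ht]
  simp only [h1] at h
  rw [integral_const_mul, Measure.integral_comp_mul_left, h2] at h
  rw [← h, betaJ, abs_of_pos (by positivity), Complex.real_smul]
  have : (Real.pi : ℂ) ≠ 0 := by exact_mod_cast Real.pi_ne_zero
  push_cast
  field_simp

end Fourier

/-! ### The Chu–Vandermonde identity -/

theorem poch_zero (x : ℂ) : poch x 0 = 1 := by simp [poch]

theorem poch_succ (x : ℂ) (n : ℕ) : poch x (n + 1) = poch x n * (x + n) := by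
  simp [poch, Finset.prod_range_succ]

theorem poch_succ_left (x : ℂ) (n : ℕ) : poch x (n + 1) = x * poch (x + 1) n := by
  simp only [poch, Finset.prod_range_succ', Nat.cast_zero, add_zero, Nat.cast_add, Nat.cast_one]
  rw [mul_comm]
  congr 1
  exact Finset.prod_congr rfl fun i _ => by ring

theorem poch_ne_zero {x : ℂ} (hx : 0 < x.re) (n : ℕ) : poch x n ≠ 0 := by
  refine Finset.prod_ne_zero_iff.2 fun i _ h => ?_
  have := congrArg Complex.re h
  simp only [Complex.add_re, Complex.natCast_re, Complex.zero_re] at this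
  have : (0 : ℝ) ≤ i := i.cast_nonneg
  linarith

theorem poch_neg_natCast (n k : ℕ) :
    poch (-(n : ℂ)) k = (-1) ^ k * (k.factorial : ℂ) * (n.choose k : ℂ) := by
  induction k with
  | zero => simp [poch_zero]
  | succ k ih =>
    rw [poch_succ, ih]
    rcases le_or_gt k n with h | h
    · have h1 : ((n.choose (k + 1) : ℂ)) * (k + 1) = n.choose k * (n - k) := by
        have := congrArg (Nat.cast : ℕ → ℂ) (Nat.choose_succ_right_eq n k)
        push_cast [Nat.cast_sub h] at this
        exact this
      rw [Nat.factorial_succ]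
      push_cast
      linear_combination (-1 : ℂ) ^ k * (k.factorial : ℂ) * h1
    · rw [Nat.choose_eq_zero_of_lt h, Nat.choose_eq_zero_of_lt (h.trans (Nat.lt_succ_self k))]
      simp

theorem sum_choose_succ (u : ℕ → ℂ) (n : ℕ) :
    ∑ k ∈ Finset.range (n + 2), (-1 : ℂ) ^ k * ((n + 1).choose k : ℂ) * u k =
      ∑ k ∈ Finset.range (n + 1), (-1 : ℂ) ^ k * (n.choose k : ℂ) * u k -
      ∑ k ∈ Finset.range (n + 1), (-1 : ℂ) ^ k * (n.choose k : ℂ) * u (k + 1) := by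
  have h1 : ∑ k ∈ Finset.range (n + 2), (-1 : ℂ) ^ k * (n.choose k : ℂ) * u k =
      ∑ k ∈ Finset.range (n + 1), (-1 : ℂ) ^ k * (n.choose k : ℂ) * u k := by
    rw [Finset.sum_range_succ]
    simp
  rw [← h1, Finset.sum_range_succ', Finset.sum_range_succ' _ (n + 1), add_sub_right_comm,
    ← Finset.sum_sub_distrib]
  congr 1
  · refine Finset.sum_congr rfl fun k _ => ?_
    rw [Nat.choose_succ_succ]
    push_cast
    ring
  · simp

theorem chu_vandermonde (n : ℕ) : ∀ {e c : ℂ}, 0 < c.re →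
    ∑ k ∈ Finset.range (n + 1), (-1 : ℂ) ^ k * (n.choose k : ℂ) * (poch e k / poch c k) =
      poch (c - e) n / poch c n := by
  induction n with
  | zero => intro e c _; simp [poch_zero]
  | succ n ih =>
    intro e c hc
    have hc' : 0 < (c + 1).re := by simp only [Complex.add_re, Complex.one_re]; linarith
    have hc0 : c ≠ 0 := fun h => by simp [h] at hc
    have h1 : ∀ k, poch e (k + 1) / poch c (k + 1) = e / c * (poch (e + 1) k / poch (c + 1) k) :=
      fun k => by rw [poch_succ_left, poch_succ_left, mul_div_mul_comm]
    rw [sum_choose_succ, ih hc]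
    have h2 : ∑ k ∈ Finset.range (n + 1), (-1 : ℂ) ^ k * (n.choose k : ℂ) *
        (poch e (k + 1) / poch c (k + 1)) = e / c * (poch (c - e) n / poch (c + 1) n) := by
      rw [show c - e = c + 1 - (e + 1) by ring, ← ih hc', Finset.mul_sum]
      exact Finset.sum_congr rfl fun k _ => by rw [h1]; ring
    rw [h2]
    have h3 := poch_ne_zero hc n
    have h4 := poch_ne_zero hc' n
    have h5 := poch_ne_zero hc (n + 1)
    have h6 : c * poch (c + 1) n = poch c n * (c + n) := by rw [← poch_succ_left, poch_succ]
    have h7 : c + n ≠ 0 := fun h => h5 (by rw [poch_succ, h, mul_zero])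
    rw [div_mul_div_comm, h6, poch_succ, poch_succ]
    field_simp
    ring

/-! ### The orthogonal polynomials -/

open Polynomial in
/-- `(X - i)ⁿ ₂F₁[-n, b, c; 2/(1 + i X)]` as a polynomial. -/
def hypPoly (n : ℕ) (b c : ℂ) : ℂ[X] :=
  ∑ k ∈ Finset.range (n + 1),
    C ((-1) ^ k * (n.choose k : ℂ) * (poch b k / poch c k) * (-2 * I) ^ k) * (X - C I) ^ (n - k)

theorem eval_hypPoly (n : ℕ) (b c : ℂ) (x : ℝ) :
    (hypPoly n b c).eval (x : ℂ) = ((x : ℂ) - I) ^ n * twoF1neg n b c (2 / (1 + I * x)) := by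
  rw [hypPoly, Polynomial.eval_finsetSum, twoF1neg, Finset.mul_sum]
  refine Finset.sum_congr rfl fun k hk => ?_
  have hk' : k ≤ n := Nat.lt_succ_iff.1 (Finset.mem_range.1 hk)
  have h1 := slitPlane_ne_zero (one_add_I_mul_mem_slitPlane x)
  have h2 : ((x : ℂ) - I) * (2 / (1 + I * x)) = -2 * I := by
    rw [← mul_div_assoc, div_eq_iff h1]
    linear_combination (2 * (x : ℂ)) * I_mul_I
  have h3 : (k.factorial : ℂ) ≠ 0 := by exact_mod_cast k.factorial_ne_zero
  simp only [Polynomial.eval_mul, Polynomial.eval_C, Polynomial.eval_pow, Polynomial.eval_sub,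
    Polynomial.eval_X]
  rw [← h2, mul_pow, poch_neg_natCast]
  conv_rhs => rw [← Nat.sub_add_cancel hk', pow_add, Nat.sub_add_cancel hk']
  field_simp

theorem natDegree_hypPoly_le (n : ℕ) (b c : ℂ) : (hypPoly n b c).natDegree ≤ n := by
  refine Polynomial.natDegree_sum_le_of_forall_le _ _ fun k _ => ?_
  refine (Polynomial.natDegree_C_mul_le _ _).trans ((Polynomial.natDegree_pow_le).trans ?_)
  rw [Polynomial.natDegree_X_sub_C, mul_one]
  exact Nat.sub_le _ _

theorem coeff_hypPoly (n : ℕ) (b c : ℂ) : (hypPoly n b c).coeff n = 1 := by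
  rw [hypPoly, Polynomial.finsetSum_coeff, Finset.sum_eq_single 0]
  · have h := (Polynomial.monic_X_sub_C I).pow n
    have h2 : ((Polynomial.X - Polynomial.C I) ^ n).natDegree = n := by
      rw [Polynomial.natDegree_pow, Polynomial.natDegree_X_sub_C, mul_one]
    simp only [pow_zero, Nat.choose_zero_right, Nat.cast_one, poch_zero, div_one, mul_one,
      Polynomial.C_1, one_mul, Nat.sub_zero]
    have h3 := h.coeff_natDegree
    rwa [h2] at h3
  · intro k hk hk0
    rw [Polynomial.coeff_C_mul, Polynomial.coeff_eq_zero_of_natDegree_lt, mul_zero]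
    rw [Polynomial.natDegree_pow, Polynomial.natDegree_X_sub_C, mul_one]
    have := Finset.mem_range.1 hk
    omega
  · simp

/-- Integration of a polynomial against the weight `(1+ix)^{-a}(1-ix)^{-b}`. -/
def betaFunctional (a b : ℂ) (q : Polynomial ℂ) : ℂ := ∫ x : ℝ, q.eval (x : ℂ) * betaFun a b x

theorem norm_ofReal_pow_le_rpow (x : ℝ) {m k : ℕ} (h : m ≤ k) :
    ‖(x : ℂ) ^ m‖ ≤ ((1 + x ^ 2) ^ ((k : ℝ) / 2)) := by
  have h1 : ‖(x : ℂ)‖ ≤ Real.sqrt (1 + x ^ 2) := by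
    rw [Complex.norm_real, Real.norm_eq_abs]
    exact Real.abs_le_sqrt (by linarith)
  have h2 : 1 ≤ Real.sqrt (1 + x ^ 2) := Real.one_le_sqrt.2 (by nlinarith [sq_nonneg x])
  rw [norm_pow, div_eq_inv_mul, Real.rpow_mul (by positivity), ← one_div, ← Real.sqrt_eq_rpow,
    Real.rpow_natCast]
  exact (pow_le_pow_left₀ (norm_nonneg _) h1 m).trans (pow_le_pow_right₀ h2 h)

theorem integrable_pow_mul_betaFun {a b : ℂ} {m : ℕ} (h : m + 1 < (a + b).re) :
    Integrable fun x : ℝ => (x : ℂ) ^ m * betaFun a b x := by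
  have h1 := (integrable_rpow_neg_one_add_norm_sq (E := ℝ) (μ := volume) (r := (a + b).re - m)
    (by simp only [Module.finrank_self, Nat.cast_one]; linarith)).const_mul
    (Real.exp (Real.pi * |a.im|) * Real.exp (Real.pi * |b.im|))
  refine h1.mono' (((Complex.continuous_ofReal.pow m).mul
    (continuous_betaFun a b)).aestronglyMeasurable) (Eventually.of_forall fun x => ?_)
  rw [norm_mul]
  refine (mul_le_mul (norm_ofReal_pow_le_rpow x le_rfl) (norm_betaFun_le a b x) (norm_nonneg _)
    (by positivity)).trans (le_of_eq ?_)
  rw [mul_left_comm, ← Real.rpow_add (by positivity)]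
  congr 2
  · simp
  · ring

theorem integrable_eval_mul_betaFun {a b : ℂ} {q : Polynomial ℂ} {d : ℕ} (hq : q.natDegree ≤ d)
    (h : d + 1 < (a + b).re) : Integrable fun x : ℝ => q.eval (x : ℂ) * betaFun a b x := by
  simp only [Polynomial.eval_eq_sum_range, Finset.sum_mul, mul_assoc]
  refine integrable_finsetSum _ fun m hm => (integrable_pow_mul_betaFun ?_).const_mul _
  have : m ≤ d := (Nat.lt_succ_iff.1 (Finset.mem_range.1 hm)).trans hq
  have : (m : ℝ) ≤ d := by exact_mod_cast this
  linarith

theorem betaFun_sub_left (a b : ℂ) (j : ℕ) (x : ℝ) :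
    betaFun (a - j) b x = (1 + I * x) ^ j * betaFun a b x := by
  induction j with
  | zero => simp
  | succ j ih =>
    rw [betaFun_succ_left, show a - ((j + 1 : ℕ) : ℂ) + 1 = a - j by push_cast; ring, ih]
    ring

theorem betaFun_sub_right (a b : ℂ) (j : ℕ) (x : ℝ) :
    betaFun a (b - j) x = (1 - I * x) ^ j * betaFun a b x := by
  induction j with
  | zero => simp
  | succ j ih =>
    rw [betaFun_succ_right, show b - ((j + 1 : ℕ) : ℂ) + 1 = b - j by push_cast; ring, ih]
    ring

open Polynomial in
theorem betaFunctional_basis (a b : ℂ) (j m : ℕ) :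
    betaFunctional a b ((X - C I) ^ j * (X + C I) ^ m) =
      (-I) ^ j * I ^ m * betaJ (a - j) (b - m) := by
  rw [betaFunctional, betaJ, ← integral_const_mul]
  refine integral_congr_ae (Eventually.of_forall fun x => ?_)
  simp only [eval_mul, eval_pow, eval_sub, eval_add, eval_X, eval_C]
  rw [betaFun_sub_left, betaFun_sub_right, show (x : ℂ) - I = -I * (1 + I * x) by
    linear_combination (x : ℂ) * I_mul_I, show (x : ℂ) + I = I * (1 - I * x) by
    linear_combination ((x : ℂ)) * I_mul_I, mul_pow, mul_pow]
  ring

theorem two_pow_mul_poch_mul_betaJ {b d : ℂ} (h : 1 < (b + d).re) (k : ℕ) :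
    2 ^ k * poch b k * betaJ (b + k) d = poch (b + d - 1) k * betaJ b d := by
  induction k with
  | zero => simp [poch_zero]
  | succ k ih =>
    have h1 := betaJ_succ_left (a := b + k) (b := d) (by
      simp only [Complex.add_re, Complex.natCast_re] at h ⊢
      have : (0 : ℝ) ≤ k := k.cast_nonneg
      linarith)
    rw [poch_succ, poch_succ, Nat.cast_succ, ← add_assoc]
    linear_combination (2 : ℂ) ^ k * poch b k * h1 + (b + d - 1 + k) * ih

open Polynomial in
theorem betaFunctional_hypPoly {n m : ℕ} {b b' c d : ℂ} (hc : 0 < c.re)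
    (h : 1 < (b + d - m).re) (hd : (n + m) + 1 < (b + n + d).re) (hb : b + n = b') :
    betaFunctional b' d (hypPoly n b c * (X + C I) ^ m) =
      (-I) ^ n * I ^ m * betaJ b (d - m) * (poch (c - (b + d - m - 1)) n / poch c n) := by
  subst hb
  have hInt : ∀ k ∈ Finset.range (n + 1), Integrable fun x : ℝ =>
      (C ((-1) ^ k * (n.choose k : ℂ) * (poch b k / poch c k) * (-2 * I) ^ k) *
        ((X - C I) ^ (n - k) * (X + C I) ^ m)).eval (x : ℂ) * betaFun (b + n) d x := by
    intro k hk
    refine integrable_eval_mul_betaFun (d := n + m) ?_ (by exact_mod_cast hd)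
    refine (natDegree_C_mul_le _ _).trans (natDegree_mul_le.trans (add_le_add ?_ ?_))
    · refine natDegree_pow_le.trans ?_
      rw [natDegree_X_sub_C, mul_one]; exact Nat.sub_le _ _
    · refine natDegree_pow_le.trans ?_
      rw [natDegree_X_add_C, mul_one]
  rw [← chu_vandermonde n hc, hypPoly, Finset.sum_mul, betaFunctional]
  simp only [mul_assoc (C _)]
  simp only [eval_finsetSum, Finset.sum_mul]
  rw [integral_finsetSum _ hInt, Finset.mul_sum]
  refine Finset.sum_congr rfl fun k hk => ?_
  have hk' : k ≤ n := Nat.lt_succ_iff.1 (Finset.mem_range.1 hk)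
  have h1 := betaFunctional_basis (b + n) d (n - k) m
  rw [betaFunctional] at h1
  simp only [eval_mul (p := C _), eval_C, mul_assoc ((-1 : ℂ) ^ k * _ * _ * _)]
  rw [integral_const_mul, h1, Nat.cast_sub hk', show b + (n : ℂ) - (n - k) = b + k by ring]
  have h2 := two_pow_mul_poch_mul_betaJ (b := b) (d := d - m) (by rwa [← add_sub_assoc]) k
  have h3 : (-2 * I : ℂ) ^ k * (-I) ^ (n - k) = 2 ^ k * (-I) ^ n := by
    rw [show (-2 * I : ℂ) = 2 * -I by ring, mul_pow, mul_assoc, ← pow_add, Nat.add_sub_cancel' hk']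
  have h4 : b + d - (m : ℂ) - 1 = b + (d - m) - 1 := by ring
  rw [h4]
  calc _ = ((-1) ^ k * (n.choose k : ℂ) * (poch b k / poch c k)) *
        ((-2 * I) ^ k * (-I) ^ (n - k)) * (I ^ m * betaJ (b + k) (d - m)) := by ring
    _ = ((-1) ^ k * (n.choose k : ℂ) * (-I) ^ n * I ^ m / poch c k) *
        (2 ^ k * poch b k * betaJ (b + k) (d - m)) := by rw [h3]; ring
    _ = _ := by rw [h2]; ring

/-! ### The Christoffel–Darboux formula -/

open Polynomial in
theorem christoffel_darboux {n : ℕ} (Λ : ℂ[X] →ₗ[ℂ] ℂ) {p q : ℂ[X]} {h : ℂ}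
    (hp : p.natDegree ≤ n) (hpn : p.coeff n = 1) (hq : q.natDegree ≤ n + 1)
    (hqn : q.coeff (n + 1) = 1) (horth : ∀ r : ℂ[X], r.degree < n → Λ (p * r) = 0)
    (horth' : ∀ r : ℂ[X], r.degree < n → Λ (q * r) = 0) (hh : Λ (p * X ^ n) = h)
    {A : Matrix (Fin (n + 1)) (Fin (n + 1)) ℂ}
    (hA : A * Matrix.of (fun i j : Fin (n + 1) => Λ (X ^ (i + j : ℕ))) = 1) (x y : ℂ) :
    q.eval x * p.eval y - p.eval x * q.eval y =
      h * (x - y) * ∑ i, ∑ j, A i j * (y ^ (i : ℕ) * x ^ (j : ℕ)) := by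
  have hp0 : p ≠ 0 := fun h => by simp [h] at hpn
  have key : ∀ x : ℂ, p.eval x * (q.eval x * p.eval y - p.eval x * q.eval y -
      h * (x - y) * ∑ i, ∑ j, A i j * (y ^ (i : ℕ) * x ^ (j : ℕ))) = 0 := by
    intro x
    set P : ℂ[X] := C (p.eval x) * q - C (q.eval x) * p with hP
    set κ : ℂ[X] := P /ₘ (X - C x) with hκ
    have hPκ : (X - C x) * κ = P := by
      rw [hκ, mul_divByMonic_eq_iff_isRoot]
      simp [hP, IsRoot, mul_comm]
    have hPdeg : P.natDegree ≤ n + 1 :=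
      (natDegree_sub_le_of_le ((natDegree_C_mul_le _ _).trans hq)
        ((natDegree_C_mul_le _ _).trans (hp.trans (Nat.le_succ n)))).trans (max_self _).le
    have hκdeg : κ.natDegree ≤ n := by
      rw [hκ, natDegree_divByMonic _ (monic_X_sub_C x), natDegree_X_sub_C]
      omega
    have hκn : κ.coeff n = p.eval x := by
      have h1 : (κ * (X - C x)).coeff (n + 1) = P.coeff (n + 1) := by rw [mul_comm, hPκ]
      rw [coeff_mul_X_sub_C, coeff_eq_zero_of_natDegree_lt (Nat.lt_succ_of_le hκdeg), zero_mul,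
        sub_zero, hP, coeff_sub, coeff_C_mul, coeff_C_mul, hqn,
        coeff_eq_zero_of_natDegree_lt (Nat.lt_succ_of_le hp)] at h1
      simpa using h1
    have hrep : ∀ r : ℂ[X], r.natDegree ≤ n → Λ (κ * r) = r.eval x * Λ κ := by
      intro r hr
      set d := (r - C (r.eval x)) /ₘ (X - C x) with hd
      have h1 : (X - C x) * d = r - C (r.eval x) := by
        rw [hd, mul_divByMonic_eq_iff_isRoot]
        simp [IsRoot]
      have h2 : d.degree < n := by
        rcases eq_or_ne d 0 with h0 | h0
        · rw [h0, degree_zero]; exact WithBot.bot_lt_coe n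
        · have h3 : (r - C (r.eval x)).natDegree ≤ n := by rwa [natDegree_sub_C]
          rw [← h1, natDegree_mul (X_sub_C_ne_zero x) h0, natDegree_X_sub_C] at h3
          exact (natDegree_lt_iff_degree_lt h0).1 (by omega)
      have h3 : κ * r = p.eval x • (q * d) - q.eval x • (p * d) + r.eval x • κ := by
        rw [smul_eq_C_mul, smul_eq_C_mul, smul_eq_C_mul]
        linear_combination (-κ) * h1 + d * hPκ + d * hP
      rw [h3, map_add, map_sub, map_smul, map_smul, map_smul, horth d h2, horth' d h2]
      simp
    have hI : p.eval x * Λ κ = p.eval x * h := by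
      rw [← hrep p hp]
      have h1 : (κ - C (p.eval x) * X ^ n).degree < (n : WithBot ℕ) := by
        rw [degree_lt_iff_coeff_zero]
        intro m hm
        rw [coeff_sub, coeff_C_mul, coeff_X_pow]
        rcases hm.eq_or_lt with rfl | hm
        · simp [hκn]
        · rw [coeff_eq_zero_of_natDegree_lt (hκdeg.trans_lt hm), if_neg hm.ne']
          simp
      have h2 : κ * p = p * (κ - C (p.eval x) * X ^ n) + p.eval x • (p * X ^ n) := by
        rw [smul_eq_C_mul]; ring
      rw [h2, map_add, map_smul, horth _ h1, hh, zero_add, smul_eq_mul]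
    have hsum : κ = ∑ j : Fin (n + 1), C (κ.coeff j) * X ^ (j : ℕ) := by
      rw [Fin.sum_univ_eq_sum_range (fun j => C (κ.coeff j) * X ^ j)]
      exact κ.as_sum_range_C_mul_X_pow' (Nat.lt_succ_of_le hκdeg)
    have hmul : ∀ i : Fin (n + 1), p.eval x * ∑ j : Fin (n + 1), Λ (X ^ (i + j : ℕ)) * κ.coeff j =
        p.eval x * h * x ^ (i : ℕ) := by
      intro i
      have h1 := hrep (X ^ (i : ℕ)) (by rw [natDegree_X_pow]; exact Nat.lt_succ_iff.1 i.2)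
      rw [eval_pow, eval_X] at h1
      rw [← hI, mul_right_comm, mul_assoc (p.eval x), ← h1]
      congr 1
      conv_rhs => rw [hsum, Finset.sum_mul, map_sum]
      refine Finset.sum_congr rfl fun j _ => ?_
      rw [mul_assoc, ← smul_eq_C_mul, map_smul, ← pow_add, add_comm (j : ℕ), smul_eq_mul, mul_comm]
    have hcoeff : ∀ k : Fin (n + 1), p.eval x * κ.coeff k =
        p.eval x * h * ∑ i, A k i * x ^ (i : ℕ) := by
      intro k
      have h1 : κ.coeff k = ∑ j : Fin (n + 1), (A * Matrix.of
          (fun i j : Fin (n + 1) => Λ (X ^ (i + j : ℕ)))) k j * κ.coeff j := by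
        rw [hA]
        simp [Matrix.one_apply]
      rw [h1]
      simp only [Matrix.mul_apply, Matrix.of_apply, Finset.sum_mul]
      rw [Finset.sum_comm, Finset.mul_sum, Finset.mul_sum]
      refine Finset.sum_congr rfl fun i _ => ?_
      calc _ = A k i * (p.eval x * ∑ j : Fin (n + 1), Λ (X ^ (i + j : ℕ)) * κ.coeff j) := by
            simp only [Finset.mul_sum]
            exact Finset.sum_congr rfl fun j _ => by ring
        _ = _ := by rw [hmul]; ring
    have h1 : (y - x) * κ.eval y = p.eval x * q.eval y - q.eval x * p.eval y := by
      have := congrArg (eval y) hPκ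
      simpa [hP] using this
    have h2 : p.eval x * κ.eval y =
        p.eval x * h * ∑ i, ∑ j, A i j * (y ^ (i : ℕ) * x ^ (j : ℕ)) := by
      conv_lhs => rw [hsum]
      rw [eval_finsetSum, Finset.mul_sum, Finset.mul_sum]
      refine Finset.sum_congr rfl fun i _ => ?_
      rw [eval_mul, eval_C, eval_pow, eval_X, ← mul_assoc, hcoeff, mul_assoc, Finset.sum_mul]
      congr 1
      exact Finset.sum_congr rfl fun j _ => by ring
    linear_combination p.eval x * h1 - (y - x) * h2
  set R : ℂ[X] := q * C (p.eval y) - p * C (q.eval y) -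
    C h * (X - C y) * ∑ i : Fin (n + 1), ∑ j : Fin (n + 1),
      C (A i j) * (C (y ^ (i : ℕ)) * X ^ (j : ℕ)) with hR
  have hev : ∀ x, R.eval x = q.eval x * p.eval y - p.eval x * q.eval y -
      h * (x - y) * ∑ i, ∑ j, A i j * (y ^ (i : ℕ) * x ^ (j : ℕ)) := by
    intro x
    simp [hR, eval_finsetSum]
  have h0 : p * R = 0 := Polynomial.funext fun x => by rw [eval_mul, hev, key, eval_zero]
  have h1 := hev x
  rw [(mul_eq_zero.1 h0).resolve_left hp0, eval_zero] at h1
  exact sub_eq_zero.1 h1.symm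

/-! ### The finite-`N` kernel as a projection kernel -/

theorem wH_pos (s : ℂ) (N : ℕ) (x : ℝ) : 0 < wH s N x :=
  mul_pos (Real.rpow_pos_of_pos (by positivity) _) (Real.exp_pos _)

theorem ofReal_wH (s : ℂ) (N : ℕ) (x : ℝ) :
    ((wH s N x : ℝ) : ℂ) = betaFun (s + N) ((starRingEnd ℂ) s + N) x := by
  have h1 := one_add_I_mul_mem_slitPlane x
  have h2 : (1 - I * x : ℂ) ^ (-((starRingEnd ℂ) s + N)) =
      (starRingEnd ℂ) ((1 + I * x : ℂ) ^ (-(s + N))) := by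
    have h3 := Complex.cpow_conj (1 - I * x) (-(s + N)) (slitPlane_arg_ne_pi
      (one_sub_I_mul_mem_slitPlane x))
    simpa [sub_eq_add_neg, add_comm] using h3
  rw [betaFun, h2, Complex.mul_conj, Complex.normSq_eq_norm_sq,
    Complex.norm_cpow_of_ne_zero (slitPlane_ne_zero h1), norm_one_add_I_mul, wH]
  congr 1
  have h4 : ∀ u : ℝ, (Real.sqrt (1 + x ^ 2) ^ u) ^ 2 = (1 + x ^ 2) ^ u := fun u => by
    rw [pow_two (_ ^ u), ← Real.mul_rpow (Real.sqrt_nonneg _) (Real.sqrt_nonneg _),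
      Real.mul_self_sqrt (by positivity)]
  rw [div_pow, h4, ← Real.exp_nat_mul, div_eq_mul_inv, ← Real.exp_neg]
  congr 2
  · simp; ring
  · simp; ring

theorem differentiable_wH (s : ℂ) (N : ℕ) : Differentiable ℝ (wH s N) := by
  have h : wH s N = fun x => Complex.reCLM (betaFun (s + N) ((starRingEnd ℂ) s + N) x) := by
    ext x
    rw [← ofReal_wH]
    simp
  rw [h]
  exact fun x => (Complex.reCLM.differentiableAt).comp x (hasDerivAt_betaFun _ _ x).differentiableAt

theorem differentiable_sqrt_wH (s : ℂ) (N : ℕ) :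
    Differentiable ℝ fun x => Real.sqrt (wH s N x) :=
  fun x => (differentiable_wH s N x).sqrt (wH_pos s N x).ne'

/-- The orthogonalisation basis `xⁱ √(w_H(x))`. -/
def wMonomial (s : ℂ) (N : ℕ) (i : Fin N) (x : ℝ) : ℝ := x ^ (i : ℕ) * Real.sqrt (wH s N x)

theorem differentiable_wMonomial (s : ℂ) (N : ℕ) (i : Fin N) :
    Differentiable ℝ (wMonomial s N i) :=
  (differentiable_id.pow _).mul (differentiable_sqrt_wH s N)

theorem wMonomial_mul (s : ℂ) (N : ℕ) (i j : Fin N) (x : ℝ) :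
    wMonomial s N i x * wMonomial s N j x = x ^ (i + j : ℕ) * wH s N x := by
  rw [wMonomial, wMonomial, mul_mul_mul_comm, Real.mul_self_sqrt (wH_pos s N x).le, pow_add]

theorem integrable_pow_mul_wH {s : ℂ} {N m : ℕ} (h : m + 1 < 2 * s.re + 2 * N) :
    Integrable fun x => x ^ m * wH s N x := by
  have h1 := (integrable_pow_mul_betaFun (a := s + N) (b := (starRingEnd ℂ) s + N) (m := m)
    (by simp; linarith)).re
  refine h1.congr (Eventually.of_forall fun x => ?_)
  simp only [← ofReal_wH, ← Complex.ofReal_pow, ← Complex.ofReal_mul]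
  exact Complex.ofReal_re _

theorem integrable_wMonomial_mul {s : ℂ} (hs : -(1 / 2 : ℝ) < s.re) {N : ℕ} (i j : Fin N) :
    Integrable fun x => wMonomial s N i x * wMonomial s N j x := by
  simp only [wMonomial_mul]
  refine integrable_pow_mul_wH ?_
  have h1 : (i + j : ℕ) + 2 ≤ 2 * N := by have := i.2; have := j.2; omega
  have h2 : (((i + j : ℕ) : ℝ)) + 2 ≤ 2 * N := by exact_mod_cast h1
  linarith

theorem det_gramMatrix_ne_zero {n : ℕ} {φ : Fin n → ℝ → ℝ} (hc : ∀ i, Continuous (φ i))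
    (hInt : ∀ l m, Integrable fun x => φ l x * φ m x) (hli : LinearIndependent ℝ φ) :
    (gramMatrix volume φ).det ≠ 0 := by
  intro hdet
  obtain ⟨v, hv, hMv⟩ := Matrix.exists_mulVec_eq_zero_iff.2 hdet
  have hInt2 : ∀ i j, Integrable fun x => v i * v j * (φ i x * φ j x) :=
    fun i j => (hInt i j).const_mul _
  have hsq : ∀ x, (∑ i, v i * φ i x) ^ 2 = ∑ i, ∑ j, v i * v j * (φ i x * φ j x) := by
    intro x
    rw [sq, Finset.sum_mul_sum]
    exact Finset.sum_congr rfl fun i _ => Finset.sum_congr rfl fun j _ => by ring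
  have hintsq : Integrable fun x => (∑ i, v i * φ i x) ^ 2 := by
    simp only [hsq]
    exact integrable_finsetSum _ fun i _ => integrable_finsetSum _ fun j _ => hInt2 i j
  have h0 : ∫ x, (∑ i, v i * φ i x) ^ 2 = 0 := by
    simp only [hsq]
    rw [integral_finsetSum _ fun i _ => integrable_finsetSum _ fun j _ => hInt2 i j]
    refine Finset.sum_eq_zero fun i _ => ?_
    rw [integral_finsetSum _ fun j _ => hInt2 i j]
    simp only [integral_const_mul]
    have h1 := congrFun hMv i
    simp only [Matrix.mulVec, dotProduct, gramMatrix, Matrix.of_apply, Pi.zero_apply] at h1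
    rw [← mul_zero (v i), ← h1, Finset.mul_sum]
    exact Finset.sum_congr rfl fun j _ => by ring
  rw [integral_eq_zero_iff_of_nonneg (fun x => sq_nonneg _) hintsq] at h0
  have hcont : Continuous fun x => (∑ i, v i * φ i x) ^ 2 :=
    (continuous_finsetSum _ fun i _ => continuous_const.mul (hc i)).pow 2
  replace h0 := (Continuous.ae_eq_iff_eq volume hcont continuous_zero).1 h0
  refine hv (funext (Fintype.linearIndependent_iff.1 hli v (funext fun x => ?_)))
  have h1 : (∑ i, v i * φ i x) ^ 2 = 0 := congrFun h0 x
  simpa using h1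

theorem linearIndependent_wMonomial (s : ℂ) (N : ℕ) : LinearIndependent ℝ (wMonomial s N) := by
  rw [Fintype.linearIndependent_iff]
  intro v hv i
  have h0 : (∑ i : Fin N, Polynomial.C (v i) * Polynomial.X ^ (i : ℕ)) = 0 := by
    refine Polynomial.funext fun x => ?_
    have h1 := congrFun hv x
    simp only [wMonomial, Finset.sum_apply, Pi.smul_apply, smul_eq_mul, ← mul_assoc,
      ← Finset.sum_mul, Pi.zero_apply] at h1
    simpa [Polynomial.eval_finsetSum] using
      (mul_eq_zero.1 h1).resolve_right (Real.sqrt_pos.2 (wH_pos s N x)).ne'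
  have h1 := congrArg (fun q : Polynomial ℝ => q.coeff i) h0
  simp only [Polynomial.finsetSum_coeff, Polynomial.coeff_C_mul, Polynomial.coeff_X_pow,
    Polynomial.coeff_zero] at h1
  rw [Finset.sum_eq_single i] at h1
  · simpa using h1
  · intro j _ hj
    rw [if_neg (fun h => hj (Fin.ext h.symm)), mul_zero]
  · simp

theorem Gamma_add_natCast {z : ℂ} (hz : 0 < z.re) (n : ℕ) :
    Complex.Gamma (z + n) = poch z n * Complex.Gamma z := by
  induction n with
  | zero => simp [poch_zero]
  | succ n ih =>
    have h1 : z + n ≠ 0 := fun h => by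
      have := congrArg Complex.re h
      simp only [Complex.add_re, Complex.natCast_re, Complex.zero_re] at this
      have : (0 : ℝ) ≤ n := n.cast_nonneg
      linarith
    rw [Nat.cast_succ, ← add_assoc, Complex.Gamma_add_one _ h1, ih, poch_succ]
    ring

theorem add_conj_eq (s : ℂ) : s + (starRingEnd ℂ) s = ((2 * s.re : ℝ) : ℂ) := Complex.add_conj s

theorem Gamma_mul_betaJ {s : ℂ} (hs : -(1 / 2 : ℝ) < s.re) :
    Complex.Gamma (s + 1) * Complex.Gamma ((starRingEnd ℂ) s + 1) *
        betaJ (s + 1) ((starRingEnd ℂ) s + 1) * ((2 : ℝ) ^ (2 * s.re) : ℝ) =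
      Real.pi * Complex.Gamma ((2 * s.re + 1 : ℝ) : ℂ) := by
  have h1 := betaJ_succ_left (a := s + 1) (b := (starRingEnd ℂ) s + 1) (by simp; linarith)
  have h2 := betaJ_eq_of_one_lt (a := s + 1 + 1) (b := (starRingEnd ℂ) s + 1)
    (by simp; linarith) (by simp; linarith)
  have h3 : s + 1 ≠ 0 := fun h => by
    have := congrArg Complex.re h
    simp at this
    linarith
  have h4 : ((2 * s.re + 1 : ℝ) : ℂ) ≠ 0 := by
    rw [Complex.ofReal_ne_zero]; linarith
  have h5 : s + 1 + 1 + ((starRingEnd ℂ) s + 1) - 1 = ((2 * s.re + 1 : ℝ) : ℂ) + 1 := by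
    have := add_conj_eq s
    push_cast at this ⊢
    linear_combination this
  have h6 : s + 1 + ((starRingEnd ℂ) s + 1) - 1 = ((2 * s.re + 1 : ℝ) : ℂ) := by
    have := add_conj_eq s
    push_cast at this ⊢
    linear_combination this
  have h7 : (1 : ℂ) - (s + 1 + 1) - ((starRingEnd ℂ) s + 1) =
      ((-(2 * s.re) : ℝ) : ℂ) + (-2 : ℤ) := by
    have := add_conj_eq s
    push_cast at this ⊢
    linear_combination -this
  rw [h5, h7, Complex.Gamma_add_one _ h4, Complex.Gamma_add_one _ h3,
    Complex.cpow_add _ _ two_ne_zero, Complex.cpow_intCast] at h2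
  rw [h6] at h1
  have h8 : (2 : ℂ) ^ ((-(2 * s.re) : ℝ) : ℂ) * ((2 : ℝ) ^ (2 * s.re) : ℝ) = 1 := by
    rw [Complex.ofReal_cpow (by norm_num), Complex.ofReal_ofNat, ← Complex.cpow_add _ _ two_ne_zero]
    simp
  refine mul_left_cancel₀ h4 ?_
  rw [show (2 : ℂ) ^ (-2 : ℤ) = 1 / 4 by norm_num] at h2
  linear_combination (-(Complex.Gamma (s + 1) * Complex.Gamma ((starRingEnd ℂ) s + 1) *
    ((2 : ℝ) ^ (2 * s.re) : ℝ))) * h1 + 2 * (((2 : ℝ) ^ (2 * s.re) : ℝ) : ℂ) * h2 +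
    (Real.pi * ((2 * s.re + 1 : ℝ) : ℂ) * Complex.Gamma ((2 * s.re + 1 : ℝ) : ℂ)) * h8

/-- The squared norm of the `n`-th orthogonal polynomial for the weight `w_H` with `N = n + 1`. -/
def orthNorm (s : ℂ) (n : ℕ) : ℂ :=
  betaJ (s + 1) ((starRingEnd ℂ) s + 1) * (n.factorial / poch ((2 * s.re + 2 : ℝ) : ℂ) n)

theorem CNs_mul_orthNorm {s : ℂ} (hs : -(1 / 2 : ℝ) < s.re) (n : ℕ) :
    CNs s (n + 1) * orthNorm s n = 1 := by
  have h1 := Gamma_mul_betaJ hs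
  have hp : 0 < ((2 * s.re + 2 : ℝ) : ℂ).re := by rw [Complex.ofReal_re]; linarith
  have hp1 : 0 < ((2 * s.re + 1 : ℝ) : ℂ).re := by rw [Complex.ofReal_re]; linarith
  have h2 := Gamma_add_natCast hp n
  have h3 := Complex.Gamma_ne_zero_of_re_pos hp
  have h4 := Complex.Gamma_ne_zero_of_re_pos hp1
  have h5 := poch_ne_zero hp n
  have h6 : (n.factorial : ℂ) ≠ 0 := by exact_mod_cast n.factorial_ne_zero
  have h7 : (Real.pi : ℂ) ≠ 0 := by exact_mod_cast Real.pi_ne_zero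
  rw [CNs, orthNorm, show ((2 * s.re + (n + 1 : ℕ) + 1 : ℝ) : ℂ) = ((2 * s.re + 2 : ℝ) : ℂ) + n by
    push_cast; ring, h2, Nat.cast_succ, Complex.Gamma_nat_eq_factorial, Complex.ofReal_div]
  generalize ((2 * s.re + 2 : ℝ) : ℂ) = c at *
  field_simp
  linear_combination h1

open Polynomial in
/-- The moment functional of `w_H` for `N = n + 1`, on polynomials of degree at most `2n`. -/
def momentFunctional (s : ℂ) (n : ℕ) : ℂ[X] →ₗ[ℂ] ℂ :=
  ∑ m ∈ Finset.range (2 * n + 1),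
    betaFunctional (s + (n + 1 : ℕ)) ((starRingEnd ℂ) s + (n + 1 : ℕ)) (X ^ m) • lcoeff ℂ m

open Polynomial in
theorem momentFunctional_eq {s : ℂ} (hs : -(1 / 2 : ℝ) < s.re) {n : ℕ} {q : ℂ[X]}
    (hq : q.natDegree ≤ 2 * n) : momentFunctional s n q =
      betaFunctional (s + (n + 1 : ℕ)) ((starRingEnd ℂ) s + (n + 1 : ℕ)) q := by
  have hInt : ∀ m ∈ Finset.range (2 * n + 1), Integrable fun x : ℝ => q.coeff m * ((x : ℂ) ^ m *
      betaFun (s + (n + 1 : ℕ)) ((starRingEnd ℂ) s + (n + 1 : ℕ)) x) := fun m hm => by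
    refine (integrable_pow_mul_betaFun ?_).const_mul _
    have h1 : m ≤ 2 * n := Nat.lt_succ_iff.1 (Finset.mem_range.1 hm)
    have h2 : (m : ℝ) ≤ 2 * n := by exact_mod_cast h1
    simp
    linarith
  simp only [momentFunctional, LinearMap.sum_apply, LinearMap.smul_apply, lcoeff_apply,
    smul_eq_mul, betaFunctional, eval_pow, eval_X]
  simp only [eval_eq_sum_range' (Nat.lt_succ_of_le hq), Finset.sum_mul, mul_assoc]
  rw [integral_finsetSum _ hInt]
  refine Finset.sum_congr rfl fun m _ => ?_
  rw [integral_const_mul, mul_comm]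

open Polynomial in
theorem linearMap_mul_eq_zero_of_degree_lt (Λ : ℂ[X] →ₗ[ℂ] ℂ) {p : ℂ[X]} {n : ℕ} (a : ℂ)
    (h : ∀ m < n, Λ (p * (X - C a) ^ m) = 0) {r : ℂ[X]} (hr : r.degree < (n : WithBot ℕ)) :
    Λ (p * r) = 0 := by
  rw [← sum_taylor_eq r a, Polynomial.sum, Finset.mul_sum, map_sum]
  refine Finset.sum_eq_zero fun m hm => ?_
  have h1 : m < n := by
    have h2 := le_degree_of_mem_supp m hm
    rw [degree_taylor] at h2
    exact_mod_cast h2.trans_lt hr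
  rw [mul_left_comm, ← smul_eq_C_mul, map_smul, h m h1, smul_zero]

theorem poch_neg_eq_zero {m n : ℕ} (h : m < n) : poch (-(m : ℂ)) n = 0 := by
  rw [poch_neg_natCast, Nat.choose_eq_zero_of_lt h]
  simp

theorem poch_one (n : ℕ) : poch 1 n = n.factorial := by
  induction n with
  | zero => simp [poch_zero]
  | succ n ih => rw [poch_succ, ih, Nat.factorial_succ]; push_cast; ring

/-- The polynomial `p_{N-1}` for `N = n + 1`. -/
def lowPoly (s : ℂ) (n : ℕ) : Polynomial ℂ := hypPoly n (s + 1) ((2 * s.re + 2 : ℝ) : ℂ)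

/-- The polynomial `p̃_N` for `N = n + 1`. -/
def highPoly (s : ℂ) (n : ℕ) : Polynomial ℂ := hypPoly (n + 1) s ((2 * s.re + 1 : ℝ) : ℂ)

open Polynomial in
theorem momentFunctional_lowPoly {s : ℂ} (hs : -(1 / 2 : ℝ) < s.re) {n m : ℕ} (hm : m ≤ n) :
    momentFunctional s n (lowPoly s n * (X + C I) ^ m) =
      (-I) ^ n * I ^ m * betaJ (s + 1) ((starRingEnd ℂ) s + (n + 1 : ℕ) - m) *
        (poch (1 - ((n : ℂ) - m)) n / poch ((2 * s.re + 2 : ℝ) : ℂ) n) := by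
  have hm' : (m : ℝ) ≤ n := by exact_mod_cast hm
  rw [momentFunctional_eq hs, lowPoly, betaFunctional_hypPoly (b := s + 1)]
  · congr 3
    have := add_conj_eq s
    push_cast at this ⊢
    linear_combination -this
  · rw [Complex.ofReal_re]; linarith
  · simp; linarith
  · simp; linarith
  · push_cast; ring
  · refine natDegree_mul_le.trans ((add_le_add (natDegree_hypPoly_le _ _ _)
      natDegree_pow_le).trans ?_)
    rw [natDegree_X_add_C]
    omega

open Polynomial in
theorem momentFunctional_highPoly {s : ℂ} (hs : -(1 / 2 : ℝ) < s.re) {n m : ℕ} (hm : m < n) :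
    momentFunctional s n (highPoly s n * (X + C I) ^ m) = 0 := by
  have hm' : (m : ℝ) + 1 ≤ n := by exact_mod_cast hm
  rw [momentFunctional_eq hs, highPoly, betaFunctional_hypPoly (b := s)]
  · have h : ((2 * s.re + 1 : ℝ) : ℂ) - (s + ((starRingEnd ℂ) s + (n + 1 : ℕ)) - m - 1) =
        -((n - 1 - m : ℕ) : ℂ) := by
      have := add_conj_eq s
      rw [Nat.cast_sub (by omega), Nat.cast_sub (by omega)]
      push_cast at this ⊢
      linear_combination -this
    rw [h, poch_neg_eq_zero (by omega)]
    simp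
  · rw [Complex.ofReal_re]; linarith
  · simp; linarith
  · simp; linarith
  · push_cast; ring
  · refine natDegree_mul_le.trans ((add_le_add (natDegree_hypPoly_le _ _ _)
      natDegree_pow_le).trans ?_)
    rw [natDegree_X_add_C]
    omega

open Polynomial in
theorem momentFunctional_lowPoly_mul_eq_zero {s : ℂ} (hs : -(1 / 2 : ℝ) < s.re) {n : ℕ} {r : ℂ[X]}
    (hr : r.degree < (n : WithBot ℕ)) : momentFunctional s n (lowPoly s n * r) = 0 := by
  refine linearMap_mul_eq_zero_of_degree_lt _ (-I) (fun m hm => ?_) hr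
  rw [C_neg, sub_neg_eq_add, momentFunctional_lowPoly hs hm.le,
    show (1 : ℂ) - (n - m) = -((n - 1 - m : ℕ) : ℂ) by
      rw [Nat.cast_sub (by omega), Nat.cast_sub (by omega)]; push_cast; ring,
    poch_neg_eq_zero (by omega)]
  simp

open Polynomial in
theorem momentFunctional_highPoly_mul_eq_zero {s : ℂ} (hs : -(1 / 2 : ℝ) < s.re) {n : ℕ}
    {r : ℂ[X]} (hr : r.degree < (n : WithBot ℕ)) :
    momentFunctional s n (highPoly s n * r) = 0 := by
  refine linearMap_mul_eq_zero_of_degree_lt _ (-I) (fun m hm => ?_) hr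
  rw [C_neg, sub_neg_eq_add, momentFunctional_highPoly hs hm]

open Polynomial in
theorem momentFunctional_lowPoly_mul_X_pow {s : ℂ} (hs : -(1 / 2 : ℝ) < s.re) (n : ℕ) :
    momentFunctional s n (lowPoly s n * X ^ n) = orthNorm s n := by
  have h1 : (X ^ n - (X + C I) ^ n : ℂ[X]).degree < (n : WithBot ℕ) := by
    have h2 : (X ^ n : ℂ[X]).degree = n := degree_X_pow n
    have h3 : ((X + C I) ^ n : ℂ[X]).degree = n := by
      rw [degree_pow, degree_X_add_C]; simp
    rw [← h2]
    exact degree_sub_lt_left (h2.trans h3.symm) (pow_ne_zero _ X_ne_zero)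
      (by rw [(monic_X_pow n).leadingCoeff, ((monic_X_add_C I).pow n).leadingCoeff])
  have h2 : lowPoly s n * X ^ n = lowPoly s n * (X ^ n - (X + C I) ^ n) +
      lowPoly s n * (X + C I) ^ n := by ring
  rw [h2, map_add, momentFunctional_lowPoly_mul_eq_zero hs h1, zero_add,
    momentFunctional_lowPoly hs le_rfl, ← mul_pow, orthNorm, sub_self, sub_zero, poch_one,
    show (starRingEnd ℂ) s + ((n + 1 : ℕ) : ℂ) - n = (starRingEnd ℂ) s + 1 by push_cast; ring]
  simp

theorem momentFunctional_X_pow {s : ℂ} (hs : -(1 / 2 : ℝ) < s.re) {n : ℕ} (i j : Fin (n + 1)) :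
    momentFunctional s n (Polynomial.X ^ (i + j : ℕ)) =
      ((gramMatrix volume (wMonomial s (n + 1)) i j : ℝ) : ℂ) := by
  rw [momentFunctional_eq hs, betaFunctional, gramMatrix, Matrix.of_apply,
    ← integral_complex_ofReal]
  · simp only [wMonomial_mul, Complex.ofReal_mul, Complex.ofReal_pow, ofReal_wH]
    simp
  · rw [Polynomial.natDegree_X_pow]
    omega

theorem eval_highPoly (s : ℂ) (n : ℕ) (x : ℝ) :
    (highPoly s n).eval (x : ℂ) = pTil s (n + 1) x := eval_hypPoly _ _ _ _

theorem eval_lowPoly (s : ℂ) (n : ℕ) (x : ℝ) :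
    (lowPoly s n).eval (x : ℂ) = pPrev s (n + 1) x := eval_hypPoly _ _ _ _

/-- The reproducing kernel of the span of the functions `φ i` in `L²(ℝ)`. -/
def projKernel {n : ℕ} (φ : Fin n → ℝ → ℝ) (x y : ℝ) : ℝ :=
  ∑ i, ∑ j, (gramMatrix volume φ)⁻¹ i j * (φ i x * φ j y)

theorem phiN_mul_psiN_sub {s : ℂ} (hs : -(1 / 2 : ℝ) < s.re) (n : ℕ) (x y : ℝ) :
    phiN s (n + 1) x * psiN s (n + 1) y - psiN s (n + 1) x * phiN s (n + 1) y =
      orthNorm s n * ((x : ℂ) - y) * (projKernel (wMonomial s (n + 1)) x y : ℝ) := by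
  have hdet := det_gramMatrix_ne_zero (fun i => (differentiable_wMonomial s (n + 1) i).continuous)
    (integrable_wMonomial_mul hs) (linearIndependent_wMonomial s (n + 1))
  set G := gramMatrix volume (wMonomial s (n + 1)) with hG
  have hA : (G⁻¹.map Complex.ofReal : Matrix (Fin (n + 1)) (Fin (n + 1)) ℂ) *
      Matrix.of (fun i j : Fin (n + 1) =>
        momentFunctional s n (Polynomial.X ^ (i + j : ℕ))) = 1 := by
    have h1 : Matrix.of (fun i j : Fin (n + 1) =>
        momentFunctional s n (Polynomial.X ^ (i + j : ℕ))) = G.map Complex.ofReal := by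
      ext i j
      simp [momentFunctional_X_pow hs, hG]
    have h2 : G⁻¹ * G = 1 := Matrix.nonsing_inv_mul _ (isUnit_iff_ne_zero.2 hdet)
    have h3 := congrArg Complex.ofRealHom.mapMatrix h2
    rw [map_mul, map_one] at h3
    rw [h1]
    exact h3
  have h := christoffel_darboux (momentFunctional s n) (natDegree_hypPoly_le n (s + 1) _)
    (coeff_hypPoly n (s + 1) _) (natDegree_hypPoly_le (n + 1) s _) (coeff_hypPoly (n + 1) s _)
    (fun r hr => momentFunctional_lowPoly_mul_eq_zero hs hr)
    (fun r hr => momentFunctional_highPoly_mul_eq_zero hs hr)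
    (momentFunctional_lowPoly_mul_X_pow hs n) hA (y : ℂ) (x : ℂ)
  change (highPoly s n).eval _ * (lowPoly s n).eval _ -
    (lowPoly s n).eval _ * (highPoly s n).eval _ = _ at h
  rw [eval_highPoly, eval_lowPoly, eval_highPoly, eval_lowPoly] at h
  have h2 : ((projKernel (wMonomial s (n + 1)) x y : ℝ) : ℂ) =
      (∑ i : Fin (n + 1), ∑ j : Fin (n + 1), (G⁻¹.map Complex.ofReal) i j *
        ((x : ℂ) ^ (i : ℕ) * (y : ℂ) ^ (j : ℕ))) *
        (Real.sqrt (wH s (n + 1) x) * Real.sqrt (wH s (n + 1) y)) := by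
    simp only [projKernel, Finset.sum_mul, Complex.ofReal_sum, wMonomial]
    refine Finset.sum_congr rfl fun i _ => Finset.sum_congr rfl fun j _ => ?_
    simp only [Matrix.map_apply]
    push_cast
    ring
  rw [h2]
  simp only [phiN, psiN]
  linear_combination (-(Real.sqrt (wH s (n + 1) x) * Real.sqrt (wH s (n + 1) y) : ℂ)) * h

theorem differentiable_phiN (s : ℂ) (n : ℕ) : Differentiable ℝ (phiN s (n + 1)) := by
  have h : phiN s (n + 1) = fun x : ℝ =>
      (highPoly s n).eval (x : ℂ) * ((Real.sqrt (wH s (n + 1) x) : ℝ) : ℂ) := by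
    ext x; rw [eval_highPoly, phiN]
  rw [h]
  exact fun x => (((highPoly s n).hasDerivAt (x : ℂ)).comp_ofReal.differentiableAt).mul
    ((differentiable_sqrt_wH s (n + 1) x).hasDerivAt.ofReal_comp.differentiableAt)

theorem differentiable_psiN (s : ℂ) (n : ℕ) : Differentiable ℝ (psiN s (n + 1)) := by
  have h : psiN s (n + 1) = fun x : ℝ =>
      (lowPoly s n).eval (x : ℂ) * ((Real.sqrt (wH s (n + 1) x) : ℝ) : ℂ) := by
    ext x; rw [eval_lowPoly, psiN]
  rw [h]
  exact fun x => (((lowPoly s n).hasDerivAt (x : ℂ)).comp_ofReal.differentiableAt).mul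
    ((differentiable_sqrt_wH s (n + 1) x).hasDerivAt.ofReal_comp.differentiableAt)

theorem KNC_eq_projKernel {s : ℂ} (hs : -(1 / 2 : ℝ) < s.re) (n : ℕ) (x y : ℝ) :
    KNC s (n + 1) x y = (projKernel (wMonomial s (n + 1)) x y : ℝ) := by
  have hC := CNs_mul_orthNorm hs n
  rw [KNC]
  split_ifs with hxy
  · subst hxy
    have hd : Differentiable ℝ fun u => projKernel (wMonomial s (n + 1)) u x := by
      unfold projKernel
      refine Differentiable.fun_sum fun i _ => Differentiable.fun_sum fun j _ => ?_
      exact ((differentiable_wMonomial s (n + 1) i).mul_const _).const_mul _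
    have h1 := ((differentiable_phiN s n x).hasDerivAt.mul_const (psiN s (n + 1) x)).sub
      ((differentiable_psiN s n x).hasDerivAt.mul_const (phiN s (n + 1) x))
    have h2 := ((((hasDerivAt_id x).ofReal_comp.sub_const (x : ℂ)).const_mul (orthNorm s n)).mul
      (hd x).hasDerivAt.ofReal_comp)
    have h3 := h1.unique (h2.congr_of_eventuallyEq
      (Eventually.of_forall fun u => phiN_mul_psiN_sub hs n u x))
    rw [h3]
    simp only [id, sub_self, mul_zero, zero_mul, add_zero, Complex.ofReal_one, mul_one]
    rw [← mul_assoc, hC, one_mul]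
  · have h : (x : ℂ) - y ≠ 0 := sub_ne_zero.2 fun h => hxy (by exact_mod_cast h)
    rw [phiN_mul_psiN_sub hs, div_eq_iff h]
    linear_combination ((x : ℂ) - y) * (projKernel (wMonomial s (n + 1)) x y : ℝ) * hC

theorem KN_eq_projKernel {s : ℂ} (hs : -(1 / 2 : ℝ) < s.re) (n : ℕ) (x y : ℝ) :
    KN s (n + 1) x y = projKernel (wMonomial s (n + 1)) x y := by
  rw [KN, KNC_eq_projKernel hs, Complex.ofReal_re]

theorem ofReal_KN {s : ℂ} (hs : -(1 / 2 : ℝ) < s.re) (n : ℕ) (x y : ℝ) :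
    ((KN s (n + 1) x y : ℝ) : ℂ) = KNC s (n + 1) x y := by
  rw [KN_eq_projKernel hs, KNC_eq_projKernel hs]

theorem fredholmDet_Kscaled_nonneg_monotone {s : ℂ} (hs : -(1 / 2 : ℝ) < s.re) (n : ℕ) :
    (∀ t, 0 ≤ fredholmDet (Kscaled s (n + 1)) t) ∧ Monotone (fredholmDet (Kscaled s (n + 1))) := by
  have hN : (0 : ℝ) < (n + 1 : ℕ) := by positivity
  have hmul : ∀ (i j : Fin (n + 1)) (x y : ℝ), (Real.sqrt (n + 1 : ℕ) *
      wMonomial s (n + 1) i ((n + 1 : ℕ) * x)) *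
        (Real.sqrt (n + 1 : ℕ) * wMonomial s (n + 1) j ((n + 1 : ℕ) * y)) = (n + 1 : ℕ) *
      (wMonomial s (n + 1) i ((n + 1 : ℕ) * x) * wMonomial s (n + 1) j ((n + 1 : ℕ) * y)) :=
    fun i j x y => by rw [mul_mul_mul_comm, Real.mul_self_sqrt hN.le]
  have hInt : ∀ i j, Integrable fun x => (Real.sqrt (n + 1 : ℕ) *
      wMonomial s (n + 1) i ((n + 1 : ℕ) * x)) *
        (Real.sqrt (n + 1 : ℕ) * wMonomial s (n + 1) j ((n + 1 : ℕ) * x)) := fun i j => by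
    simp only [hmul]
    exact ((integrable_wMonomial_mul hs i j).comp_mul_left' hN.ne').const_mul _
  have hgram : gramMatrix volume (fun i x => Real.sqrt (n + 1 : ℕ) *
      wMonomial s (n + 1) i ((n + 1 : ℕ) * x)) = gramMatrix volume (wMonomial s (n + 1)) := by
    ext i j
    simp only [gramMatrix, Matrix.of_apply, hmul]
    rw [integral_const_mul, Measure.integral_comp_mul_left
      (fun x => wMonomial s (n + 1) i x * wMonomial s (n + 1) j x), abs_of_pos (inv_pos.2 hN),
      smul_eq_mul, mul_inv_cancel_left₀ hN.ne']
  refine fredholmDet_nonneg_monotone hInt ?_ fun x y => ?_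
  · rw [hgram]
    exact det_gramMatrix_ne_zero (fun i => (differentiable_wMonomial s (n + 1) i).continuous)
      (integrable_wMonomial_mul hs) (linearIndependent_wMonomial s (n + 1))
  · rw [hgram, Kscaled, KN_eq_projKernel hs, projKernel, Finset.mul_sum]
    refine Finset.sum_congr rfl fun i _ => ?_
    rw [Finset.mul_sum]
    refine Finset.sum_congr rfl fun j _ => ?_
    rw [hmul]
    ring

/-! ### Integrable kernels in the inverse variable -/

/-- The bracket `(a(ζ) g(η) - g(ζ) a(η)) / (η - ζ)`, extended to the diagonal. -/
def bracket (a g : ℂ → ℂ) (ζ η : ℂ) : ℂ := a ζ * dslope g ζ η - g ζ * dslope a ζ η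

theorem bracket_of_ne (a g : ℂ → ℂ) {ζ η : ℂ} (h : ζ ≠ η) :
    bracket a g ζ η = (a ζ * g η - g ζ * a η) / (η - ζ) := by
  have h' : η - ζ ≠ 0 := sub_ne_zero.2 h.symm
  rw [bracket, dslope_of_ne _ h.symm, dslope_of_ne _ h.symm, slope_def_field, slope_def_field]
  field_simp
  ring

theorem bracket_self (a g : ℂ → ℂ) (ζ : ℂ) :
    bracket a g ζ ζ = a ζ * deriv g ζ - g ζ * deriv a ζ := by
  rw [bracket, dslope_same, dslope_same]

theorem norm_dslope_le {f : ℂ → ℂ} {S : Set ℂ} {M : ℝ} (hS : Convex ℝ S)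
    (hf : ∀ z ∈ S, DifferentiableAt ℂ f z) (hM : ∀ z ∈ S, ‖deriv f z‖ ≤ M) {ζ η : ℂ}
    (hζ : ζ ∈ S) (hη : η ∈ S) : ‖dslope f ζ η‖ ≤ M := by
  rcases eq_or_ne η ζ with rfl | h
  · rw [dslope_same]
    exact hM _ hη
  · rw [dslope_of_ne _ h, slope_def_field, norm_div,
      div_le_iff₀ (norm_pos_iff.2 (sub_ne_zero.2 h))]
    exact hS.norm_image_sub_le_of_norm_deriv_le hf hM hζ hη

theorem norm_bracket_le {a g : ℂ → ℂ} {S : Set ℂ} {M M' : ℝ} (hS : Convex ℝ S)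
    (ha : ∀ z ∈ S, DifferentiableAt ℂ a z) (hg : ∀ z ∈ S, DifferentiableAt ℂ g z)
    (haM : ∀ z ∈ S, ‖a z‖ ≤ M) (hgM : ∀ z ∈ S, ‖g z‖ ≤ M)
    (haM' : ∀ z ∈ S, ‖deriv a z‖ ≤ M') (hgM' : ∀ z ∈ S, ‖deriv g z‖ ≤ M') {ζ η : ℂ}
    (hζ : ζ ∈ S) (hη : η ∈ S) : ‖bracket a g ζ η‖ ≤ 2 * (M * M') := by
  have hM : 0 ≤ M := (norm_nonneg _).trans (haM ζ hζ)
  have h1 := mul_le_mul (haM ζ hζ) (norm_dslope_le hS hg hgM' hζ hη) (norm_nonneg _) hM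
  have h2 := mul_le_mul (hgM ζ hζ) (norm_dslope_le hS ha haM' hζ hη) (norm_nonneg _) hM
  rw [bracket]
  refine (norm_sub_le _ _).trans ?_
  rw [norm_mul, norm_mul]
  linarith

/-- The kernel on `(1,∞)²` obtained by rescaling a kernel of the form
`c (x y)^{-α-1} bracket a g x⁻¹ y⁻¹` on `(τ⁻¹,∞)²`. -/
def tailKernel (α : ℝ) (c : ℂ) (a g : ℂ → ℂ) (τ : ℂ) (u v : ℝ) : ℂ :=
  c * τ ^ ((2 * α + 1 : ℝ) : ℂ) *
    ((((max 1 u)⁻¹ ^ (α + 1) * (max 1 v)⁻¹ ^ (α + 1) : ℝ) : ℂ) *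
      bracket a g (τ * ((max 1 u)⁻¹ : ℝ)) (τ * ((max 1 v)⁻¹ : ℝ)))

/-- The Fredholm determinant of `tailKernel` on `(1,∞)`. -/
def tailDet (α : ℝ) (c : ℂ) (a g : ℂ → ℂ) (τ : ℂ) : ℂ :=
  fredSeries (volume.restrict (Ioi (1 : ℝ))) (tailKernel α c a g τ)

theorem inv_max_pos (u : ℝ) : 0 < (max 1 u)⁻¹ := by positivity

theorem inv_max_le_one (u : ℝ) : (max 1 u)⁻¹ ≤ 1 := inv_le_one_of_one_le₀ (le_max_left _ _)

theorem integrable_inv_max_rpow_sq {α : ℝ} (hα : -(1 / 2) < α) :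
    Integrable (fun u : ℝ => ((max 1 u)⁻¹ ^ (α + 1)) ^ 2) (volume.restrict (Ioi 1)) := by
  have h := integrableOn_Ioi_rpow_of_lt (a := -(2 * α + 2)) (by linarith) one_pos
  refine h.congr_fun (fun u hu => ?_) measurableSet_Ioi
  have hu' : (1 : ℝ) < u := hu
  have hu0 : 0 ≤ u := by linarith
  simp only [max_eq_right hu'.le]
  rw [Real.inv_rpow hu0, ← Real.rpow_neg hu0, ← Real.rpow_natCast (u ^ (-(α + 1))),
    ← Real.rpow_mul hu0]
  congr 1
  push_cast
  ring

theorem continuous_inv_max : Continuous fun u : ℝ => (max 1 u)⁻¹ :=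
  (continuous_const.max continuous_id).inv₀ fun _ => (lt_max_of_lt_left one_pos).ne'

theorem isOpen_re_pos : IsOpen {τ : ℂ | 0 < τ.re} :=
  isOpen_lt continuous_const Complex.continuous_re

theorem measurable_tailKernel {α : ℝ} {c : ℂ} {a g : ℂ → ℂ} {τ : ℂ} {S : Set ℂ} (hS : IsOpen S)
    (hτS : ∀ u : ℝ, τ * ((max 1 u)⁻¹ : ℝ) ∈ S)
    (ha : DifferentiableOn ℂ a S) (hg : DifferentiableOn ℂ g S) :
    Measurable fun p : ℝ × ℝ => tailKernel α c a g τ p.1 p.2 := by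
  have hm : Continuous fun u : ℝ => τ * (((max 1 u)⁻¹ : ℝ) : ℂ) :=
    continuous_const.mul (Complex.continuous_ofReal.comp continuous_inv_max)
  have hcomp : ∀ f : ℂ → ℂ, ContinuousOn f S → Measurable fun u : ℝ => f (τ * ((max 1 u)⁻¹ : ℝ)) :=
    fun f hf => (hf.comp_continuous hm hτS).measurable
  have hset : MeasurableSet {p : ℝ × ℝ |
      τ * (((max 1 p.1)⁻¹ : ℝ) : ℂ) = τ * (((max 1 p.2)⁻¹ : ℝ) : ℂ)} :=
    measurableSet_eq_fun (hm.measurable.comp measurable_fst) (hm.measurable.comp measurable_snd)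
  have ha1 := hcomp a ha.continuousOn
  have hg1 := hcomp g hg.continuousOn
  have ha2 := hcomp _ (ha.deriv hS).continuousOn
  have hg2 := hcomp _ (hg.deriv hS).continuousOn
  have hb : Measurable fun p : ℝ × ℝ =>
      bracket a g (τ * ((max 1 p.1)⁻¹ : ℝ)) (τ * ((max 1 p.2)⁻¹ : ℝ)) := by
    classical
    have h1 : Measurable fun p : ℝ × ℝ =>
        if τ * (((max 1 p.1)⁻¹ : ℝ) : ℂ) = τ * (((max 1 p.2)⁻¹ : ℝ) : ℂ) then
          a (τ * ((max 1 p.1)⁻¹ : ℝ)) * deriv g (τ * ((max 1 p.1)⁻¹ : ℝ)) -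
            g (τ * ((max 1 p.1)⁻¹ : ℝ)) * deriv a (τ * ((max 1 p.1)⁻¹ : ℝ))
        else (a (τ * ((max 1 p.1)⁻¹ : ℝ)) * g (τ * ((max 1 p.2)⁻¹ : ℝ)) -
            g (τ * ((max 1 p.1)⁻¹ : ℝ)) * a (τ * ((max 1 p.2)⁻¹ : ℝ))) /
          (τ * ((max 1 p.2)⁻¹ : ℝ) - τ * ((max 1 p.1)⁻¹ : ℝ)) := by
      refine Measurable.ite hset ?_ ?_
      · exact ((ha1.comp measurable_fst).mul (hg2.comp measurable_fst)).sub
          ((hg1.comp measurable_fst).mul (ha2.comp measurable_fst))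
      · exact (((ha1.comp measurable_fst).mul (hg1.comp measurable_snd)).sub
          ((hg1.comp measurable_fst).mul (ha1.comp measurable_snd))).div
          ((hm.measurable.comp measurable_snd).sub (hm.measurable.comp measurable_fst))
    convert h1 using 2 with p
    split_ifs with h
    · rw [← h, bracket_self]
    · rw [bracket_of_ne _ _ h]
  have hv : Continuous fun u : ℝ => (max 1 u)⁻¹ ^ (α + 1) :=
    continuous_inv_max.rpow_const fun u => Or.inl (inv_max_pos u).ne'
  have hp : Measurable fun p : ℝ × ℝ =>
      (((max 1 p.1)⁻¹ ^ (α + 1) * (max 1 p.2)⁻¹ ^ (α + 1) : ℝ) : ℂ) :=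
    Complex.measurable_ofReal.comp
      ((hv.measurable.comp measurable_fst).mul (hv.measurable.comp measurable_snd))
  exact (hp.mul hb).const_mul _

theorem norm_tailKernel_le {α : ℝ} {c : ℂ} {a g : ℂ → ℂ} {τ : ℂ} {B : ℝ} {u v : ℝ}
    (hB : ‖bracket a g (τ * ((max 1 u)⁻¹ : ℝ)) (τ * ((max 1 v)⁻¹ : ℝ))‖ ≤ B) :
    ‖tailKernel α c a g τ u v‖ ≤ ‖c‖ * ‖τ‖ ^ (2 * α + 1) * B *
      ((max 1 u)⁻¹ ^ (α + 1) * (max 1 v)⁻¹ ^ (α + 1)) := by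
  have h1 := inv_max_pos u
  have h2 := inv_max_pos v
  rw [tailKernel, norm_mul, norm_mul, norm_mul, Complex.norm_cpow_real, Complex.norm_real,
    Real.norm_of_nonneg (by positivity)]
  calc _ ≤ ‖c‖ * ‖τ‖ ^ (2 * α + 1) *
        ((max 1 u)⁻¹ ^ (α + 1) * (max 1 v)⁻¹ ^ (α + 1) * B) := by gcongr
    _ = _ := by ring

theorem differentiableOn_tailKernel {α : ℝ} {c : ℂ} {a g : ℂ → ℂ} {S : Set ℂ} (hS : IsOpen S)
    (ha : DifferentiableOn ℂ a S) (hg : DifferentiableOn ℂ g S) {T : Set ℂ}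
    (hT : ∀ τ ∈ T, 0 < τ.re) (hTS : ∀ τ ∈ T, ∀ u : ℝ, τ * ((max 1 u)⁻¹ : ℝ) ∈ S) (u v : ℝ) :
    DifferentiableOn ℂ (fun τ => tailKernel α c a g τ u v) T := by
  have hlin : ∀ w : ℂ, DifferentiableOn ℂ (fun τ : ℂ => τ * w) T :=
    fun w => differentiableOn_id.mul_const w
  have hcomp : ∀ f : ℂ → ℂ, DifferentiableOn ℂ f S → ∀ u : ℝ,
      DifferentiableOn ℂ (fun τ => f (τ * ((max 1 u)⁻¹ : ℝ))) T :=
    fun f hf u => hf.comp (hlin _) fun τ hτ => hTS τ hτ u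
  have hpow : DifferentiableOn ℂ (fun τ : ℂ => c * τ ^ ((2 * α + 1 : ℝ) : ℂ)) T := fun τ hτ =>
    ((differentiableAt_id.cpow_const (Or.inl (hT τ hτ))).const_mul c).differentiableWithinAt
  refine hpow.mul (DifferentiableOn.const_mul ?_ _)
  rcases eq_or_ne (max 1 u)⁻¹ (max 1 v)⁻¹ with h | h
  · simp only [h, bracket_self]
    exact ((hcomp a ha v).mul (hcomp _ (hg.deriv hS) v)).sub
      ((hcomp g hg v).mul (hcomp _ (ha.deriv hS) v))
  · have hne : ∀ τ ∈ T, τ * (((max 1 u)⁻¹ : ℝ) : ℂ) ≠ τ * (((max 1 v)⁻¹ : ℝ) : ℂ) := by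
      intro τ hτ h0
      have hτ0 : τ ≠ 0 := fun h => by simpa [h] using hT τ hτ
      exact h (by exact_mod_cast mul_left_cancel₀ hτ0 h0)
    have h1 : DifferentiableOn ℂ (fun τ : ℂ =>
        (a (τ * ((max 1 u)⁻¹ : ℝ)) * g (τ * ((max 1 v)⁻¹ : ℝ)) -
          g (τ * ((max 1 u)⁻¹ : ℝ)) * a (τ * ((max 1 v)⁻¹ : ℝ))) /
          (τ * ((max 1 v)⁻¹ : ℝ) - τ * ((max 1 u)⁻¹ : ℝ))) T :=
      (((hcomp a ha u).mul (hcomp g hg v)).sub ((hcomp g hg u).mul (hcomp a ha v))).div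
        ((hlin _).sub (hlin _)) fun τ hτ => sub_ne_zero.2 (hne τ hτ).symm
    exact h1.congr fun τ hτ => bracket_of_ne _ _ (hne τ hτ)

/-- A truncated closed cone around the positive real axis. -/
def truncCone (κ R : ℝ) : Set ℂ := {ζ | |ζ.im| ≤ κ * ζ.re ∧ ‖ζ‖ ≤ R}

theorem convex_truncCone (κ R : ℝ) : Convex ℝ (truncCone κ R) := by
  have h1 : Convex ℝ (Metric.closedBall (0 : ℂ) R) := convex_closedBall _ _
  intro x hx y hy p q hp hq hpq
  refine ⟨?_, by simpa using h1 (by simpa using hx.2) (by simpa using hy.2) hp hq hpq⟩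
  simp only [Complex.add_im, Complex.real_smul, Complex.im_ofReal_mul, Complex.add_re,
    Complex.re_ofReal_mul]
  calc _ ≤ |p * x.im| + |q * y.im| := abs_add_le _ _
    _ = p * |x.im| + q * |y.im| := by rw [abs_mul, abs_mul, abs_of_nonneg hp, abs_of_nonneg hq]
    _ ≤ p * (κ * x.re) + q * (κ * y.re) := by gcongr; exacts [hx.1, hy.1]
    _ = _ := by ring

theorem isCompact_truncCone (κ R : ℝ) : IsCompact (truncCone κ R) := by
  refine (isCompact_closedBall (0 : ℂ) R).of_isClosed_subset ?_ fun ζ hζ => by simpa using hζ.2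
  exact (isClosed_le (continuous_abs.comp Complex.continuous_im)
    (continuous_const.mul Complex.continuous_re)).inter
    (isClosed_le continuous_norm continuous_const)

theorem mul_inv_max_mem_truncCone {κ R : ℝ} {τ : ℂ} (hτ : τ ∈ truncCone κ R) (u : ℝ) :
    τ * ((max 1 u)⁻¹ : ℝ) ∈ truncCone κ R := by
  have h1 := inv_max_pos u
  refine ⟨?_, ?_⟩
  · rw [Complex.re_mul_ofReal, Complex.im_mul_ofReal, abs_mul, abs_of_pos h1, ← mul_assoc]
    exact mul_le_mul_of_nonneg_right hτ.1 h1.le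
  · rw [norm_mul, Complex.norm_real, Real.norm_of_nonneg h1.le]
    exact (mul_le_of_le_one_right (norm_nonneg _) (inv_max_le_one u)).trans hτ.2

theorem exists_ball_subset_truncCone {τ : ℂ} (hτ : 0 < τ.re) :
    ∃ r > 0, ∃ κ R : ℝ, 0 < κ ∧ Metric.ball τ r ⊆ truncCone κ R ∧
      ∀ z ∈ Metric.ball τ r, 0 < z.re := by
  have hball : ∀ z ∈ Metric.ball τ (τ.re / 2), τ.re / 2 ≤ z.re ∧ ‖z‖ ≤ ‖τ‖ + τ.re / 2 := by
    intro z hz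
    rw [Metric.mem_ball, dist_eq_norm] at hz
    constructor
    · have h1 := (abs_le.1 (Complex.abs_re_le_norm (z - τ))).1
      rw [Complex.sub_re] at h1
      linarith
    · have := norm_add_le (z - τ) τ
      rw [sub_add_cancel] at this
      linarith
  refine ⟨τ.re / 2, half_pos hτ, (‖τ‖ + τ.re / 2) / (τ.re / 2), ‖τ‖ + τ.re / 2, by positivity,
    fun z hz => ⟨?_, (hball z hz).2⟩, fun z hz => (half_pos hτ).trans_le (hball z hz).1⟩
  rw [div_mul_eq_mul_div, le_div_iff₀ (half_pos hτ)]
  exact mul_le_mul ((Complex.abs_im_le_norm z).trans (hball z hz).2) (hball z hz).1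
    (half_pos hτ).le (by positivity)

theorem truncCone_subset {κ R : ℝ} (hκ : 0 < κ) {U : Set ℂ} (h0 : (0 : ℂ) ∈ U)
    (hU : ∀ z : ℂ, 0 < z.re → z ∈ U) : truncCone κ R ⊆ U := by
  intro z hz
  rcases lt_or_ge 0 z.re with h | h
  · exact hU z h
  · have h1 : 0 ≤ κ * z.re := (abs_nonneg _).trans hz.1
    have h2 : z.re = 0 := le_antisymm h (nonneg_of_mul_nonneg_right h1 hκ)
    have h3 : |z.im| ≤ 0 := by simpa [h2] using hz.1
    have : z = 0 := Complex.ext h2 (abs_nonpos_iff.1 h3)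
    rwa [this]

theorem norm_tailKernel_le_of_convex {α : ℝ} (hα : -(1 / 2) < α) {c : ℂ} {a g : ℂ → ℂ}
    {S : Set ℂ} {M M' R C : ℝ} (hS : Convex ℝ S) (ha : ∀ z ∈ S, DifferentiableAt ℂ a z)
    (hg : ∀ z ∈ S, DifferentiableAt ℂ g z) (haM : ∀ z ∈ S, ‖a z‖ ≤ M) (hgM : ∀ z ∈ S, ‖g z‖ ≤ M)
    (haM' : ∀ z ∈ S, ‖deriv a z‖ ≤ M') (hgM' : ∀ z ∈ S, ‖deriv g z‖ ≤ M') (hc : ‖c‖ ≤ C)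
    {τ : ℂ} (hτ : ‖τ‖ ≤ R) (hτS : ∀ u : ℝ, τ * ((max 1 u)⁻¹ : ℝ) ∈ S) (u v : ℝ) :
    ‖tailKernel α c a g τ u v‖ ≤ C * R ^ (2 * α + 1) * (2 * (M * M')) *
      ((max 1 u)⁻¹ ^ (α + 1) * (max 1 v)⁻¹ ^ (α + 1)) := by
  have h1 := inv_max_pos u
  have h2 := inv_max_pos v
  have hM : 0 ≤ M := (norm_nonneg _).trans (haM _ (hτS u))
  have hM' : 0 ≤ M' := (norm_nonneg _).trans (haM' _ (hτS u))
  refine (norm_tailKernel_le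
    (norm_bracket_le hS ha hg haM hgM haM' hgM' (hτS u) (hτS v))).trans ?_
  have hR : ‖τ‖ ^ (2 * α + 1) ≤ R ^ (2 * α + 1) :=
    Real.rpow_le_rpow (norm_nonneg _) hτ (by linarith)
  have hC : 0 ≤ C := (norm_nonneg _).trans hc
  gcongr

theorem differentiableOn_tailDet {α : ℝ} (hα : -(1 / 2) < α) (c : ℂ) {a g : ℂ → ℂ} {U : Set ℂ}
    (hUo : IsOpen U) (h0 : (0 : ℂ) ∈ U) (hU : ∀ z : ℂ, 0 < z.re → z ∈ U)
    (ha : DifferentiableOn ℂ a U) (hg : DifferentiableOn ℂ g U) :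
    DifferentiableOn ℂ (tailDet α c a g) {τ | 0 < τ.re} := by
  intro τ hτ
  obtain ⟨r, hr, κ, R, hκ, hball, hre⟩ := exists_ball_subset_truncCone hτ
  have hsub : truncCone κ R ⊆ U := truncCone_subset hκ h0 hU
  have hbd : ∀ f : ℂ → ℂ, ContinuousOn f U → ∃ M, ∀ z ∈ truncCone κ R, ‖f z‖ ≤ M := fun f hf =>
    (isCompact_truncCone κ R).exists_bound_of_continuousOn (hf.mono hsub)
  obtain ⟨M₁, h₁⟩ := hbd a ha.continuousOn
  obtain ⟨M₂, h₂⟩ := hbd g hg.continuousOn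
  obtain ⟨M₃, h₃⟩ := hbd _ (ha.deriv hUo).continuousOn
  obtain ⟨M₄, h₄⟩ := hbd _ (hg.deriv hUo).continuousOn
  have hR : 0 ≤ R := (norm_nonneg _).trans (hball (Metric.mem_ball_self hr)).2
  have hmem : ∀ z ∈ Metric.ball τ r, ∀ u : ℝ, z * ((max 1 u)⁻¹ : ℝ) ∈ truncCone κ R :=
    fun z hz u => mul_inv_max_mem_truncCone (hball hz) u
  have hM1 : 0 ≤ max M₁ M₂ :=
    (norm_nonneg _).trans ((h₁ _ (hball (Metric.mem_ball_self hr))).trans (le_max_left _ _))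
  have hM2 : 0 ≤ max M₃ M₄ :=
    (norm_nonneg _).trans ((h₃ _ (hball (Metric.mem_ball_self hr))).trans (le_max_left _ _))
  have key := differentiableOn_fredSeries_ball (μ := volume.restrict (Ioi (1 : ℝ)))
    (integrable_inv_max_rpow_sq hα) (L := tailKernel α c a g)
    (z₀ := τ) (r := r) (C := ‖c‖ * R ^ (2 * α + 1) * (2 * (max M₁ M₂ * max M₃ M₄)))
    (by positivity)
    (fun z hz => measurable_tailKernel hUo (fun u => hsub (hmem z hz u)) ha hg)
    (fun u v => differentiableOn_tailKernel hUo ha hg hre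
      (fun z hz u => hsub (hmem z hz u)) u v)
    (fun z hz u v => norm_tailKernel_le_of_convex hα (convex_truncCone κ R)
      (fun z hz => ha.differentiableAt (hUo.mem_nhds (hsub hz)))
      (fun z hz => hg.differentiableAt (hUo.mem_nhds (hsub hz)))
      (fun z hz => (h₁ z hz).trans (le_max_left _ _))
      (fun z hz => (h₂ z hz).trans (le_max_right _ _))
      (fun z hz => (h₃ z hz).trans (le_max_left _ _))
      (fun z hz => (h₄ z hz).trans (le_max_right _ _)) le_rfl (hball hz).2 (hmem z hz) u v)
  exact (key.differentiableAt (Metric.ball_mem_nhds τ hr)).differentiableWithinAt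

theorem HoloConv.bound_on_compact {f : ℕ → ℂ → ℂ} {g : ℂ → ℂ} {Ω K : Set ℂ}
    (h : HoloConv f g Ω) (hK : IsCompact K) (hKΩ : K ⊆ Ω) :
    ∃ B, ∀ᶠ n in atTop, ∀ w ∈ K, DifferentiableAt ℂ (f n) w ∧ ‖f n w‖ ≤ B := by
  refine hK.induction_on (p := fun S => ∃ B, ∀ᶠ n in atTop, ∀ w ∈ S,
    DifferentiableAt ℂ (f n) w ∧ ‖f n w‖ ≤ B) ⟨0, by simp⟩ ?_ ?_ ?_
  · rintro S T hST ⟨B, hB⟩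
    exact ⟨B, hB.mono fun n hn w hw => hn w (hST hw)⟩
  · rintro S T ⟨B, hB⟩ ⟨B', hB'⟩
    refine ⟨max B B', ?_⟩
    filter_upwards [hB, hB'] with n hn hn' w hw
    rcases hw with hw | hw
    · exact ⟨(hn w hw).1, (hn w hw).2.trans (le_max_left _ _)⟩
    · exact ⟨(hn' w hw).1, (hn' w hw).2.trans (le_max_right _ _)⟩
  · intro z hz
    obtain ⟨r, hr, -, B, hB⟩ := h.diff z (hKΩ hz)
    refine ⟨Metric.ball z r, mem_nhdsWithin_of_mem_nhds (Metric.ball_mem_nhds z hr), B, ?_⟩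
    filter_upwards [hB] with n hn w hw
    exact ⟨hn.1.differentiableAt (Metric.isOpen_ball.mem_nhds hw), hn.2 w hw⟩

theorem HoloConv.mul {f f' : ℕ → ℂ → ℂ} {g g' : ℂ → ℂ} {Ω : Set ℂ} (h : HoloConv f g Ω)
    (h' : HoloConv f' g' Ω) :
    HoloConv (fun n z => f n z * f' n z) (fun z => g z * g' z) Ω where
  diff z hz := by
    obtain ⟨r, hr, hrΩ, B, hB⟩ := h.diff z hz
    obtain ⟨r', hr', -, B', hB'⟩ := h'.diff z hz
    refine ⟨min r r', lt_min hr hr',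
      (Metric.ball_subset_ball (min_le_left _ _)).trans hrΩ, B * B', ?_⟩
    filter_upwards [hB, hB'] with n hn hn'
    have hs := Metric.ball_subset_ball (x := z) (min_le_left r r')
    have hs' := Metric.ball_subset_ball (x := z) (min_le_right r r')
    refine ⟨(hn.1.mono hs).mul (hn'.1.mono hs'), fun w hw => ?_⟩
    rw [norm_mul]
    exact mul_le_mul (hn.2 w (hs hw)) (hn'.2 w (hs' hw)) (norm_nonneg _)
      ((norm_nonneg _).trans (hn.2 w (hs hw)))
  lim z hz := (h.lim z hz).mul (h'.lim z hz)
  diff_lim := h.diff_lim.mul h'.diff_lim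

theorem HoloConv.tendsto_bracket {a g : ℕ → ℂ → ℂ} {a' g' : ℂ → ℂ} (ha : HoloConv a a' univ)
    (hg : HoloConv g g' univ) (ζ η : ℂ) :
    Tendsto (fun n => bracket (a n) (g n) ζ η) atTop (nhds (bracket a' g' ζ η)) := by
  have h : ∀ {f : ℕ → ℂ → ℂ} {f' : ℂ → ℂ}, HoloConv f f' univ →
      Tendsto (fun n => dslope (f n) ζ η) atTop (nhds (dslope f' ζ η)) := by
    intro f f' hf
    rcases eq_or_ne η ζ with rfl | hne
    · simpa only [dslope_same] using hf.tendsto_deriv (mem_univ _)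
    · simp only [dslope_of_ne _ hne, slope_def_field]
      exact ((hf.lim _ (mem_univ _)).sub (hf.lim _ (mem_univ _))).div_const _
  exact ((ha.lim _ (mem_univ _)).mul (h hg)).sub ((hg.lim _ (mem_univ _)).mul (h ha))

theorem HoloConv.tailDet {α : ℝ} (hα : -(1 / 2) < α) {c : ℕ → ℂ} {c' : ℂ}
    {a g : ℕ → ℂ → ℂ} {a' g' : ℂ → ℂ} (hc : Tendsto c atTop (nhds c'))
    (ha : HoloConv a a' univ) (hg : HoloConv g g' univ) :
    HoloConv (fun n => tailDet α (c n) (a n) (g n)) (tailDet α c' a' g') {τ | 0 < τ.re} := by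
  have key : ∀ τ : ℂ, 0 < τ.re → ∃ r > 0, ∃ C, 0 ≤ C ∧
      (∀ z ∈ Metric.ball τ r, 0 < z.re) ∧ ∀ᶠ n in atTop,
      ∃ S : Set ℂ, IsOpen S ∧ DifferentiableOn ℂ (a n) S ∧ DifferentiableOn ℂ (g n) S ∧
        ∀ z ∈ Metric.ball τ r, (∀ u : ℝ, z * ((max 1 u)⁻¹ : ℝ) ∈ S) ∧
          ∀ u v, ‖tailKernel α (c n) (a n) (g n) z u v‖ ≤
            C * ((max 1 u)⁻¹ ^ (α + 1) * (max 1 v)⁻¹ ^ (α + 1)) := by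
    intro τ hτ
    obtain ⟨r, hr, κ, R, hκ, hball, hre⟩ := exists_ball_subset_truncCone hτ
    have hR : 0 ≤ R := (norm_nonneg _).trans (hball (Metric.mem_ball_self hr)).2
    have hbd : ∀ {f : ℕ → ℂ → ℂ} {f' : ℂ → ℂ}, HoloConv f f' univ → ∃ M, 0 ≤ M ∧
        ∀ᶠ n in atTop, ∀ w ∈ Metric.ball (0 : ℂ) (R + 1),
          DifferentiableAt ℂ (f n) w ∧ ‖f n w‖ ≤ M := by
      intro f f' hf
      obtain ⟨M, hM⟩ := hf.bound_on_compact (isCompact_closedBall (0 : ℂ) (R + 1)) (subset_univ _)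
      refine ⟨max M 0, le_max_right _ _, hM.mono fun n hn w hw => ?_⟩
      have := hn w (Metric.ball_subset_closedBall hw)
      exact ⟨this.1, this.2.trans (le_max_left _ _)⟩
    obtain ⟨M₁, h₁, h₁'⟩ := hbd ha
    obtain ⟨M₂, h₂, h₂'⟩ := hbd hg
    obtain ⟨M₃, h₃, h₃'⟩ := hbd (ha.deriv isOpen_univ)
    obtain ⟨M₄, h₄, h₄'⟩ := hbd (hg.deriv isOpen_univ)
    refine ⟨r, hr, (‖c'‖ + 1) * R ^ (2 * α + 1) * (2 * (max M₁ M₂ * max M₃ M₄)),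
      mul_nonneg (by positivity)
        (mul_nonneg zero_le_two (mul_nonneg (h₁.trans (le_max_left _ _))
          (h₃.trans (le_max_left _ _)))), hre, ?_⟩
    filter_upwards [h₁', h₂', h₃', h₄', hc.norm.eventually_le_const (lt_add_one _)]
      with n hn₁ hn₂ hn₃ hn₄ hn
    have hmem : ∀ z ∈ Metric.ball τ r, ∀ u : ℝ,
        z * ((max 1 u)⁻¹ : ℝ) ∈ Metric.ball (0 : ℂ) (R + 1) := fun z hz u => by
      have := (mul_inv_max_mem_truncCone (hball hz) u).2
      rw [mem_ball_zero_iff]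
      linarith
    refine ⟨Metric.ball (0 : ℂ) (R + 1), Metric.isOpen_ball,
      fun w hw => (hn₁ w hw).1.differentiableWithinAt,
      fun w hw => (hn₂ w hw).1.differentiableWithinAt, fun z hz => ⟨hmem z hz, ?_⟩⟩
    exact norm_tailKernel_le_of_convex hα (convex_ball _ _)
      (fun w hw => (hn₁ w hw).1) (fun w hw => (hn₂ w hw).1)
      (fun w hw => (hn₁ w hw).2.trans (le_max_left _ _))
      (fun w hw => (hn₂ w hw).2.trans (le_max_right _ _))
      (fun w hw => (hn₃ w hw).2.trans (le_max_left _ _))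
      (fun w hw => (hn₄ w hw).2.trans (le_max_right _ _)) hn (hball hz).2 (hmem z hz)
  refine ⟨fun τ hτ => ?_, fun τ hτ => ?_, ?_⟩
  · obtain ⟨r, hr, C, hC, hre, hev⟩ := key τ hτ
    refine ⟨r, hr, hre, 1 + ∑' k, fredBound (volume.restrict (Ioi (1 : ℝ)))
      (fun u => (max 1 u)⁻¹ ^ (α + 1)) C k, hev.mono fun n hn => ?_⟩
    obtain ⟨S, hS, haS, hgS, hz⟩ := hn
    exact ⟨differentiableOn_fredSeries_ball (integrable_inv_max_rpow_sq hα) hC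
      (fun z h => measurable_tailKernel hS (hz z h).1 haS hgS)
      (fun u v => differentiableOn_tailKernel hS haS hgS hre (fun z h => (hz z h).1) u v)
      (fun z h => (hz z h).2),
      fun z h => norm_fredSeries_le (integrable_inv_max_rpow_sq hα) hC (hz z h).2⟩
  · obtain ⟨r, hr, C, hC, hre, hev⟩ := key τ hτ
    refine tendsto_fredSeries (integrable_inv_max_rpow_sq hα) hC (hev.mono fun n hn => ?_)
      (hev.mono fun n hn => ?_) fun u v => ?_
    · obtain ⟨S, hS, haS, hgS, hz⟩ := hn
      exact measurable_tailKernel hS (hz τ (Metric.mem_ball_self hr)).1 haS hgS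
    · obtain ⟨S, hS, haS, hgS, hz⟩ := hn
      exact (hz τ (Metric.mem_ball_self hr)).2
    · exact (hc.mul_const _).mul ((ha.tendsto_bracket hg _ _).const_mul _)
  · exact differentiableOn_tailDet hα c' isOpen_univ (mem_univ _) (fun _ _ => mem_univ _)
      ha.diff_lim hg.diff_lim

open scoped Pointwise in
theorem ofReal_fredholmDet_inv {α : ℝ} {c : ℂ} {a g : ℂ → ℂ} {K : ℝ → ℝ → ℝ}
    (hK : ∀ x y : ℝ, 0 < x → 0 < y → ((K x y : ℝ) : ℂ) =
      c * (((x⁻¹ ^ (α + 1) * y⁻¹ ^ (α + 1) : ℝ) : ℂ) *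
        bracket a g ((x⁻¹ : ℝ) : ℂ) ((y⁻¹ : ℝ) : ℂ))) {τ : ℝ} (hτ : 0 < τ) :
    ((fredholmDet K τ⁻¹ : ℝ) : ℂ) = tailDet α c a g τ := by
  have hentry : ∀ u v : ℝ, 1 < u → 1 < v →
      (((τ⁻¹ * K (τ⁻¹ * u) (τ⁻¹ * v) : ℝ)) : ℂ) = tailKernel α c a g τ u v := by
    intro u v hu hv
    have hu0 : 0 < u := one_pos.trans hu
    have hv0 : 0 < v := one_pos.trans hv
    have hpow : τ⁻¹ * ((τ * u⁻¹) ^ (α + 1) * (τ * v⁻¹) ^ (α + 1)) =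
        τ ^ (2 * α + 1) * (u⁻¹ ^ (α + 1) * v⁻¹ ^ (α + 1)) := by
      have h : τ ^ (2 * α + 1) = τ⁻¹ * (τ ^ (α + 1) * τ ^ (α + 1)) := by
        rw [show 2 * α + 1 = (α + 1) + (α + 1) - 1 by ring, Real.rpow_sub_one hτ.ne',
          Real.rpow_add hτ, div_eq_inv_mul]
      rw [Real.mul_rpow hτ.le (by positivity), Real.mul_rpow hτ.le (by positivity), h]
      ring
    rw [Complex.ofReal_mul, hK _ _ (by positivity) (by positivity), tailKernel, max_eq_right hu.le,
      max_eq_right hv.le, mul_inv, mul_inv, inv_inv, ← Complex.ofReal_cpow hτ.le,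
      mul_left_comm, ← mul_assoc ((τ⁻¹ : ℝ) : ℂ), ← Complex.ofReal_mul, hpow]
    push_cast
    ring
  have hInt : ∀ k : ℕ, ((∫ x : Fin k → ℝ in univ.pi fun _ => Ioi τ⁻¹, rhoK K k x : ℝ) : ℂ) =
      ∫ x : Fin k → ℝ, (Matrix.of fun i j => tailKernel α c a g τ (x i) (x j)).det
        ∂Measure.pi fun _ => volume.restrict (Ioi (1 : ℝ)) := by
    intro k
    have hset : τ⁻¹ • (univ.pi fun _ => Ioi 1 : Set (Fin k → ℝ)) = univ.pi fun _ => Ioi τ⁻¹ := by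
      ext x
      rw [Set.mem_smul_set_iff_inv_smul_mem₀ (inv_ne_zero hτ.ne'), inv_inv]
      simp only [Set.mem_univ_pi, Set.mem_Ioi, Pi.smul_apply, smul_eq_mul]
      exact forall_congr' fun i => by rw [inv_lt_iff_one_lt_mul₀' hτ]
    have h1 := Measure.setIntegral_comp_smul_of_pos (volume : Measure (Fin k → ℝ)) (rhoK K k)
      (univ.pi fun _ => Ioi 1) (inv_pos.2 hτ)
    rw [hset, Module.finrank_fin_fun, smul_eq_mul, eq_inv_mul_iff_mul_eq₀
      (pow_ne_zero _ (inv_ne_zero hτ.ne'))] at h1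
    rw [← h1, ← Measure.restrict_pi_pi, ← volume_pi, ← integral_const_mul,
      ← integral_complex_ofReal]
    refine setIntegral_congr_fun (MeasurableSet.univ_pi fun _ => measurableSet_Ioi) fun x hx => ?_
    have hx' : ∀ i, 1 < x i := fun i => hx i (mem_univ i)
    have h2 := Matrix.det_smul (Matrix.of fun i j => K (τ⁻¹ * x i) (τ⁻¹ * x j)) τ⁻¹
    rw [Fintype.card_fin] at h2
    simp only [rhoK, Pi.smul_apply, smul_eq_mul]
    rw [← h2, ← Complex.ofRealHom_eq_coe, RingHom.map_det]
    congr 1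
    ext i j
    simpa using hentry _ _ (hx' i) (hx' j)
  rw [fredholmDet, tailDet, fredSeries, Complex.ofReal_add, Complex.ofReal_one, Complex.ofReal_tsum]
  congr 1
  refine tsum_congr fun k => ?_
  rw [← hInt]
  push_cast
  rfl

theorem tendsto_tailDet_inv_add_one {α : ℝ} (hα : -(1 / 2) < α) (c : ℂ) {a g : ℂ → ℂ} {U : Set ℂ}
    (hUo : IsOpen U) (h0 : (0 : ℂ) ∈ U) (hU : ∀ z : ℂ, 0 < z.re → z ∈ U)
    (ha : DifferentiableOn ℂ a U) (hg : DifferentiableOn ℂ g U) :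
    Tendsto (fun n : ℕ => tailDet α c a g ((1 / ((n : ℝ) + 1) : ℝ) : ℂ)) atTop (nhds 1) := by
  have hsub : truncCone 1 1 ⊆ U := truncCone_subset one_pos h0 hU
  have hbd : ∀ f : ℂ → ℂ, ContinuousOn f U → ∃ M, ∀ z ∈ truncCone 1 1, ‖f z‖ ≤ M := fun f hf =>
    (isCompact_truncCone 1 1).exists_bound_of_continuousOn (hf.mono hsub)
  obtain ⟨M₁, h₁⟩ := hbd a ha.continuousOn
  obtain ⟨M₂, h₂⟩ := hbd g hg.continuousOn
  obtain ⟨M₃, h₃⟩ := hbd _ (ha.deriv hUo).continuousOn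
  obtain ⟨M₄, h₄⟩ := hbd _ (hg.deriv hUo).continuousOn
  have hmem0 : (0 : ℂ) ∈ truncCone 1 1 := by simp [truncCone]
  have hM1 : 0 ≤ max M₁ M₂ := (norm_nonneg _).trans ((h₁ _ hmem0).trans (le_max_left _ _))
  have hM2 : 0 ≤ max M₃ M₄ := (norm_nonneg _).trans ((h₃ _ hmem0).trans (le_max_left _ _))
  have hpos : ∀ n : ℕ, (0 : ℝ) < 1 / ((n : ℝ) + 1) := fun n => by positivity
  have hcone : ∀ n : ℕ, ((1 / ((n : ℝ) + 1) : ℝ) : ℂ) ∈ truncCone 1 1 := by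
    intro n
    refine ⟨?_, ?_⟩
    · rw [Complex.ofReal_im, Complex.ofReal_re, abs_zero, one_mul]
      exact (hpos n).le
    · rw [Complex.norm_real, Real.norm_of_nonneg (hpos n).le]
      exact (div_le_one₀ (by positivity)).2 (by linarith [n.cast_nonneg (α := ℝ)])
  have hbound : ∀ (n : ℕ) (R : ℝ), ‖((1 / ((n : ℝ) + 1) : ℝ) : ℂ)‖ ≤ R → ∀ u v,
      ‖tailKernel α c a g ((1 / ((n : ℝ) + 1) : ℝ) : ℂ) u v‖ ≤
      ‖c‖ * R ^ (2 * α + 1) * (2 * (max M₁ M₂ * max M₃ M₄)) *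
        ((max 1 u)⁻¹ ^ (α + 1) * (max 1 v)⁻¹ ^ (α + 1)) := fun n R hR u v =>
    norm_tailKernel_le_of_convex hα (convex_truncCone 1 1)
      (fun z hz => ha.differentiableAt (hUo.mem_nhds (hsub hz)))
      (fun z hz => hg.differentiableAt (hUo.mem_nhds (hsub hz)))
      (fun z hz => (h₁ z hz).trans (le_max_left _ _))
      (fun z hz => (h₂ z hz).trans (le_max_right _ _))
      (fun z hz => (h₃ z hz).trans (le_max_left _ _))
      (fun z hz => (h₄ z hz).trans (le_max_right _ _)) le_rfl hR
      (mul_inv_max_mem_truncCone (hcone n)) u v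
  have hlim : Tendsto (fun n : ℕ => ‖((1 / ((n : ℝ) + 1) : ℝ) : ℂ)‖ ^ (2 * α + 1)) atTop
      (nhds 0) := by
    have h := (tendsto_one_div_add_atTop_nhds_zero_nat (𝕜 := ℝ)).rpow_const
      (p := 2 * α + 1) (Or.inr (by linarith))
    rw [Real.zero_rpow (by linarith)] at h
    refine h.congr fun n => ?_
    rw [Complex.norm_real, Real.norm_of_nonneg (hpos n).le]
  have hzero : fredSeries (volume.restrict (Ioi (1 : ℝ))) (fun _ _ => 0) = 1 := by
    have : ∀ k : ℕ, (Matrix.of fun _ _ : Fin (k + 1) => (0 : ℂ)).det = 0 := fun k =>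
      Matrix.det_eq_zero_of_row_eq_zero 0 fun _ => rfl
    simp [fredSeries, this]
  rw [← hzero]
  refine tendsto_fredSeries (integrable_inv_max_rpow_sq hα)
    (C := ‖c‖ * 1 ^ (2 * α + 1) * (2 * (max M₁ M₂ * max M₃ M₄))) (by positivity)
    (Eventually.of_forall fun n => measurable_tailKernel hUo
      (fun u => hsub (mul_inv_max_mem_truncCone (hcone n) u)) ha hg)
    (Eventually.of_forall fun n => hbound n 1 (hcone n).2) fun u v => ?_
  refine squeeze_zero_norm (fun n => hbound n _ le_rfl u v) ?_
  have := ((hlim.const_mul ‖c‖).mul_const (2 * (max M₁ M₂ * max M₃ M₄))).mul_const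
    ((max 1 u)⁻¹ ^ (α + 1) * (max 1 v)⁻¹ ^ (α + 1))
  simpa using this

/-! ### Nonvanishing and logarithmic derivatives -/

theorem fredholmDet_ne_zero_of_monotone {α : ℝ} (hα : -(1 / 2) < α) (c : ℂ) {a g : ℂ → ℂ}
    {U : Set ℂ} (hUo : IsOpen U) (h0 : (0 : ℂ) ∈ U) (hU : ∀ z : ℂ, 0 < z.re → z ∈ U)
    (ha : DifferentiableOn ℂ a U) (hg : DifferentiableOn ℂ g U) {F : ℝ → ℝ}
    (hF : ∀ τ : ℝ, 0 < τ → ((F τ⁻¹ : ℝ) : ℂ) = tailDet α c a g τ)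
    (hnonneg : ∀ t, 0 < t → 0 ≤ F t) (hmono : ∀ t t', 0 < t → t ≤ t' → F t ≤ F t')
    {t : ℝ} (ht : 0 < t) : F t ≠ 0 := by
  intro hzero
  have hzero' : ∀ τ : ℝ, t⁻¹ ≤ τ → tailDet α c a g τ = 0 := by
    intro τ hτ
    have hτ0 : 0 < τ := (inv_pos.2 ht).trans_le hτ
    have h1 : F τ⁻¹ ≤ F t := hmono _ _ (inv_pos.2 hτ0) (inv_le_of_inv_le₀ ht hτ)
    rw [← hF τ hτ0, le_antisymm (h1.trans hzero.le) (hnonneg _ (inv_pos.2 hτ0)),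
      Complex.ofReal_zero]
  have han : AnalyticOnNhd ℂ (tailDet α c a g) {τ | 0 < τ.re} :=
    (differentiableOn_tailDet hα c hUo h0 hU ha hg).analyticOnNhd isOpen_re_pos
  have hconn : IsPreconnected {τ : ℂ | 0 < τ.re} := (convex_halfSpace_re_gt 0).isPreconnected
  have htend : Tendsto (fun n : ℕ => ((t⁻¹ + 1 / ((n : ℝ) + 1) : ℝ) : ℂ)) atTop
      (nhdsWithin ((t⁻¹ : ℝ) : ℂ) {((t⁻¹ : ℝ) : ℂ)}ᶜ) := by
    refine tendsto_nhdsWithin_iff.2 ⟨?_, Eventually.of_forall fun n => ?_⟩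
    · refine (Complex.continuous_ofReal.tendsto _).comp ?_
      simpa using (tendsto_one_div_add_atTop_nhds_zero_nat (𝕜 := ℝ)).const_add t⁻¹
    · have : (0 : ℝ) < 1 / ((n : ℝ) + 1) := by positivity
      rw [Set.mem_compl_singleton_iff, Ne, Complex.ofReal_inj]
      linarith
  have hfreq := htend.frequently (p := fun z => tailDet α c a g z = 0)
    (Eventually.frequently (Eventually.of_forall fun n => hzero' _
      (le_add_of_nonneg_right (by positivity))))
  have heq := han.eqOn_zero_of_preconnected_of_frequently_eq_zero hconn
    (show 0 < (((t⁻¹ : ℝ) : ℂ)).re by simpa using ht) hfreq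
  have hlim := tendsto_tailDet_inv_add_one hα c hUo h0 hU ha hg
  have hconst : (fun n : ℕ => tailDet α c a g ((1 / ((n : ℝ) + 1) : ℝ) : ℂ)) = fun _ => 0 :=
    funext fun n => heq (show 0 < (((1 / ((n : ℝ) + 1) : ℝ) : ℂ)).re by
      rw [Complex.ofReal_re]; positivity)
  rw [hconst] at hlim
  exact zero_ne_one (tendsto_nhds_unique tendsto_const_nhds hlim)

theorem HoloConv.inv {f : ℕ → ℂ → ℂ} {g : ℂ → ℂ} {Ω : Set ℂ} (hΩ : IsOpen Ω)
    (h : HoloConv f g Ω) :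
    HoloConv (fun n z => (f n z)⁻¹) (fun z => (g z)⁻¹) {z ∈ Ω | g z ≠ 0} where
  diff z hz := by
    obtain ⟨hzΩ, hgz⟩ := hz
    obtain ⟨r, hr, hrΩ, B, hB⟩ := h.diff z hzΩ
    have hB0 : 0 ≤ B := by
      obtain ⟨n, hn⟩ := hB.exists
      exact (norm_nonneg _).trans (hn.2 z (Metric.mem_ball_self hr))
    have hgz' : 0 < ‖g z‖ := norm_pos_iff.2 hgz
    obtain ⟨r₁, hr₁, hr₁'⟩ := Metric.mem_nhds_iff.1
      ((h.diff_lim.continuousOn.isOpen_inter_preimage hΩ isOpen_ne).mem_nhds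
        (show z ∈ Ω ∩ g ⁻¹' {w | w ≠ 0} from ⟨hzΩ, hgz⟩))
    set δ := min (min r₁ (r / 2)) (‖g z‖ / 4 / (B / (r / 4) + 1)) with hδ
    have hδ0 : 0 < δ := lt_min (lt_min hr₁ (half_pos hr)) (by positivity)
    have hδr : δ ≤ r / 2 := (min_le_left _ _).trans (min_le_right _ _)
    refine ⟨δ, hδ0, (Metric.ball_subset_ball ((min_le_left _ _).trans (min_le_left _ _))).trans
      fun w hw => hr₁' hw, (‖g z‖ / 4)⁻¹, ?_⟩
    have hlarge := (h.lim z hzΩ).norm.eventually_const_le (half_lt_self hgz')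
    filter_upwards [hB, hlarge] with n hn hn'
    have hsub : Metric.ball z δ ⊆ Metric.ball z r := Metric.ball_subset_ball (by linarith)
    have hlow : ∀ w ∈ Metric.ball z δ, ‖g z‖ / 4 ≤ ‖f n w‖ := by
      intro w hw
      have hlip := (convex_ball z (r / 2)).norm_image_sub_le_of_norm_deriv_le (f := f n)
        (C := B / (r / 4))
        (fun x hx => hn.1.differentiableAt (Metric.isOpen_ball.mem_nhds
          (Metric.ball_subset_ball (by linarith) hx)))
        (fun x hx => norm_deriv_le_of_ball hr hn.1 hn.2 hx)
        (Metric.mem_ball_self (half_pos hr)) (Metric.ball_subset_ball hδr hw)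
      have hwz : ‖w - z‖ ≤ ‖g z‖ / 4 / (B / (r / 4) + 1) := by
        rw [Metric.mem_ball, dist_eq_norm] at hw
        exact hw.le.trans (min_le_right _ _)
      have h4 : B / (r / 4) * ‖w - z‖ ≤ ‖g z‖ / 4 := by
        have hq : 0 ≤ B / (r / 4) := by positivity
        calc _ ≤ (B / (r / 4) + 1) * (‖g z‖ / 4 / (B / (r / 4) + 1)) := by gcongr; linarith
          _ = _ := mul_div_cancel₀ _ (by positivity)
      have h5 := norm_sub_norm_le (f n z) (f n w)
      rw [norm_sub_rev] at h5
      linarith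
    refine ⟨(hn.1.mono hsub).inv fun w hw =>
      norm_pos_iff.1 ((by positivity : 0 < ‖g z‖ / 4).trans_le
      (hlow w hw)), fun w hw => ?_⟩
    rw [norm_inv]
    exact inv_anti₀ (by positivity) (hlow w hw)
  lim z hz := (h.lim z hz.1).inv₀ hz.2
  diff_lim := (h.diff_lim.mono fun _ hz => hz.1).inv fun _ hz => hz.2

theorem HoloConv.mono {f : ℕ → ℂ → ℂ} {g : ℂ → ℂ} {Ω Ω' : Set ℂ} (h : HoloConv f g Ω)
    (hΩ' : IsOpen Ω') (hsub : Ω' ⊆ Ω) : HoloConv f g Ω' where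
  diff z hz := by
    obtain ⟨r, hr, -, B, hB⟩ := h.diff z (hsub hz)
    obtain ⟨r', hr', hr''⟩ := Metric.isOpen_iff.1 hΩ' z hz
    refine ⟨min r r', lt_min hr hr',
      (Metric.ball_subset_ball (min_le_right _ _)).trans hr'', B, hB.mono fun n hn => ?_⟩
    have hs := Metric.ball_subset_ball (x := z) (min_le_left r r')
    exact ⟨hn.1.mono hs, fun w hw => hn.2 w (hs hw)⟩
  lim z hz := h.lim z (hsub hz)
  diff_lim := h.diff_lim.mono hsub

theorem holoConv_const {g : ℂ → ℂ} (hg : Differentiable ℂ g) :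
    HoloConv (fun _ => g) g univ where
  diff z _ := by
    obtain ⟨B, hB⟩ := (isCompact_closedBall z 1).exists_bound_of_continuousOn
      hg.continuous.continuousOn
    exact ⟨1, one_pos, subset_univ _, B, Eventually.of_forall fun _ =>
      ⟨hg.differentiableOn, fun w hw => hB w (Metric.ball_subset_closedBall hw)⟩⟩
  lim _ _ := tendsto_const_nhds
  diff_lim := hg.differentiableOn

theorem HoloConv.iterate_deriv {f : ℕ → ℂ → ℂ} {g : ℂ → ℂ} {Ω : Set ℂ} (hΩ : IsOpen Ω)
    (h : HoloConv f g Ω) (p : ℕ) :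
    HoloConv (fun n => (_root_.deriv^[p]) (f n)) ((_root_.deriv^[p]) g) Ω := by
  induction p with
  | zero => exact h
  | succ p ih =>
    simp only [Function.iterate_succ', Function.comp]
    exact ih.deriv hΩ

theorem iteratedDerivWithin_eq_re {f : ℝ → ℝ} {G : ℂ → ℂ} {Ω : Set ℂ} (hΩ : IsOpen Ω)
    (hpos : ∀ x : ℝ, 0 < x → (x : ℂ) ∈ Ω) (hG : DifferentiableOn ℂ G Ω)
    (hf : ∀ x : ℝ, 0 < x → f x = (G x).re) (p : ℕ) {x : ℝ} (hx : 0 < x) :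
    iteratedDerivWithin p f (Ioi 0) x = ((deriv^[p]) G x).re := by
  have hdiff : ∀ p, DifferentiableOn ℂ ((deriv^[p]) G) Ω := by
    intro p
    induction p with
    | zero => exact hG
    | succ p ih =>
      rw [Function.iterate_succ']
      exact ih.deriv hΩ
  induction p generalizing x with
  | zero => simpa using hf x hx
  | succ p ih =>
    rw [iteratedDerivWithin_succ, derivWithin_of_isOpen isOpen_Ioi hx, Function.iterate_succ']
    have h1 : (iteratedDerivWithin p f (Ioi 0)) =ᶠ[nhds x] fun y : ℝ => ((deriv^[p]) G y).re := by
      filter_upwards [isOpen_Ioi.mem_nhds hx] with y hy using ih hy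
    rw [h1.deriv_eq]
    exact ((hdiff p).differentiableAt (hΩ.mem_nhds (hpos x hx))).hasDerivAt.real_of_complex.deriv

theorem contDiffOn_of_eq_re {f : ℝ → ℝ} {G : ℂ → ℂ} {Ω : Set ℂ} (hΩ : IsOpen Ω)
    (hpos : ∀ x : ℝ, 0 < x → (x : ℂ) ∈ Ω) (hG : DifferentiableOn ℂ G Ω)
    (hf : ∀ x : ℝ, 0 < x → f x = (G x).re) : ContDiffOn ℝ 2 f (Ioi 0) := by
  have h1 : ContDiffOn ℝ 2 G Ω := (hG.contDiffOn hΩ).restrict_scalars ℝ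
  have h2 : ContDiffOn ℝ 2 (fun x : ℝ => (G x).re) (Ioi 0) :=
    Complex.reCLM.contDiff.comp_contDiffOn
      (h1.comp Complex.ofRealCLM.contDiff.contDiffOn fun x hx => hpos x hx)
  exact h2.congr fun x hx => hf x hx

/-- The complex logarithmic derivative `z G'(z) / G(z)`. -/
def logDerivMul (G : ℂ → ℂ) (z : ℂ) : ℂ := z * (deriv G z * (G z)⁻¹)

theorem hasDerivAt_comp_inv {F : ℝ → ℝ} {G : ℂ → ℂ} (hG : DifferentiableOn ℂ G {τ | 0 < τ.re})
    (hF : ∀ τ : ℝ, 0 < τ → ((F τ⁻¹ : ℝ) : ℂ) = G τ)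
    {τ : ℝ} (hτ : 0 < τ) :
    HasDerivAt (fun u : ℝ => F u⁻¹) (deriv G τ).re τ := by
  have h1 := (hG.differentiableAt (isOpen_re_pos.mem_nhds
    (show 0 < (τ : ℂ).re from hτ))).hasDerivAt.real_of_complex
  refine h1.congr_of_eventuallyEq ?_
  filter_upwards [isOpen_Ioi.mem_nhds hτ] with u hu
  rw [← hF u hu, Complex.ofReal_re]

theorem hasDerivAt_of_comp_inv {F : ℝ → ℝ} {G : ℂ → ℂ} (hG : DifferentiableOn ℂ G {τ | 0 < τ.re})
    (hF : ∀ τ : ℝ, 0 < τ → ((F τ⁻¹ : ℝ) : ℂ) = G τ)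
    {τ : ℝ} (hτ : 0 < τ) :
    HasDerivAt F (-(deriv G τ).re * τ ^ 2) τ⁻¹ := by
  have h1 := hasDerivAt_comp_inv hG hF hτ
  rw [← inv_inv τ] at h1
  have h2 := h1.comp τ⁻¹ (hasDerivAt_inv (inv_ne_zero hτ.ne'))
  rw [inv_inv] at h2
  simpa [Function.comp_def] using h2

theorem thetaOf_eq {F : ℝ → ℝ} {G : ℂ → ℂ} (hG : DifferentiableOn ℂ G {τ | 0 < τ.re})
    (hF : ∀ τ : ℝ, 0 < τ → ((F τ⁻¹ : ℝ) : ℂ) = G τ) (hF0 : ∀ t : ℝ, 0 < t → F t ≠ 0)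
    {τ : ℝ} (hτ : 0 < τ) :
    thetaOf F τ = τ * ((deriv G τ).re / F τ⁻¹) := by
  rw [thetaOf, ((hasDerivAt_comp_inv hG hF hτ).log (hF0 _ (inv_pos.2 hτ))).deriv]

theorem thetaOf_eq_deriv {F : ℝ → ℝ} {G : ℂ → ℂ} (hG : DifferentiableOn ℂ G {τ | 0 < τ.re})
    (hF : ∀ τ : ℝ, 0 < τ → ((F τ⁻¹ : ℝ) : ℂ) = G τ) (hF0 : ∀ t : ℝ, 0 < t → F t ≠ 0)
    {τ : ℝ} (hτ : 0 < τ) :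
    thetaOf F τ = -deriv F τ⁻¹ / (τ * F τ⁻¹) := by
  have h0 := hF0 _ (inv_pos.2 hτ)
  rw [thetaOf_eq hG hF hF0 hτ, (hasDerivAt_of_comp_inv hG hF hτ).deriv]
  field_simp

theorem thetaOf_eq_re {F : ℝ → ℝ} {G : ℂ → ℂ} (hG : DifferentiableOn ℂ G {τ | 0 < τ.re})
    (hF : ∀ τ : ℝ, 0 < τ → ((F τ⁻¹ : ℝ) : ℂ) = G τ) (hF0 : ∀ t : ℝ, 0 < t → F t ≠ 0)
    {τ : ℝ} (hτ : 0 < τ) : thetaOf F τ = (logDerivMul G τ).re := by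
  rw [thetaOf_eq hG hF hF0 hτ, logDerivMul, ← hF τ hτ, Complex.re_ofReal_mul, ← Complex.ofReal_inv,
    Complex.re_mul_ofReal, div_eq_mul_inv]

theorem ofReal_mem_ne_zero {F : ℝ → ℝ} {G : ℂ → ℂ} (hF : ∀ τ : ℝ, 0 < τ → ((F τ⁻¹ : ℝ) : ℂ) = G τ)
    (hF0 : ∀ t : ℝ, 0 < t → F t ≠ 0)
    {τ : ℝ} (hτ : 0 < τ) :
    (τ : ℂ) ∈ {z ∈ {τ : ℂ | 0 < τ.re} | G z ≠ 0} := by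
  refine ⟨hτ, ?_⟩
  rw [← hF τ hτ, Complex.ofReal_ne_zero]
  exact hF0 _ (inv_pos.2 hτ)

theorem isOpen_ne_zero {G : ℂ → ℂ} (hG : DifferentiableOn ℂ G {τ | 0 < τ.re}) :
    IsOpen {z ∈ {τ : ℂ | 0 < τ.re} | G z ≠ 0} :=
  hG.continuousOn.isOpen_inter_preimage isOpen_re_pos isOpen_ne

theorem differentiableOn_logDerivMul {G : ℂ → ℂ} (hG : DifferentiableOn ℂ G {τ | 0 < τ.re}) :
    DifferentiableOn ℂ (logDerivMul G) {z ∈ {τ : ℂ | 0 < τ.re} | G z ≠ 0} :=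
  differentiableOn_id.mul (((hG.deriv isOpen_re_pos).mono fun _ hz => hz.1).mul
    ((hG.mono fun _ hz => hz.1).inv fun _ hz => hz.2))

theorem HoloConv.logDerivMul {G : ℕ → ℂ → ℂ} {G' : ℂ → ℂ} (h : HoloConv G G' {τ | 0 < τ.re}) :
    HoloConv (fun n => logDerivMul (G n)) (logDerivMul G')
      {z ∈ {τ : ℂ | 0 < τ.re} | G' z ≠ 0} := by
  have ho := isOpen_ne_zero h.diff_lim
  exact ((holoConv_const differentiable_id).mono ho (subset_univ _)).mul
    (((h.deriv isOpen_re_pos).mono ho fun _ hz => hz.1).mul (h.inv isOpen_re_pos))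

/-! ### From terminating `₂F₁` to `₁F₁` -/

theorem norm_poch_le {b c : ℂ} (hc : 0 < c.re) (k : ℕ) :
    ‖poch b k‖ ≤ (‖b‖ / c.re + 1) ^ k * ‖poch c k‖ := by
  induction k with
  | zero => simp [poch_zero]
  | succ k ih =>
    have h1 : ‖b + k‖ ≤ (‖b‖ / c.re + 1) * ‖c + k‖ := by
      have h2 : c.re + k ≤ ‖c + k‖ := by
        simpa using Complex.re_le_norm (c + k)
      have h3 : ‖b + k‖ ≤ ‖b‖ + k := by simpa using norm_add_le b (k : ℂ)
      calc ‖b + k‖ ≤ ‖b‖ + k := h3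
        _ ≤ (‖b‖ / c.re + 1) * (c.re + k) := by
          have : (‖b‖ / c.re + 1) * (c.re + k) = ‖b‖ + k + (c.re + ‖b‖ / c.re * k) := by
            field_simp
            ring
          rw [this]
          have : 0 ≤ c.re + ‖b‖ / c.re * k := by positivity
          linarith
        _ ≤ _ := by gcongr
    rw [poch_succ, poch_succ, norm_mul, norm_mul, pow_succ]
    calc _ ≤ ((‖b‖ / c.re + 1) ^ k * ‖poch c k‖) * ((‖b‖ / c.re + 1) * ‖c + k‖) := by gcongr
      _ = _ := by ring

theorem norm_poch_div_le {b c : ℂ} (hc : 0 < c.re) (k : ℕ) :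
    ‖poch b k / poch c k‖ ≤ (‖b‖ / c.re + 1) ^ k := by
  rw [norm_div, div_le_iff₀ (norm_pos_iff.2 (poch_ne_zero hc k))]
  exact norm_poch_le hc k

theorem norm_oneF1_term_le {b c : ℂ} (hc : 0 < c.re) {T : ℝ} {z : ℂ} (hz : ‖z‖ ≤ T) (k : ℕ) :
    ‖poch b k / (poch c k * k.factorial) * z ^ k‖ ≤
      ((‖b‖ / c.re + 1) * T) ^ k / k.factorial := by
  have : poch b k / (poch c k * k.factorial) * z ^ k =
      poch b k / poch c k * z ^ k / k.factorial := by
    rw [← div_div, div_mul_eq_mul_div]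
  rw [this, norm_div, norm_mul, norm_pow, Complex.norm_natCast, mul_pow]
  gcongr
  exact norm_poch_div_le hc k

theorem differentiable_oneF1 (b : ℂ) {c : ℂ} (hc : 0 < c.re) : Differentiable ℂ (oneF1 b c) := by
  intro z
  have h := Complex.differentiableOn_tsum_of_summable_norm
    (F := fun (k : ℕ) (z : ℂ) => poch b k / (poch c k * k.factorial) * z ^ k)
    (U := Metric.ball 0 (‖z‖ + 1))
    (Real.summable_pow_div_factorial ((‖b‖ / c.re + 1) * (‖z‖ + 1)))
    (fun k => ((differentiable_id.pow k).const_mul _).differentiableOn) Metric.isOpen_ball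
    fun k w hw => norm_oneF1_term_le hc (mem_ball_zero_iff.1 hw).le k
  exact h.differentiableAt (Metric.isOpen_ball.mem_nhds (by simp))

theorem twoF1neg_eq_tsum (m : ℕ) (b c z : ℂ) :
    twoF1neg m b c z =
      ∑' k : ℕ, poch (-(m : ℂ)) k * poch b k / (poch c k * (k.factorial : ℂ)) * z ^ k := by
  rw [twoF1neg, tsum_eq_sum]
  intro k hk
  rw [Finset.mem_range, not_lt] at hk
  rw [poch_neg_natCast, Nat.choose_eq_zero_of_lt hk]
  simp

theorem norm_twoF1neg_term_le {b c : ℂ} (hc : 0 < c.re) {m : ℕ} {T : ℝ} {z : ℂ}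
    (hz : m * ‖z‖ ≤ T) (k : ℕ) :
    ‖poch (-(m : ℂ)) k * poch b k / (poch c k * (k.factorial : ℂ)) * z ^ k‖ ≤
      ((‖b‖ / c.re + 1) * T) ^ k / k.factorial := by
  have hk : (k.factorial : ℂ) ≠ 0 := by exact_mod_cast k.factorial_ne_zero
  have h1 : poch (-(m : ℂ)) k * poch b k / (poch c k * (k.factorial : ℂ)) * z ^ k =
      (-1) ^ k * (poch b k / poch c k) * ((m.choose k : ℂ) * z ^ k) := by
    rw [poch_neg_natCast]
    field_simp
  have h2 : (m.choose k : ℝ) * ‖z‖ ^ k ≤ T ^ k / k.factorial := by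
    calc (m.choose k : ℝ) * ‖z‖ ^ k ≤ (m : ℝ) ^ k / k.factorial * ‖z‖ ^ k := by
          gcongr
          exact Nat.choose_le_pow_div k m
      _ = (m * ‖z‖) ^ k / k.factorial := by rw [mul_pow, div_mul_eq_mul_div]
      _ ≤ _ := by gcongr
  rw [h1, norm_mul, norm_mul, norm_mul, norm_pow, norm_pow, norm_neg, norm_one, one_pow, one_mul,
    Complex.norm_natCast, mul_pow, mul_div_assoc]
  gcongr
  exact norm_poch_div_le hc k

theorem norm_twoF1neg_le {b c : ℂ} (hc : 0 < c.re) {m : ℕ} {T : ℝ} {z : ℂ} (hz : m * ‖z‖ ≤ T) :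
    ‖twoF1neg m b c z‖ ≤ ∑' k : ℕ, ((‖b‖ / c.re + 1) * T) ^ k / k.factorial := by
  rw [twoF1neg_eq_tsum]
  exact tsum_of_norm_bounded (Real.summable_pow_div_factorial _).hasSum
    (norm_twoF1neg_term_le hc hz)

theorem tendsto_twoF1neg {b c : ℂ} (hc : 0 < c.re) {m : ℕ → ℕ} {Z : ℕ → ℂ} {z : ℂ}
    (hZ : Tendsto Z atTop (nhds 0)) (hmZ : Tendsto (fun n => -(m n : ℂ) * Z n) atTop (nhds z)) :
    Tendsto (fun n => twoF1neg (m n) b c (Z n)) atTop (nhds (oneF1 b c z)) := by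
  simp only [twoF1neg_eq_tsum, oneF1]
  refine tendsto_tsum_of_dominated_convergence
    (Real.summable_pow_div_factorial ((‖b‖ / c.re + 1) * (‖z‖ + 1))) (fun k => ?_) ?_
  · have h1 : Tendsto (fun n => poch (-(m n : ℂ)) k * Z n ^ k) atTop (nhds (z ^ k)) := by
      have h2 : ∀ n, poch (-(m n : ℂ)) k * Z n ^ k =
          ∏ i ∈ Finset.range k, (-(m n : ℂ) * Z n + i * Z n) := by
        intro n
        simp only [← add_mul, Finset.prod_mul_distrib, Finset.prod_const, Finset.card_range, poch]
      simp only [h2]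
      have h3 := tendsto_finsetProd (Finset.range k)
        fun i _ => hmZ.add (hZ.const_mul (i : ℂ))
      simpa using h3
    refine (h1.const_mul (poch b k / (poch c k * k.factorial))).congr fun n => ?_
    ring
  · filter_upwards [hmZ.norm.eventually_le_const (lt_add_one _)] with n hn k
    refine norm_twoF1neg_term_le hc ?_ k
    simpa using hn

/-! ### The orthogonal polynomials in the inverse variable -/

theorem holoConv_univ_of_ball {f : ℕ → ℂ → ℂ} {g : ℂ → ℂ}
    (hf : ∀ R, ∃ B, ∀ᶠ n in atTop, ∀ w ∈ Metric.ball (0 : ℂ) R,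
      DifferentiableAt ℂ (f n) w ∧ ‖f n w‖ ≤ B)
    (hlim : ∀ z, Tendsto (fun n => f n z) atTop (nhds (g z))) (hg : Differentiable ℂ g) :
    HoloConv f g univ where
  diff z _ := by
    obtain ⟨B, hB⟩ := hf (‖z‖ + 1)
    have hs : Metric.ball z 1 ⊆ Metric.ball 0 (‖z‖ + 1) := by
      refine Metric.ball_subset_ball' ?_
      rw [dist_zero_right, add_comm]
    exact ⟨1, one_pos, subset_univ _, B, hB.mono fun n hn =>
      ⟨fun w hw => (hn w (hs hw)).1.differentiableWithinAt, fun w hw => (hn w (hs hw)).2⟩⟩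
  lim z _ := hlim z
  diff_lim := hg.differentiableOn

/-- The variable `2 / (1 + i N x)` in terms of `ζ = x⁻¹`. -/
def cayleyVar (N : ℕ) (ζ : ℂ) : ℂ := -2 * (I * ζ / N) / (1 - I * ζ / N)

/-- The weight factor in terms of the inverse variable. -/
def expFactor (s : ℂ) (N : ℕ) (ζ : ℂ) : ℂ :=
  exp (((N : ℂ) - s) / 2 * log (1 - I * ζ / N) -
    ((N : ℂ) + (starRingEnd ℂ) s) / 2 * log (1 + I * ζ / N))

/-- The weighted polynomial `p̃_N` in the inverse variable. -/
def highInv (s : ℂ) (N : ℕ) (ζ : ℂ) : ℂ :=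
  expFactor s N ζ * twoF1neg N s ((2 * s.re + 1 : ℝ) : ℂ) (cayleyVar N ζ)

/-- The weighted polynomial `p_{N-1}` in the inverse variable. -/
def lowInv (s : ℂ) (N : ℕ) (ζ : ℂ) : ℂ :=
  ζ * ((expFactor s N ζ * (1 - I * ζ / N)⁻¹) *
    twoF1neg (N - 1) (s + 1) ((2 * s.re + 2 : ℝ) : ℂ) (cayleyVar N ζ))

/-- The limit of `highInv`. -/
def highInvLim (s ζ : ℂ) : ℂ := exp (-(I * ζ)) * oneF1 s ((2 * s.re + 1 : ℝ) : ℂ) (2 * (I * ζ))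

/-- The limit of `lowInv`. -/
def lowInvLim (s ζ : ℂ) : ℂ :=
  ζ * ((exp (-(I * ζ)) * 1) * oneF1 (s + 1) ((2 * s.re + 2 : ℝ) : ℂ) (2 * (I * ζ)))

theorem differentiable_twoF1neg (m : ℕ) (b c : ℂ) : Differentiable ℂ (twoF1neg m b c) :=
  Differentiable.fun_sum fun _ _ => (differentiable_id.pow _).const_mul _

theorem differentiable_div_natCast (N : ℕ) : Differentiable ℂ fun ζ : ℂ => I * ζ / N :=
  (differentiable_id.const_mul I).div_const _

theorem differentiableAt_cayleyVar {N : ℕ} {ζ : ℂ} (h : 1 - I * ζ / N ≠ 0) :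
    DifferentiableAt ℂ (cayleyVar N) ζ :=
  (((differentiable_div_natCast N).const_mul (-2)) ζ).div
    (((differentiable_div_natCast N).const_sub 1) ζ) h

theorem differentiableAt_expFactor {s : ℂ} {N : ℕ} {ζ : ℂ} (h : 1 - I * ζ / N ∈ slitPlane)
    (h' : 1 + I * ζ / N ∈ slitPlane) : DifferentiableAt ℂ (expFactor s N) ζ :=
  ((((((differentiable_div_natCast N).const_sub 1) ζ).clog h).const_mul _).sub
    (((((differentiable_div_natCast N).const_add 1) ζ).clog h').const_mul _)).cexp

theorem differentiableAt_highInv {s : ℂ} {N : ℕ} {ζ : ℂ} (h : 1 - I * ζ / N ∈ slitPlane)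
    (h' : 1 + I * ζ / N ∈ slitPlane) : DifferentiableAt ℂ (highInv s N) ζ :=
  (differentiableAt_expFactor h h').mul ((differentiable_twoF1neg _ _ _ _).comp ζ
    (differentiableAt_cayleyVar (slitPlane_ne_zero h)))

theorem differentiableAt_lowInv {s : ℂ} {N : ℕ} {ζ : ℂ} (h : 1 - I * ζ / N ∈ slitPlane)
    (h' : 1 + I * ζ / N ∈ slitPlane) : DifferentiableAt ℂ (lowInv s N) ζ :=
  differentiableAt_id.mul (((differentiableAt_expFactor h h').mul
    ((((differentiable_div_natCast N).const_sub 1) ζ).inv (slitPlane_ne_zero h))).mul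
    ((differentiable_twoF1neg _ _ _ _).comp ζ (differentiableAt_cayleyVar (slitPlane_ne_zero h))))

/-- A domain on which `highInv` and `lowInv` are holomorphic. -/
def invDomain (N : ℕ) : Set ℂ := {ζ | 1 - I * ζ / N ∈ slitPlane ∧ 1 + I * ζ / N ∈ slitPlane}

theorem isOpen_invDomain (N : ℕ) : IsOpen (invDomain N) :=
  (isOpen_slitPlane.preimage ((differentiable_div_natCast N).const_sub 1).continuous).inter
    (isOpen_slitPlane.preimage ((differentiable_div_natCast N).const_add 1).continuous)

theorem zero_mem_invDomain (N : ℕ) : (0 : ℂ) ∈ invDomain N := by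
  simp [invDomain]

theorem re_pos_mem_invDomain {N : ℕ} (hN : N ≠ 0) {ζ : ℂ} (hζ : 0 < ζ.re) : ζ ∈ invDomain N := by
  have hN' : (0 : ℝ) < N := by exact_mod_cast Nat.pos_of_ne_zero hN
  have him : (I * ζ / N).im = ζ.re / N := by
    rw [Complex.div_natCast_im]
    simp
  have hpos : 0 < ζ.re / N := by positivity
  refine ⟨Or.inr ?_, Or.inr ?_⟩
  · rw [Complex.sub_im, him, Complex.one_im]
    linarith
  · rw [Complex.add_im, him, Complex.one_im]
    linarith

theorem differentiableOn_highInv (s : ℂ) (N : ℕ) :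
    DifferentiableOn ℂ (highInv s N) (invDomain N) :=
  fun _ hζ => (differentiableAt_highInv hζ.1 hζ.2).differentiableWithinAt

theorem differentiableOn_lowInv (s : ℂ) (N : ℕ) : DifferentiableOn ℂ (lowInv s N) (invDomain N) :=
  fun _ hζ => (differentiableAt_lowInv hζ.1 hζ.2).differentiableWithinAt

theorem natCast_mul_norm_div {N : ℕ} (hN : N ≠ 0) (ζ : ℂ) : (N : ℝ) * ‖I * ζ / N‖ = ‖ζ‖ := by
  have hN' : (N : ℝ) ≠ 0 := by exact_mod_cast hN
  rw [norm_div, norm_mul, Complex.norm_I, one_mul, Complex.norm_natCast, mul_div_cancel₀ _ hN']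

theorem eventually_ball_norm_div_le (R : ℝ) : ∀ᶠ N : ℕ in atTop, N ≠ 0 ∧
    ∀ ζ ∈ Metric.ball (0 : ℂ) R, ‖I * ζ / N‖ ≤ 1 / 2 := by
  filter_upwards [eventually_ne_atTop 0, tendsto_natCast_atTop_atTop.eventually_ge_atTop (2 * R)]
    with N hN hR
  refine ⟨hN, fun ζ hζ => ?_⟩
  have hN' : (0 : ℝ) < N := by exact_mod_cast Nat.pos_of_ne_zero hN
  have h := natCast_mul_norm_div hN ζ
  rw [mem_ball_zero_iff] at hζ
  by_contra! hc
  nlinarith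

theorem mem_slitPlane_of_norm_le_half {u : ℂ} (hu : ‖u‖ ≤ 1 / 2) :
    1 - u ∈ slitPlane ∧ 1 + u ∈ slitPlane := by
  refine ⟨?_, mem_slitPlane_of_norm_lt_one (by linarith)⟩
  rw [sub_eq_add_neg]
  exact mem_slitPlane_of_norm_lt_one (by rw [norm_neg]; linarith)

theorem half_le_norm_one_sub {u : ℂ} (hu : ‖u‖ ≤ 1 / 2) : 1 / 2 ≤ ‖1 - u‖ := by
  have := norm_sub_norm_le (1 : ℂ) u
  rw [norm_one] at this
  linarith

theorem tendsto_div_natCast (ζ : ℂ) : Tendsto (fun N : ℕ => I * ζ / N) atTop (nhds 0) :=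
  tendsto_const_div_atTop_nhds_zero_nat _

theorem tendsto_one_sub_div_natCast (ζ : ℂ) :
    Tendsto (fun N : ℕ => 1 - I * ζ / N) atTop (nhds 1) := by
  simpa using (tendsto_div_natCast ζ).const_sub 1

theorem holoConv_expFactor (s : ℂ) :
    HoloConv (expFactor s) (fun ζ => exp (-(I * ζ))) univ := by
  refine holoConv_univ_of_ball (fun R => ⟨Real.exp (3 / 2 * (|R| + ‖s‖)), ?_⟩) (fun ζ => ?_)
    (differentiable_id.const_mul I).neg.cexp
  · filter_upwards [eventually_ball_norm_div_le R] with N hN ζ hζ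
    have hu := hN.2 ζ hζ
    have hslit := mem_slitPlane_of_norm_le_half hu
    refine ⟨differentiableAt_expFactor hslit.1 hslit.2, ?_⟩
    rw [expFactor]
    refine (Complex.norm_exp_le_exp_norm _).trans (Real.exp_le_exp.2 ?_)
    have hNu := natCast_mul_norm_div hN.1 ζ
    have hζR : ‖ζ‖ ≤ |R| := (mem_ball_zero_iff.1 hζ).le.trans (le_abs_self R)
    have l1 : ‖log (1 - I * ζ / N)‖ ≤ 3 / 2 * ‖I * ζ / N‖ := by
      have := norm_log_one_add_half_le_self (z := -(I * ζ / N)) (by rwa [norm_neg])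
      rwa [norm_neg, ← sub_eq_add_neg] at this
    have l2 := norm_log_one_add_half_le_self hu
    have c1 : ‖((N : ℂ) - s) / 2‖ ≤ (N + ‖s‖) / 2 := by
      rw [norm_div, Complex.norm_ofNat]
      gcongr
      simpa using norm_sub_le (N : ℂ) s
    have c2 : ‖((N : ℂ) + (starRingEnd ℂ) s) / 2‖ ≤ (N + ‖s‖) / 2 := by
      rw [norm_div, Complex.norm_ofNat]
      gcongr
      simpa using norm_add_le (N : ℂ) ((starRingEnd ℂ) s)
    refine (norm_sub_le _ _).trans ?_
    rw [norm_mul, norm_mul]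
    calc _ ≤ (N + ‖s‖) / 2 * (3 / 2 * ‖I * ζ / N‖) + (N + ‖s‖) / 2 * (3 / 2 * ‖I * ζ / N‖) := by
          gcongr
      _ = 3 / 2 * (N * ‖I * ζ / N‖ + ‖s‖ * ‖I * ζ / N‖) := by ring
      _ ≤ 3 / 2 * (|R| + ‖s‖ * 1) := by
          rw [hNu]
          gcongr
          linarith
      _ = _ := by ring
  · have hz := tendsto_div_natCast ζ
    have hnat : Tendsto (fun N : ℕ => (N : ℂ) * (I * ζ / N)) atTop (nhds (I * ζ)) := by
      refine tendsto_const_nhds.congr' ?_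
      filter_upwards [eventually_ne_atTop 0] with N hN
      have : (N : ℂ) ≠ 0 := by exact_mod_cast hN
      field_simp
    have h2 := Complex.tendsto_nat_mul_log_one_add_of_tendsto hnat
    have h1 := Complex.tendsto_nat_mul_log_one_add_of_tendsto
      (g := fun N : ℕ => -(I * ζ / N)) (t := -(I * ζ)) (by simpa using hnat.neg)
    have hlog : ∀ g : ℕ → ℂ, Tendsto g atTop (nhds 0) →
        Tendsto (fun N => log (1 + g N)) atTop (nhds 0) := by
      intro g hg
      have h3 : Tendsto (fun N => 1 + g N) atTop (nhds 1) := by simpa using hg.const_add 1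
      simpa [Function.comp_def] using (continuousAt_clog one_mem_slitPlane).tendsto.comp h3
    have l1 := hlog (fun N : ℕ => -(I * ζ / N)) (by simpa using hz.neg)
    have l2 := hlog _ hz
    have key := ((h1.sub (l1.const_mul s)).sub
      (h2.add (l2.const_mul ((starRingEnd ℂ) s)))).div_const
      2
    have hval : (-(I * ζ) - s * 0 - (I * ζ + (starRingEnd ℂ) s * 0)) / 2 = -(I * ζ) := by ring
    rw [hval] at key
    refine ((Complex.continuous_exp.tendsto _).comp key).congr fun N => ?_
    simp only [Function.comp_apply, expFactor, ← sub_eq_add_neg]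
    congr 1
    ring

theorem holoConv_inv_one_sub :
    HoloConv (fun (N : ℕ) ζ => (1 - I * ζ / N)⁻¹) (fun _ => 1) univ := by
  refine holoConv_univ_of_ball (fun R => ⟨2, ?_⟩) (fun ζ => ?_) (differentiable_const 1)
  · filter_upwards [eventually_ball_norm_div_le R] with N hN ζ hζ
    have hu := hN.2 ζ hζ
    refine ⟨(((differentiable_div_natCast N).const_sub 1) ζ).inv
      (slitPlane_ne_zero (mem_slitPlane_of_norm_le_half hu).1), ?_⟩
    rw [norm_inv]
    exact inv_le_of_inv_le₀ two_pos (by linarith [half_le_norm_one_sub hu])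
  · simpa using (tendsto_one_sub_div_natCast ζ).inv₀ one_ne_zero

theorem holoConv_twoF1neg (b : ℂ) {c : ℂ} (hc : 0 < c.re) {m : ℕ → ℕ} (hm : ∀ N, m N ≤ N)
    (hm' : Tendsto (fun N => (m N : ℂ) / N) atTop (nhds 1)) :
    HoloConv (fun N ζ => twoF1neg (m N) b c (cayleyVar N ζ))
      (fun ζ => oneF1 b c (2 * (I * ζ))) univ := by
  refine holoConv_univ_of_ball
    (fun R => ⟨∑' k : ℕ, ((‖b‖ / c.re + 1) * (4 * |R|)) ^ k / k.factorial, ?_⟩) (fun ζ => ?_)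
    ((differentiable_oneF1 b hc).comp ((differentiable_id.const_mul I).const_mul 2))
  · filter_upwards [eventually_ball_norm_div_le R] with N hN ζ hζ
    have hu := hN.2 ζ hζ
    refine ⟨(differentiable_twoF1neg _ _ _ _).comp ζ (differentiableAt_cayleyVar
      (slitPlane_ne_zero (mem_slitPlane_of_norm_le_half hu).1)), norm_twoF1neg_le hc ?_⟩
    have hNu := natCast_mul_norm_div hN.1 ζ
    have hζR : ‖ζ‖ ≤ |R| := (mem_ball_zero_iff.1 hζ).le.trans (le_abs_self R)
    have hhalf := half_le_norm_one_sub hu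
    have h1 : ‖cayleyVar N ζ‖ ≤ 4 * ‖I * ζ / N‖ := by
      rw [cayleyVar, norm_div, div_le_iff₀ (by linarith), norm_mul, norm_neg, Complex.norm_ofNat]
      nlinarith [norm_nonneg (I * ζ / N)]
    calc (m N : ℝ) * ‖cayleyVar N ζ‖ ≤ N * (4 * ‖I * ζ / N‖) := by
          gcongr
          exact hm N
      _ = 4 * ‖ζ‖ := by rw [← hNu]; ring
      _ ≤ _ := by gcongr
  · have hinv := (tendsto_one_sub_div_natCast ζ).inv₀ one_ne_zero
    have hZ : Tendsto (fun N => cayleyVar N ζ) atTop (nhds 0) := by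
      have := ((tendsto_div_natCast ζ).const_mul (-2)).mul hinv
      simpa [cayleyVar, div_eq_mul_inv] using this
    refine tendsto_twoF1neg hc hZ ?_
    have h2 := ((hm'.mul_const (2 * (I * ζ))).mul hinv)
    rw [one_mul, inv_one, mul_one] at h2
    refine h2.congr fun N => ?_
    rw [cayleyVar]
    ring

theorem two_re_add_pos {s : ℂ} (hs : -(1 / 2 : ℝ) < s.re) :
    0 < ((2 * s.re + 1 : ℝ) : ℂ).re ∧ 0 < ((2 * s.re + 2 : ℝ) : ℂ).re := by
  constructor <;> rw [Complex.ofReal_re] <;> linarith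

theorem holoConv_highInv {s : ℂ} (hs : -(1 / 2 : ℝ) < s.re) :
    HoloConv (highInv s) (highInvLim s) univ := by
  refine (holoConv_expFactor s).mul
    (holoConv_twoF1neg s (two_re_add_pos hs).1 (m := fun N => N) (fun _ => le_rfl) ?_)
  refine tendsto_const_nhds.congr' ?_
  filter_upwards [eventually_ne_atTop 0] with N hN
  exact (div_self (by exact_mod_cast hN)).symm

theorem holoConv_lowInv {s : ℂ} (hs : -(1 / 2 : ℝ) < s.re) :
    HoloConv (lowInv s) (lowInvLim s) univ := by
  refine (holoConv_const differentiable_id).mul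
    (((holoConv_expFactor s).mul holoConv_inv_one_sub).mul
    (holoConv_twoF1neg (s + 1) (two_re_add_pos hs).2 (m := fun N => N - 1)
      (fun N => Nat.sub_le N 1) ?_))
  have h : Tendsto (fun N : ℕ => 1 - (1 : ℂ) / N) atTop (nhds 1) := by
    simpa using (tendsto_const_div_atTop_nhds_zero_nat (1 : ℂ)).const_sub 1
  refine h.congr' ?_
  filter_upwards [eventually_ge_atTop 1] with N hN
  have : (N : ℂ) ≠ 0 := by exact_mod_cast (Nat.one_le_iff_ne_zero.1 hN)
  rw [Nat.cast_sub hN, sub_div, div_self this, Nat.cast_one]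

/-! ### The kernels in the inverse variable -/

theorem hasDerivAt_comp_ofReal_inv {κ a' : ℂ} {α x φ' : ℝ} {p : ℝ → ℂ} {a : ℂ → ℂ} (hx : 0 < x)
    (hp : ∀ x : ℝ, 0 < x → p x = κ * (((x⁻¹ ^ α : ℝ) : ℂ) * a ((x⁻¹ : ℝ) : ℂ)))
    (ha : HasDerivAt a a' ((x⁻¹ : ℝ) : ℂ)) (hφ : HasDerivAt (fun x : ℝ => x⁻¹ ^ α) φ' x) :
    HasDerivAt p (κ * ((φ' : ℂ) * a ((x⁻¹ : ℝ) : ℂ) +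
      ((x⁻¹ ^ α : ℝ) : ℂ) * (((-(x ^ 2)⁻¹ : ℝ) : ℂ) * a'))) x := by
  have h1 : HasDerivAt (fun x : ℝ => a ((x⁻¹ : ℝ) : ℂ)) (((-(x ^ 2)⁻¹ : ℝ) : ℂ) * a') x := by
    simpa [Function.comp_def] using HasDerivAt.scomp x ha.comp_ofReal (hasDerivAt_inv hx.ne')
  refine ((hφ.ofReal_comp.mul h1).const_mul κ).congr_of_eventuallyEq ?_
  filter_upwards [isOpen_Ioi.mem_nhds hx] with y hy using hp y hy

theorem kernel_eq_bracket {α : ℝ} {C κ κ' : ℂ} {p q : ℝ → ℂ} {a g : ℂ → ℂ}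
    (hp : ∀ x : ℝ, 0 < x → p x = κ * (((x⁻¹ ^ α : ℝ) : ℂ) * a ((x⁻¹ : ℝ) : ℂ)))
    (hq : ∀ x : ℝ, 0 < x → q x = κ' * (((x⁻¹ ^ α : ℝ) : ℂ) * g ((x⁻¹ : ℝ) : ℂ)))
    (ha : ∀ x : ℝ, 0 < x → DifferentiableAt ℂ a ((x⁻¹ : ℝ) : ℂ))
    (hg : ∀ x : ℝ, 0 < x → DifferentiableAt ℂ g ((x⁻¹ : ℝ) : ℂ)) {x y : ℝ} (hx : 0 < x)
    (hy : 0 < y) :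
    (if x = y then C * (deriv p x * q x - deriv q x * p x)
      else C * (p x * q y - q x * p y) / ((x : ℂ) - (y : ℂ))) =
      (C * κ * κ') * (((x⁻¹ ^ (α + 1) * y⁻¹ ^ (α + 1) : ℝ) : ℂ) *
        bracket a g ((x⁻¹ : ℝ) : ℂ) ((y⁻¹ : ℝ) : ℂ)) := by
  have hpow : ∀ x : ℝ, 0 < x → x⁻¹ ^ (α + 1) = x⁻¹ ^ α * x⁻¹ := fun x hx =>
    Real.rpow_add_one (inv_ne_zero hx.ne') α
  rw [hpow x hx, hpow y hy]
  have hx' : (x : ℂ) ≠ 0 := by exact_mod_cast hx.ne'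
  have hy' : (y : ℂ) ≠ 0 := by exact_mod_cast hy.ne'
  split_ifs with h
  · subst h
    have hφ : HasDerivAt (fun x : ℝ => x⁻¹ ^ α) _ x :=
      (hasDerivAt_inv hx.ne').rpow_const (Or.inl (inv_ne_zero hx.ne'))
    rw [(hasDerivAt_comp_ofReal_inv hx hp (ha x hx).hasDerivAt hφ).deriv,
      (hasDerivAt_comp_ofReal_inv hx hq (hg x hx).hasDerivAt hφ).deriv, hp x hx, hq x hx,
      bracket_self]
    push_cast
    field_simp
    ring
  · have hne : ((x⁻¹ : ℝ) : ℂ) ≠ ((y⁻¹ : ℝ) : ℂ) := by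
      rw [Ne, Complex.ofReal_inj, inv_inj]
      exact h
    rw [bracket_of_ne _ _ hne, hp x hx, hp y hy, hq x hx, hq y hy]
    have hxy : (x : ℂ) - y ≠ 0 := sub_ne_zero.2 (by exact_mod_cast h)
    have hinv : ((y⁻¹ : ℝ) : ℂ) - ((x⁻¹ : ℝ) : ℂ) = (x - y) / (x * y) := by
      push_cast
      field_simp
    rw [hinv]
    push_cast
    field_simp

/-- The prefactor of `K_[N]` in the inverse variable. -/
def scaledConst (s : ℂ) (N : ℕ) : ℂ :=
  CNs s N * (((N : ℝ) ^ (-s.re) * Real.exp (Real.pi * s.im / 2) : ℝ) : ℂ) *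
    (((N : ℝ) ^ (-s.re - 1) * Real.exp (Real.pi * s.im / 2) : ℝ) : ℂ)

/-- The prefactor of `K_∞` in the inverse variable. -/
def limConst (s : ℂ) : ℂ :=
  cinf s * (((2 : ℝ) ^ s.re * Real.exp (Real.pi * s.im / 2) : ℝ) : ℂ) *
    ((2 * ((2 : ℝ) ^ s.re * Real.exp (Real.pi * s.im / 2)) : ℝ) : ℂ)

theorem prefac_of_pos (s : ℂ) {x : ℝ} (hx : 0 < x) :
    prefac s x = (((2 : ℝ) ^ s.re * Real.exp (Real.pi * s.im / 2) : ℝ) : ℂ) *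
      (((x⁻¹ ^ s.re : ℝ) : ℂ) * exp (-(I * ((x⁻¹ : ℝ) : ℂ)))) := by
  rw [prefac, Real.sign_of_pos hx, abs_of_pos (by positivity), div_eq_mul_inv,
    Real.mul_rpow zero_le_two (by positivity), Complex.exp_add]
  push_cast
  rw [mul_one, div_eq_mul_inv (-I), neg_mul]
  ring

theorem Ptilde_of_pos (s : ℂ) (x : ℝ) (hx : 0 < x) :
    Ptilde s x = (((2 : ℝ) ^ s.re * Real.exp (Real.pi * s.im / 2) : ℝ) : ℂ) *
      (((x⁻¹ ^ s.re : ℝ) : ℂ) * highInvLim s ((x⁻¹ : ℝ) : ℂ)) := by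
  have h : 2 * I / (x : ℂ) = 2 * (I * ((x⁻¹ : ℝ) : ℂ)) := by
    push_cast
    rw [div_eq_mul_inv, mul_assoc]
  rw [Ptilde, prefac_of_pos s hx, highInvLim, h]
  ring

theorem Qfun_of_pos (s : ℂ) (x : ℝ) (hx : 0 < x) :
    Qfun s x = ((2 * ((2 : ℝ) ^ s.re * Real.exp (Real.pi * s.im / 2)) : ℝ) : ℂ) *
      (((x⁻¹ ^ s.re : ℝ) : ℂ) * lowInvLim s ((x⁻¹ : ℝ) : ℂ)) := by
  have h : 2 * I / (x : ℂ) = 2 * (I * ((x⁻¹ : ℝ) : ℂ)) := by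
    push_cast
    rw [div_eq_mul_inv, mul_assoc]
  rw [Qfun, prefac_of_pos s hx, lowInvLim, h, div_eq_mul_inv 2]
  push_cast
  ring

theorem KinfC_eq_bracket {s : ℂ} (hs : -(1 / 2 : ℝ) < s.re) {x y : ℝ} (hx : 0 < x) (hy : 0 < y) :
    KinfC s x y = limConst s * (((x⁻¹ ^ (s.re + 1) * y⁻¹ ^ (s.re + 1) : ℝ) : ℂ) *
      bracket (highInvLim s) (lowInvLim s) ((x⁻¹ : ℝ) : ℂ) ((y⁻¹ : ℝ) : ℂ)) :=
  kernel_eq_bracket (Ptilde_of_pos s) (Qfun_of_pos s)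
    (fun _ _ => (holoConv_highInv hs).diff_lim.differentiableAt univ_mem)
    (fun _ _ => (holoConv_lowInv hs).diff_lim.differentiableAt univ_mem) hx hy

theorem log_one_add_I_mul {y : ℝ} (hy : 0 < y) :
    log (1 + I * y) = (Real.log y : ℂ) + (Real.pi / 2 * I + log (1 - I * ((y⁻¹ : ℝ) : ℂ))) := by
  have hy' : (y : ℂ) ≠ 0 := by exact_mod_cast hy.ne'
  have h1 : (1 - I * ((y⁻¹ : ℝ) : ℂ)).re = 1 := by simp
  have h0 : 1 - I * ((y⁻¹ : ℝ) : ℂ) ≠ 0 := fun h => by rw [h] at h1; simp at h1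
  have him : (1 - I * ((y⁻¹ : ℝ) : ℂ)).im = -y⁻¹ := by simp
  have harg : (1 - I * ((y⁻¹ : ℝ) : ℂ)).arg < 0 := by
    rw [Complex.arg_neg_iff, him]
    exact neg_neg_of_pos (inv_pos.2 hy)
  have harg' := (Complex.abs_arg_lt_pi_div_two_iff.2
    (Or.inl (show 0 < (1 - I * ((y⁻¹ : ℝ) : ℂ)).re by rw [h1]; exact one_pos)))
  rw [abs_lt] at harg'
  have hfac : 1 + I * y = y * (I * (1 - I * ((y⁻¹ : ℝ) : ℂ))) := by
    push_cast
    field_simp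
    ring_nf
    simp [add_comm]
  rw [hfac, Complex.log_ofReal_mul hy (mul_ne_zero I_ne_zero h0),
    (Complex.log_mul_eq_add_log_iff I_ne_zero h0).2, Complex.log_I]
  rw [Complex.arg_I]
  constructor <;> linarith [Real.pi_pos]

theorem sqrt_wH (s : ℂ) (N : ℕ) (y : ℝ) :
    Real.sqrt (wH s N y) =
      Real.exp ((-s.re - N) * (log (1 + I * y)).re + s.im * (log (1 + I * y)).im) := by
  have hnorm : ‖1 + I * (y : ℂ)‖ ^ 2 = 1 + y ^ 2 := by
    rw [← Complex.normSq_eq_norm_sq, Complex.normSq_apply]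
    simp
    ring
  have hpos : 0 < 1 + y ^ 2 := by positivity
  have hlog : Real.log (1 + y ^ 2) = 2 * (log (1 + I * y)).re := by
    rw [Complex.log_re, ← hnorm, Real.log_pow]
    norm_num
  rw [wH, Real.rpow_def_of_pos hpos, hlog, ← Real.exp_add, ← Complex.log_im,
    Real.sqrt_eq_iff_mul_self_eq (Real.exp_pos _).le (Real.exp_pos _).le, ← Real.exp_add]
  congr 1
  ring

theorem pow_mul_sqrt_wH (s : ℂ) {N : ℕ} (hN : N ≠ 0) {x : ℝ} (hx : 0 < x) :
    (((N * x : ℝ) : ℂ) - I) ^ N * ((Real.sqrt (wH s N (N * x)) : ℝ) : ℂ) =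
      (((N : ℝ) ^ (-s.re) * Real.exp (Real.pi * s.im / 2) : ℝ) : ℂ) *
        (((x⁻¹ ^ s.re : ℝ) : ℂ) * expFactor s N ((x⁻¹ : ℝ) : ℂ)) := by
  have hN' : (0 : ℝ) < N := by exact_mod_cast Nat.pos_of_ne_zero hN
  have hNC : (N : ℂ) ≠ 0 := by exact_mod_cast hN
  have hxC : (x : ℂ) ≠ 0 := by exact_mod_cast hx.ne'
  set y : ℝ := N * x with hy
  have hy0 : 0 < y := by positivity
  have hyC : (y : ℂ) ≠ 0 := by exact_mod_cast hy0.ne'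
  have hu : I * ((x⁻¹ : ℝ) : ℂ) / N = I * ((y⁻¹ : ℝ) : ℂ) := by
    rw [hy]
    push_cast
    field_simp
  set w : ℂ := 1 - I * ((y⁻¹ : ℝ) : ℂ) with hw
  have hwre : w.re = 1 := by simp [hw]
  have hw0 : w ≠ 0 := fun h => by rw [h] at hwre; simp at hwre
  have hwslit : w ∈ slitPlane := Or.inl (by rw [hwre]; exact one_pos)
  have hconj : 1 + I * ((y⁻¹ : ℝ) : ℂ) = (starRingEnd ℂ) w := by
    rw [hw, map_sub, map_mul, Complex.conj_ofReal, Complex.conj_I, map_one]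
    ring
  have hfac : (y : ℂ) - I = exp ((Real.log y : ℂ) + log w) := by
    rw [Complex.exp_add, ← Complex.ofReal_exp, Real.exp_log hy0, Complex.exp_log hw0, hw]
    push_cast
    field_simp
  have hlogy : Real.log y = Real.log N + Real.log x := Real.log_mul hN'.ne' hx.ne'
  rw [sqrt_wH, log_one_add_I_mul hy0, ← hw, hfac, ← Complex.exp_nat_mul, expFactor, hu, ← hw, hconj,
    Complex.log_conj _ (slitPlane_arg_ne_pi hwslit), Real.rpow_def_of_pos hN',
    Real.rpow_def_of_pos (inv_pos.2 hx), Real.log_inv, hlogy]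
  set l : ℂ := log w with hl
  rw [← Real.exp_add, Complex.ofReal_exp, Complex.ofReal_exp, Complex.ofReal_exp, ← Complex.exp_add,
    ← Complex.exp_add, ← Complex.exp_add]
  congr 1
  generalize Real.log N = A
  generalize Real.log x = B
  apply Complex.ext
  · simp
    ring
  · simp
    ring

theorem twoF1neg_arg_eq {N : ℕ} (hN : N ≠ 0) {x : ℝ} (hx : 0 < x) :
    2 / (1 + I * ((N * x : ℝ) : ℂ)) = cayleyVar N ((x⁻¹ : ℝ) : ℂ) := by
  have hNC : (N : ℂ) ≠ 0 := by exact_mod_cast hN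
  have hxC : (x : ℂ) ≠ 0 := by exact_mod_cast hx.ne'
  have h1 : (1 + I * ((N * x : ℝ) : ℂ)) ≠ 0 := fun h => by
    have := congrArg Complex.re h
    simp at this
  have h2 : 1 + I * ((N * x : ℝ) : ℂ) = I * (N * x * (1 - I * ((x⁻¹ : ℝ) : ℂ) / N)) := by
    push_cast
    field_simp
    ring_nf
    simp [add_comm]
  have h3 : 1 - I * ((x⁻¹ : ℝ) : ℂ) / N ≠ 0 := fun h => h1 (by rw [h2, h]; simp)
  rw [cayleyVar, div_eq_div_iff h1 h3, h2]
  push_cast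
  field_simp
  ring_nf
  simp [sub_eq_add_neg]

theorem phiN_of_pos (s : ℂ) {N : ℕ} (hN : N ≠ 0) (x : ℝ) (hx : 0 < x) :
    phiN s N (N * x) = (((N : ℝ) ^ (-s.re) * Real.exp (Real.pi * s.im / 2) : ℝ) : ℂ) *
      (((x⁻¹ ^ s.re : ℝ) : ℂ) * highInv s N ((x⁻¹ : ℝ) : ℂ)) := by
  have h := pow_mul_sqrt_wH s hN hx
  rw [phiN, pTil, twoF1neg_arg_eq hN hx, mul_right_comm, h, highInv]
  ring

theorem psiN_of_pos (s : ℂ) {N : ℕ} (hN : N ≠ 0) (x : ℝ) (hx : 0 < x) :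
    psiN s N (N * x) = (((N : ℝ) ^ (-s.re - 1) * Real.exp (Real.pi * s.im / 2) : ℝ) : ℂ) *
      (((x⁻¹ ^ s.re : ℝ) : ℂ) * lowInv s N ((x⁻¹ : ℝ) : ℂ)) := by
  have hN' : (0 : ℝ) < N := by exact_mod_cast Nat.pos_of_ne_zero hN
  have hNC : (N : ℂ) ≠ 0 := by exact_mod_cast hN
  have hxC : (x : ℂ) ≠ 0 := by exact_mod_cast hx.ne'
  have h := pow_mul_sqrt_wH s hN hx
  have h0 : ((N * x : ℝ) : ℂ) - I ≠ 0 := fun h => by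
    have := congrArg Complex.im h
    simp at this
  have h2 : ((N * x : ℝ) : ℂ) - I = N * x * (1 - I * ((x⁻¹ : ℝ) : ℂ) / N) := by
    push_cast
    field_simp
  have h3 : 1 - I * ((x⁻¹ : ℝ) : ℂ) / N ≠ 0 := fun h => h0 (by rw [h2, h]; simp)
  obtain ⟨m, rfl⟩ := Nat.exists_eq_succ_of_ne_zero hN
  have hpow := pow_succ (((((m + 1 : ℕ) : ℝ) * x : ℝ) : ℂ) - I) m
  rw [Nat.succ_eq_add_one] at *
  rw [hpow, h2, mul_right_comm] at h
  rw [psiN, pPrev, twoF1neg_arg_eq hN hx, mul_right_comm, Nat.add_sub_cancel, h2,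
    eq_div_of_mul_eq (mul_ne_zero (mul_ne_zero hNC hxC) h3) h, lowInv, Nat.add_sub_cancel,
    Real.rpow_sub_one hN'.ne']
  generalize expFactor s (m + 1) ((x⁻¹ : ℝ) : ℂ) = e
  generalize twoF1neg _ _ _ _ = T
  generalize 1 - I * ((x⁻¹ : ℝ) : ℂ) / ((m + 1 : ℕ) : ℂ) = w at h3 ⊢
  generalize m + 1 = N at hNC ⊢
  generalize (N : ℝ) ^ (-s.re) = A
  push_cast
  field_simp

/-! ### Convergence of the constants -/

theorem tendsto_Gamma_add_natCast_div {z : ℂ} (hz : 0 < z.re) :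
    Tendsto (fun N : ℕ => Gamma (z + N) / (Gamma N * (N : ℂ) ^ z)) atTop (nhds 1) := by
  have hΓ : Gamma z ≠ 0 := Gamma_ne_zero_of_re_pos hz
  have h := (tendsto_const_nhds (x := Gamma z)).div (GammaSeq_tendsto_Gamma z) hΓ
  have h2 : Tendsto (fun N : ℕ => (N : ℂ) / (N + z)) atTop (nhds 1) :=
    tendsto_natCast_div_add_atTop z
  rw [div_self hΓ] at h
  have h3 := h.mul h2
  rw [one_mul] at h3
  refine h3.congr' ?_
  filter_upwards [eventually_ne_atTop 0] with N hN
  have hG := Gamma_add_natCast hz N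
  have hpoch : ∏ j ∈ Finset.range (N + 1), (z + j) = poch z N * (z + N) := poch_succ z N
  have hN' : (N : ℂ) ≠ 0 := by exact_mod_cast hN
  have hzN : z + N ≠ 0 := fun h => by
    have := congrArg Complex.re h
    simp at this
    have : (0 : ℝ) ≤ N := N.cast_nonneg
    linarith
  have hpow : (N : ℂ) ^ z ≠ 0 := by
    rw [Ne, Complex.cpow_eq_zero_iff]
    exact fun h => hN' h.1
  have hfact : (N.factorial : ℂ) = N * Gamma N := by
    rw [← Complex.Gamma_nat_eq_factorial, Complex.Gamma_add_one _ hN']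
  have hΓN : Gamma (N : ℂ) ≠ 0 := fun h => by
    rw [h, mul_zero] at hfact
    exact N.factorial_ne_zero (by exact_mod_cast hfact)
  rw [Pi.div_apply, GammaSeq, hpoch, hfact, hG, add_comm (N : ℂ) z]
  have := poch_ne_zero hz N
  field_simp

theorem scaledConst_eq (s : ℂ) {N : ℕ} (hN : N ≠ 0) : scaledConst s N = limConst s *
    (Gamma (((2 * s.re + 1 : ℝ) : ℂ) + N) / (Gamma N * (N : ℂ) ^ ((2 * s.re + 1 : ℝ) : ℂ))) := by
  have hN' : (0 : ℝ) < N := by exact_mod_cast Nat.pos_of_ne_zero hN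
  have hpow : (N : ℂ) ^ ((2 * s.re + 1 : ℝ) : ℂ) = (((N : ℝ) ^ (2 * s.re + 1) : ℝ) : ℂ) := by
    rw [Complex.ofReal_cpow hN'.le, Complex.ofReal_natCast]
  have hmul : (N : ℝ) ^ (-s.re) * (N : ℝ) ^ (-s.re - 1) = ((N : ℝ) ^ (2 * s.re + 1))⁻¹ := by
    rw [← Real.rpow_add hN', ← Real.rpow_neg hN'.le]
    ring_nf
  have htwo : (2 : ℝ) ^ (2 * s.re) = (2 : ℝ) ^ s.re * (2 : ℝ) ^ s.re := by
    rw [← Real.rpow_add zero_lt_two, two_mul]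
  have hmul' := congrArg (fun x : ℝ => (x : ℂ)) hmul
  have hadd : ((2 * s.re + N + 1 : ℝ) : ℂ) = ((2 * s.re + 1 : ℝ) : ℂ) + N := by
    push_cast
    ring
  rw [scaledConst, limConst, CNs, cinf, hpow, htwo, hadd]
  simp only [Complex.ofReal_mul, Complex.ofReal_inv, Complex.ofReal_div, Complex.ofReal_ofNat]
    at hmul' ⊢
  generalize Gamma _ = G1
  generalize (((N : ℝ) ^ (-s.re) : ℝ) : ℂ) = A at hmul' ⊢
  generalize (((N : ℝ) ^ (-s.re - 1) : ℝ) : ℂ) = B at hmul' ⊢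
  rw [div_eq_mul_inv _ (Gamma (N : ℂ) * _), mul_inv (Gamma (N : ℂ)), ← hmul']
  ring

theorem tendsto_scaledConst {s : ℂ} (hs : -(1 / 2 : ℝ) < s.re) :
    Tendsto (scaledConst s) atTop (nhds (limConst s)) := by
  have h := (tendsto_Gamma_add_natCast_div (z := ((2 * s.re + 1 : ℝ) : ℂ))
    (by rw [Complex.ofReal_re]; linarith)).const_mul (limConst s)
  rw [mul_one] at h
  refine h.congr' ?_
  filter_upwards [eventually_ne_atTop 0] with N hN using (scaledConst_eq s hN).symm

/-! ### The rescaled kernel and its limit -/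

theorem ofReal_Kscaled {s : ℂ} (hs : -(1 / 2 : ℝ) < s.re) {N : ℕ} (hN : N ≠ 0) {x y : ℝ}
    (hx : 0 < x) (hy : 0 < y) : ((Kscaled s N x y : ℝ) : ℂ) =
      scaledConst s N * (((x⁻¹ ^ (s.re + 1) * y⁻¹ ^ (s.re + 1) : ℝ) : ℂ) *
        bracket (highInv s N) (lowInv s N) ((x⁻¹ : ℝ) : ℂ) ((y⁻¹ : ℝ) : ℂ)) := by
  have hN' : (N : ℝ) ≠ 0 := by exact_mod_cast hN
  have hNC : (N : ℂ) ≠ 0 := by exact_mod_cast hN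
  have hdom : ∀ x : ℝ, 0 < x → ((x⁻¹ : ℝ) : ℂ) ∈ invDomain N := fun x hx =>
    re_pos_mem_invDomain hN (by rw [Complex.ofReal_re]; positivity)
  rw [scaledConst, ← kernel_eq_bracket (C := CNs s N) (fun x hx => phiN_of_pos s hN x hx)
    (fun x hx => psiN_of_pos s hN x hx)
    (fun x hx => differentiableAt_highInv (hdom x hx).1 (hdom x hx).2)
    (fun x hx => differentiableAt_lowInv (hdom x hx).1 (hdom x hx).2) hx hy]
  obtain ⟨n, rfl⟩ := Nat.exists_eq_succ_of_ne_zero hN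
  rw [Kscaled, Complex.ofReal_mul, ofReal_KN hs, KNC]
  simp only [mul_right_inj' hN', Nat.succ_eq_add_one, deriv_comp_mul_left]
  split_ifs with h
  · simp only [Complex.real_smul, Complex.ofReal_natCast]
    ring
  · have hxy : (x : ℂ) - y ≠ 0 := sub_ne_zero.2 (by exact_mod_cast h)
    push_cast at hNC ⊢
    rw [← mul_sub]
    field_simp

theorem tendsto_Kscaled {s : ℂ} (hs : -(1 / 2 : ℝ) < s.re) {x y : ℝ} (hx : 0 < x) (hy : 0 < y) :
    Tendsto (fun N : ℕ => ((Kscaled s N x y : ℝ) : ℂ)) atTop (nhds (KinfC s x y)) := by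
  rw [KinfC_eq_bracket hs hx hy]
  refine ((tendsto_scaledConst hs).mul (((holoConv_highInv hs).tendsto_bracket
    (holoConv_lowInv hs) _ _).const_mul _)).congr' ?_
  filter_upwards [eventually_ne_atTop 0] with N hN using (ofReal_Kscaled hs hN hx hy).symm

theorem ofReal_Kinf {s : ℂ} (hs : -(1 / 2 : ℝ) < s.re) {x y : ℝ} (hx : 0 < x) (hy : 0 < y) :
    ((Kinf s x y : ℝ) : ℂ) =
      limConst s * (((x⁻¹ ^ (s.re + 1) * y⁻¹ ^ (s.re + 1) : ℝ) : ℂ) *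
        bracket (highInvLim s) (lowInvLim s) ((x⁻¹ : ℝ) : ℂ) ((y⁻¹ : ℝ) : ℂ)) := by
  have h := (Complex.continuous_im.tendsto _).comp (tendsto_Kscaled hs hx hy)
  have h0 : (KinfC s x y).im = 0 := tendsto_nhds_unique h (by simp [Function.comp_def])
  rw [← KinfC_eq_bracket hs hx hy, Kinf]
  exact Complex.ext (by simp) (by simp [h0])

/-! ### The Fredholm determinants as boundary values of holomorphic functions -/

/-- The holomorphic function restricting to `τ ↦ F_N(τ⁻¹)`. -/
def detExt (s : ℂ) (N : ℕ) : ℂ → ℂ := tailDet s.re (scaledConst s N) (highInv s N) (lowInv s N)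

/-- The holomorphic function restricting to `τ ↦ F_∞(τ⁻¹)`. -/
def detExtLim (s : ℂ) : ℂ → ℂ := tailDet s.re (limConst s) (highInvLim s) (lowInvLim s)

theorem holoConv_detExt {s : ℂ} (hs : -(1 / 2 : ℝ) < s.re) :
    HoloConv (detExt s) (detExtLim s) {τ | 0 < τ.re} :=
  HoloConv.tailDet hs (tendsto_scaledConst hs) (holoConv_highInv hs) (holoConv_lowInv hs)

theorem differentiableOn_detExt {s : ℂ} (hs : -(1 / 2 : ℝ) < s.re) {N : ℕ} (hN : N ≠ 0) :
    DifferentiableOn ℂ (detExt s N) {τ | 0 < τ.re} :=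
  differentiableOn_tailDet hs _ (isOpen_invDomain N) (zero_mem_invDomain N)
    (fun _ => re_pos_mem_invDomain hN) (differentiableOn_highInv s N) (differentiableOn_lowInv s N)

theorem ofReal_fredholmDet_Kscaled_inv {s : ℂ} (hs : -(1 / 2 : ℝ) < s.re) {N : ℕ} (hN : N ≠ 0)
    (τ : ℝ) (hτ : 0 < τ) : ((fredholmDet (Kscaled s N) τ⁻¹ : ℝ) : ℂ) = detExt s N τ :=
  ofReal_fredholmDet_inv (fun _ _ => ofReal_Kscaled hs hN) hτ

theorem ofReal_fredholmDet_Kinf_inv {s : ℂ} (hs : -(1 / 2 : ℝ) < s.re)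
    (τ : ℝ) (hτ : 0 < τ) : ((fredholmDet (Kinf s) τ⁻¹ : ℝ) : ℂ) = detExtLim s τ :=
  ofReal_fredholmDet_inv (fun _ _ => ofReal_Kinf hs) hτ

theorem tendsto_fredholmDet_Kscaled {s : ℂ} (hs : -(1 / 2 : ℝ) < s.re) {t : ℝ} (ht : 0 < t) :
    Tendsto (fun n : ℕ => fredholmDet (Kscaled s (n + 1)) t) atTop
      (nhds (fredholmDet (Kinf s) t)) := by
  have ht' : 0 < t⁻¹ := inv_pos.2 ht
  have h := ((holoConv_detExt hs).lim (t⁻¹ : ℝ) (by simpa using ht')).comp (tendsto_add_atTop_nat 1)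
  rw [← ofReal_fredholmDet_Kinf_inv hs _ ht', inv_inv] at h
  refine ((Complex.continuous_re.tendsto _).comp h).congr fun n => ?_
  rw [Function.comp_apply, Function.comp_apply,
    ← ofReal_fredholmDet_Kscaled_inv hs n.succ_ne_zero _ ht', inv_inv, Complex.ofReal_re]

theorem fredholmDet_Kscaled_ne_zero {s : ℂ} (hs : -(1 / 2 : ℝ) < s.re) {N : ℕ} (hN : N ≠ 0)
    (t : ℝ) (ht : 0 < t) : fredholmDet (Kscaled s N) t ≠ 0 := by
  obtain ⟨n, rfl⟩ := Nat.exists_eq_succ_of_ne_zero hN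
  obtain ⟨h0, hmono⟩ := fredholmDet_Kscaled_nonneg_monotone hs n
  exact fredholmDet_ne_zero_of_monotone hs _ (isOpen_invDomain _) (zero_mem_invDomain _)
    (fun _ => re_pos_mem_invDomain hN) (differentiableOn_highInv s _) (differentiableOn_lowInv s _)
    (ofReal_fredholmDet_Kscaled_inv hs hN) (fun t _ => h0 t) (fun _ _ _ h => hmono h) ht

theorem fredholmDet_Kinf_ne_zero {s : ℂ} (hs : -(1 / 2 : ℝ) < s.re) (t : ℝ) (ht : 0 < t) :
    fredholmDet (Kinf s) t ≠ 0 :=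
  fredholmDet_ne_zero_of_monotone hs _ isOpen_univ (mem_univ _) (fun _ _ => mem_univ _)
    (holoConv_highInv hs).diff_lim (holoConv_lowInv hs).diff_lim
    (ofReal_fredholmDet_Kinf_inv hs)
    (fun _ ht => ge_of_tendsto' (tendsto_fredholmDet_Kscaled hs ht)
      fun n => (fredholmDet_Kscaled_nonneg_monotone hs n).1 _)
    (fun _ _ ht h => le_of_tendsto_of_tendsto' (tendsto_fredholmDet_Kscaled hs ht)
      (tendsto_fredholmDet_Kscaled hs (ht.trans_le h))
      fun n => (fredholmDet_Kscaled_nonneg_monotone hs n).2 h) ht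

/-- For `Re(s) > −1/2` the Fredholm determinants `F_N` (of `K_[N]`) and
`F_∞` (of `K_∞`) never vanish on `(0,∞)`; hence `θ_N(τ) = τ (d/dτ) log F_N(τ⁻¹)
= −F_N′(τ⁻¹)/(τ F_N(τ⁻¹))` is well defined and `C²` on `(0,∞)` for all `N ∈ ℕ ∪ {∞}`,
and for `p ∈ {0,1,2}` and `τ > 0`, `θ_N^{(p)}(τ) → θ_∞^{(p)}(τ)` as `N → ∞`. -/
theorem theta_derivatives_converge (s : ℂ) (hs : -(1 / 2 : ℝ) < s.re) :
    (∀ N : ℕ, 1 ≤ N → ∀ t : ℝ, 0 < t → fredholmDet (Kscaled s N) t ≠ 0) ∧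
    (∀ t : ℝ, 0 < t → fredholmDet (Kinf s) t ≠ 0) ∧
    (∀ N : ℕ, 1 ≤ N → ∀ τ : ℝ, 0 < τ →
      thetaOf (fredholmDet (Kscaled s N)) τ =
        -deriv (fredholmDet (Kscaled s N)) τ⁻¹ / (τ * fredholmDet (Kscaled s N) τ⁻¹)) ∧
    (∀ τ : ℝ, 0 < τ →
      thetaOf (fredholmDet (Kinf s)) τ =
        -deriv (fredholmDet (Kinf s)) τ⁻¹ / (τ * fredholmDet (Kinf s) τ⁻¹)) ∧
    (∀ N : ℕ, 1 ≤ N → ContDiffOn ℝ 2 (thetaOf (fredholmDet (Kscaled s N))) (Set.Ioi 0)) ∧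
    ContDiffOn ℝ 2 (thetaOf (fredholmDet (Kinf s))) (Set.Ioi 0) ∧
    ∀ p : ℕ, p ≤ 2 → ∀ τ : ℝ, 0 < τ →
      Filter.Tendsto
        (fun N : ℕ =>
          iteratedDerivWithin p (thetaOf (fredholmDet (Kscaled s N))) (Set.Ioi 0) τ)
        Filter.atTop
        (nhds (iteratedDerivWithin p (thetaOf (fredholmDet (Kinf s))) (Set.Ioi 0) τ)) := by
  have hG := fun {N : ℕ} (hN : N ≠ 0) => differentiableOn_detExt hs hN
  have hF := fun {N : ℕ} (hN : N ≠ 0) => ofReal_fredholmDet_Kscaled_inv hs hN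
  have hF0 := fun {N : ℕ} (hN : N ≠ 0) => fredholmDet_Kscaled_ne_zero hs hN
  have hG' := (holoConv_detExt hs).diff_lim
  have hF' := ofReal_fredholmDet_Kinf_inv hs
  have hF0' := fredholmDet_Kinf_ne_zero hs
  refine ⟨fun N hN => hF0 (Nat.ne_zero_of_lt hN), hF0',
    fun N hN τ hτ => ?_, fun τ hτ => thetaOf_eq_deriv hG' hF' hF0' hτ,
    fun N hN => ?_, ?_, fun p _ τ hτ => ?_⟩
  · have hN := Nat.ne_zero_of_lt hN
    exact thetaOf_eq_deriv (hG hN) (hF hN) (hF0 hN) hτ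
  · have hN := Nat.ne_zero_of_lt hN
    exact contDiffOn_of_eq_re (isOpen_ne_zero (hG hN))
      (fun x hx => ofReal_mem_ne_zero (hF hN) (hF0 hN) hx)
      (differentiableOn_logDerivMul (hG hN))
      fun x hx => thetaOf_eq_re (hG hN) (hF hN) (hF0 hN) hx
  · exact contDiffOn_of_eq_re (isOpen_ne_zero hG')
      (fun x hx => ofReal_mem_ne_zero hF' hF0' hx) (differentiableOn_logDerivMul hG')
      fun x hx => thetaOf_eq_re hG' hF' hF0' hx
  · have hlim := ((holoConv_detExt hs).logDerivMul.iterate_deriv (isOpen_ne_zero hG') p).lim τ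
      (ofReal_mem_ne_zero hF' hF0' hτ)
    rw [iteratedDerivWithin_eq_re (isOpen_ne_zero hG')
      (fun x hx => ofReal_mem_ne_zero hF' hF0' hx) (differentiableOn_logDerivMul hG')
      (fun x hx => thetaOf_eq_re hG' hF' hF0' hx) p hτ]
    refine ((Complex.continuous_re.tendsto _).comp hlim).congr' ?_
    filter_upwards [eventually_ne_atTop 0] with N hN
    exact (iteratedDerivWithin_eq_re (isOpen_ne_zero (hG hN))
      (fun x hx => ofReal_mem_ne_zero (hF hN) (hF0 hN) hx) (differentiableOn_logDerivMul (hG hN))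
      (fun x hx => thetaOf_eq_re (hG hN) (hF hN) (hF0 hN) hx) p hτ).symm
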